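/- Let q be a power of an odd prime p, let n be an even integer with 6 ≤ n ≤ 16, and let L = PSp_{2n}(q). Let G be a finite group with ω(G) = ω(L) that is not an almost simple group with socle isomorphic to L. Let K be the solvable radical of G (the largest solvable normal subgroup of G), and suppose there is an injective homomorphism from G/K into Aut(S) whose image contains Inn(S), where S = PSL_m(u) for an even integer m and a prime power u > 3 whose characteristic v is different from p. Then (u−1) divides m and k_{2n}(q) divides k_{m−1}(u). -/

import Mathlib

/-- The spectrum of a group `G`: the set of element orders of `G`. -/
def elementOrders (G : Type*) [Monoid G] : Set ℕ := {n | ∃ g : G, orderOf g = n}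

/-- `PSL n F`: the projective special linear group over `F`,
i.e. the quotient of `SL_n(F)` by its center. -/
abbrev PSL (n : ℕ) (F : Type*) [Field F] :=
  Matrix.SpecialLinearGroup (Fin n) F ⧸
    Subgroup.center (Matrix.SpecialLinearGroup (Fin n) F)

/-- `PSp n F`: the projective symplectic group, i.e. the quotient of the
symplectic group `Sp_{2n}(F)` (2n×2n matrices preserving the standard symplectic
form) by its center. -/
abbrev PSp (n : ℕ) (F : Type*) [Field F] :=
  Matrix.symplecticGroup (Fin n) F ⧸
    Subgroup.center (Matrix.symplecticGroup (Fin n) F)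

/-- `G` is an almost simple group with socle isomorphic to `L`: there is an
injective homomorphism `ι : G → Aut L` whose image contains the inner
automorphisms `Inn L`. -/
def IsAlmostSimpleWithSocle (G : Type*) [Group G] (L : Type*) [Group L] : Prop :=
  ∃ ι : G →* MulAut L, Function.Injective ι ∧ (MulAut.conj (G := L)).range ≤ ι.range

/-- `kpart i q`: the product, with multiplicities, of all primitive prime
divisors of `q^i - 1`, i.e. of the primes `r` such that the multiplicative
order of `q` modulo `r` equals `i`. -/
noncomputable def kpart (i q : ℕ) : ℕ :=
  (q ^ i - 1).factorization.prod fun r m =>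
    if orderOf ((q : ZMod r)) = i then r ^ m else 1

open scoped Pointwise in
theorem exists_sylow_frattini {G : Type*} [Group G] [Finite G] (W : Subgroup G) (p : ℕ)
    [Fact p.Prime] :
    ∃ P : Subgroup G, P ≤ W ∧ IsPGroup p P ∧ (p ∣ Nat.card W → P ≠ ⊥) ∧
      (¬ p ∣ P.relIndex W) ∧
      ∀ g ∈ Subgroup.normalizer (W : Set G), ∃ w ∈ W, w * g ∈ Subgroup.normalizer (P : Set G) := by
  obtain ⟨Q⟩ : Nonempty (Sylow p W) := inferInstance
  refine ⟨(Q : Subgroup W).map W.subtype, ?_, Q.2.map _, ?_, ?_, ?_⟩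
  · rintro _ ⟨x, _, rfl⟩
    exact x.2
  · intro h h0
    rw [Subgroup.map_eq_bot_iff_of_injective _ W.subtype_injective] at h0
    exact Q.ne_bot_of_dvd_card h h0
  · have h1 := Q.not_dvd_index
    have : ((Q : Subgroup W).map W.subtype).relIndex W = (Q : Subgroup W).index := by
      rw [Subgroup.relIndex]
      congr 1
      exact Subgroup.comap_map_eq_self_of_injective W.subtype_injective _
    rwa [this]
  · intro g hg
    set f : MulAut W := Subgroup.normalizerMonoidHom W ⟨g, hg⟩ with hf
    obtain ⟨w, hw⟩ := MulAction.exists_smul_eq W (f • Q) Q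
    refine ⟨w, w.2, ?_⟩
    rw [Subgroup.mem_normalizer_iff]
    have key : ∀ x : W, x ∈ (Q : Subgroup W) ↔ (MulAut.conj w * f) x ∈ (Q : Subgroup W) := by
      intro x
      have h2 : (MulAut.conj w * f) • Q = Q := by
        rw [mul_smul]; exact hw
      constructor
      · intro hx
        have : (MulAut.conj w * f) • x ∈ (MulAut.conj w * f) • (Q : Subgroup W) :=
          Subgroup.smul_mem_pointwise_smul _ _ _ hx
        rw [← Sylow.pointwise_smul_def, h2] at this
        exact this
      · intro hx
        have : (MulAut.conj w * f) • x ∈ (MulAut.conj w * f) • (Q : Subgroup W) := by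
          rw [← Sylow.pointwise_smul_def, h2]
          exact hx
        exact (Subgroup.smul_mem_pointwise_smul_iff).1 this
    have hval : ∀ x : W, (((MulAut.conj w * f) x : W) : G) = (w * g) * x * (w * g)⁻¹ := by
      intro x
      have h5 : ((f x : W) : G) = g * x * g⁻¹ := rfl
      rw [MulAut.mul_apply, MulAut.conj_apply]
      push_cast
      rw [h5]
      group
    intro h
    constructor
    · rintro ⟨x, hx, rfl⟩
      exact ⟨_, (key x).1 hx, hval x⟩
    · rintro ⟨y, hy, hy2⟩
      have hyW : h ∈ W := by
        have h3 : (w * g) * h * (w * g)⁻¹ ∈ W := by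
          rw [← hy2]; exact y.2
        have hwg : (w : G) * g ∈ Subgroup.normalizer (W : Set G) :=
          mul_mem (Subgroup.le_normalizer w.2) hg
        exact (Subgroup.mem_normalizer_iff.1 hwg h).2 h3
      refine ⟨⟨h, hyW⟩, (key _).2 ?_, rfl⟩
      have : (MulAut.conj w * f) ⟨h, hyW⟩ = y := by
        apply Subtype.ext
        rw [hval]; exact hy2.symm
      rw [this]; exact hy

theorem exists_orderOf_of_dvd {G : Type*} [Group G] [Finite G] (H : Subgroup G) {r : ℕ}
    (x : G) (hx : x ∈ H) (h : r ∣ orderOf x) : ∃ y ∈ H, orderOf y = r := by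
  obtain ⟨c, hc⟩ := h
  have h0 := orderOf_pos x
  refine ⟨x ^ c, pow_mem hx c, ?_⟩
  have hc0 : c ≠ 0 := by
    rintro rfl
    omega
  rw [orderOf_pow_of_dvd hc0 ⟨r, by rw [hc, mul_comm]⟩, hc]
  exact Nat.mul_div_cancel _ (Nat.pos_of_ne_zero hc0)

theorem mul_dvd_orderOf_mul {G : Type*} [Group G] {x y : G} {t s : ℕ} (hx : orderOf x = t)
    (hy : orderOf y = s) (hco : t.Coprime s) (h : Commute x y) : t * s ∣ orderOf (x * y) := by
  rw [h.orderOf_mul_eq_mul_orderOf_of_coprime (by rwa [hx, hy]), hx, hy]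

theorem prod_fpf_eq_one {H V : Type*} [Group H] [CommGroup V] (α : H →* MulAut V)
    (T X : Subgroup H) [Finite T] [Finite X]
    (hnorm : ∀ y ∈ X, ∀ τ ∈ T, y * τ * y⁻¹ ∈ T)
    (fixT : ∀ v, (∀ τ ∈ T, α τ v = v) → v = 1)
    (fixX : ∀ v, (∀ τ ∈ X, α τ v = v) → v = 1)
    (fix : ∀ y ∈ X, y ≠ 1 → ∀ τ ∈ T, y * τ = τ * y → τ = 1) (v : V) :
    v ^ Nat.card T = 1 := by
  classical
  have := Fintype.ofFinite T
  have := Fintype.ofFinite X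
  have hN : ∀ (Y : Subgroup H) [Fintype Y], (∀ v, (∀ τ ∈ Y, α τ v = v) → v = 1) →
      ∀ v, ∏ τ : Y, α τ v = 1 := by
    intro Y _ hY v
    apply hY
    intro τ hτ
    rw [map_prod]
    refine Fintype.prod_equiv (Equiv.mulLeft (⟨τ, hτ⟩ : Y)) _ _ ?_
    intro x
    simp [MulAut.mul_apply]
  have h1 : ∏ τ : T, ∏ y : X, α (τ * y * (τ : H)⁻¹) v = 1 := by
    apply Finset.prod_eq_one
    intro τ _
    have := hN X fixX (α (τ : H)⁻¹ v)
    simp only [map_mul, MulAut.mul_apply]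
    rw [← map_prod, this, map_one]
  rw [Finset.prod_comm, Fintype.prod_eq_single (1 : X)] at h1
  · simpa [Nat.card_eq_fintype_card] using h1
  · intro y hy
    have hy1 : (y : H) ≠ 1 := by simpa using hy
    have hmem : ∀ τ : T, (τ : H) * y * (τ : H)⁻¹ * (y : H)⁻¹ ∈ T := by
      intro τ
      have := mul_mem τ.2 (hnorm y y.2 _ (inv_mem τ.2))
      simpa [mul_assoc] using this
    let f : T → T := fun τ => ⟨_, hmem τ⟩
    have hf : Function.Injective f := by
      intro τ σ h
      have h2 : (τ : H) * y * (τ : H)⁻¹ * (y : H)⁻¹ = (σ : H) * y * (σ : H)⁻¹ * (y : H)⁻¹ :=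
        congrArg Subtype.val h
      have h3 : (τ : H) * y * (τ : H)⁻¹ = (σ : H) * y * (σ : H)⁻¹ := mul_right_cancel h2
      have h4 := fix y y.2 hy1 ((σ : H)⁻¹ * τ) (mul_mem (inv_mem σ.2) τ.2) (by
        have : (σ : H)⁻¹ * ((τ : H) * y * (τ : H)⁻¹) * τ = (σ : H)⁻¹ * ((σ : H) * y *
            (σ : H)⁻¹) * τ := by
          rw [h3]
        simp only [mul_assoc, inv_mul_cancel, mul_one, inv_mul_cancel_left] at this
        simp only [mul_assoc]
        exact this.symm)
      exact Subtype.ext (inv_mul_eq_one.1 h4).symm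
    have hb : Function.Bijective f := Finite.injective_iff_bijective.1 hf
    rw [← hN T fixT (α y v)]
    refine Fintype.prod_bijective f hb _ _ ?_
    intro τ
    rw [← MulAut.mul_apply, ← map_mul]
    simp [f, mul_assoc]

theorem eq_one_of_isPGroup_pow {V : Type*} [Group V] {t : ℕ} (ht : t.Prime)
    (hV : IsPGroup t V) {n : ℕ} (hn : ¬ t ∣ n) (v : V) (h : v ^ n = 1) : v = 1 := by
  obtain ⟨k, hk⟩ := hV v
  have h1 := orderOf_dvd_of_pow_eq_one h
  have h2 := orderOf_dvd_of_pow_eq_one hk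
  have : Nat.Coprime n (t ^ k) := Nat.Coprime.pow_right _
      ((Nat.Prime.coprime_iff_not_dvd ht).2 hn).symm
  exact orderOf_eq_one_iff.1 (Nat.eq_one_of_dvd_coprimes this h1 h2)

def Nonadjacent (G : Type*) [Group G] (t s : ℕ) : Prop := ∀ g : G, ¬ t * s ∣ orderOf g

theorem Nonadjacent.symm {G : Type*} [Group G] {t s : ℕ} (h : Nonadjacent G t s) :
    Nonadjacent G s t := fun g hg => h g (by rwa [mul_comm])

theorem Nonadjacent.of_surjective {G H : Type*} [Group G] [Group H] {t s : ℕ}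
    (h : Nonadjacent G t s) (f : G →* H) (hf : Function.Surjective f) : Nonadjacent H t s := by
  intro x hx
  obtain ⟨y, rfl⟩ := hf x
  exact h y (hx.trans (orderOf_map_dvd f y))

theorem Nonadjacent.not_commute {G : Type*} [Group G] [Finite G] {t s : ℕ}
    (h : Nonadjacent G t s) (hco : t.Coprime s) {a b : G} (ha : t ∣ orderOf a)
    (hb : s ∣ orderOf b) (hab : a * b = b * a) : False := by
  obtain ⟨c, hc⟩ := ha
  obtain ⟨d, hd⟩ := hb
  have ha0 := orderOf_pos a
  have hb0 := orderOf_pos b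
  have hc0 : c ≠ 0 := by rintro rfl; omega
  have hd0 : d ≠ 0 := by rintro rfl; omega
  have h1 : orderOf (a ^ c) = t := by
    rw [orderOf_pow_of_dvd hc0 ⟨t, by rw [hc, mul_comm]⟩, hc]
    exact Nat.mul_div_cancel _ (Nat.pos_of_ne_zero hc0)
  have h2 : orderOf (b ^ d) = s := by
    rw [orderOf_pow_of_dvd hd0 ⟨s, by rw [hd, mul_comm]⟩, hd]
    exact Nat.mul_div_cancel _ (Nat.pos_of_ne_zero hd0)
  exact h _ (mul_dvd_orderOf_mul h1 h2 hco ((show Commute a b from hab).pow_pow c d))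

theorem dvd_orderOf_of_isPGroup {G : Type*} [Group G] {p : ℕ} (hp : p.Prime) {P : Subgroup G}
    (hP : IsPGroup p P) {a : G} (ha : a ∈ P) (h1 : a ≠ 1) : p ∣ orderOf a := by
  obtain ⟨k, hk⟩ := hP ⟨a, ha⟩
  have h2 : a ^ p ^ k = 1 := congrArg Subtype.val hk
  obtain ⟨j, _, hj⟩ := (Nat.dvd_prime_pow hp).1 (orderOf_dvd_of_pow_eq_one h2)
  rw [hj]
  apply dvd_pow_self
  rintro rfl
  exact h1 (orderOf_eq_one_iff.1 (by simpa using hj))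

theorem exists_central_subgroup {G : Type*} [Group G] [Finite G] {p : ℕ} (hp : p.Prime)
    {P : Subgroup G} (hP : IsPGroup p P) (h : P ≠ ⊥) :
    ∃ Z : Subgroup G, Z ≤ P ∧ Z ≠ ⊥ ∧ (∀ a ∈ Z, ∀ b ∈ P, a * b = b * a) ∧
      Subgroup.normalizer (P : Set G) ≤ Subgroup.normalizer (Z : Set G) := by
  have := Fact.mk hp
  have hnt : Nontrivial P := (Subgroup.nontrivial_iff_ne_bot P).2 h
  have hmem : ∀ a : G, a ∈ (Subgroup.center P).map P.subtype ↔ a ∈ P ∧ ∀ b ∈ P, a * b = b * a := by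
    intro a
    constructor
    · rintro ⟨x, hx, rfl⟩
      refine ⟨x.2, fun b hb => ?_⟩
      exact (congrArg Subtype.val (Subgroup.mem_center_iff.1 hx ⟨b, hb⟩)).symm
    · rintro ⟨ha, hb⟩
      refine ⟨⟨a, ha⟩, Subgroup.mem_center_iff.2 fun b => Subtype.ext (hb b b.2).symm, rfl⟩
  refine ⟨(Subgroup.center P).map P.subtype, ?_, ?_, ?_, ?_⟩
  · exact fun a ha => ((hmem a).1 ha).1
  · intro h0
    rw [Subgroup.map_eq_bot_iff_of_injective _ P.subtype_injective] at h0
    have := hP.center_nontrivial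
    exact (Subgroup.nontrivial_iff_ne_bot _).1 this h0
  · exact fun a ha => ((hmem a).1 ha).2
  · intro g hg
    have key : ∀ g ∈ Subgroup.normalizer (P : Set G), ∀ a ∈ (Subgroup.center P).map P.subtype,
        g * a * g⁻¹ ∈ (Subgroup.center P).map P.subtype := by
      intro g hg a ha
      rw [hmem] at ha ⊢
      refine ⟨(Subgroup.mem_normalizer_iff.1 hg a).1 ha.1, fun b hb => ?_⟩
      have hb' : g⁻¹ * b * g ∈ P := by
        have := (Subgroup.mem_normalizer_iff.1 (inv_mem hg) b).1 hb
        simpa using this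
      have h1 := ha.2 _ hb'
      have h2 : g * (a * (g⁻¹ * b * g)) * g⁻¹ = g * ((g⁻¹ * b * g) * a) * g⁻¹ := by rw [h1]
      simpa [mul_assoc] using h2
    rw [Subgroup.mem_normalizer_iff]
    intro a
    refine ⟨key g hg a, fun h => ?_⟩
    have := key g⁻¹ (inv_mem hg) _ h
    simpa [mul_assoc] using this

theorem pow_card_eq_one_of_fpf {G : Type*} [Group G] (Z T X : Subgroup G) [Finite T] [Finite X]
    (hZ : ∀ a ∈ Z, ∀ b ∈ Z, a * b = b * a)
    (hTZ : T ≤ Subgroup.normalizer (Z : Set G)) (hXZ : X ≤ Subgroup.normalizer (Z : Set G))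
    (hnorm : ∀ y ∈ X, ∀ τ ∈ T, y * τ * y⁻¹ ∈ T)
    (fixT : ∀ v ∈ Z, (∀ τ ∈ T, τ * v = v * τ) → v = 1)
    (fixX : ∀ v ∈ Z, (∀ τ ∈ X, τ * v = v * τ) → v = 1)
    (fix : ∀ y ∈ X, y ≠ 1 → ∀ τ ∈ T, y * τ = τ * y → τ = 1) (v : G) (hv : v ∈ Z) :
    v ^ Nat.card T = 1 := by
  let _ : CommGroup Z := { (inferInstance : Group Z) with
    mul_comm := fun a b => Subtype.ext (hZ a a.2 b b.2) }
  set N := Subgroup.normalizer (Z : Set G)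
  let α : N →* MulAut Z := Subgroup.normalizerMonoidHom Z
  have hα : ∀ (h : N) (w : Z), α h w = w → (h : G) * w = w * h := by
    intro h w hw
    have h1 : ((α h w : Z) : G) = h * w * (h : G)⁻¹ := rfl
    rw [hw] at h1
    exact (eq_mul_inv_iff_mul_eq.1 h1).symm
  have : Finite (T.subgroupOf N) :=
    Finite.of_injective (fun x : T.subgroupOf N => (⟨x.1.1, x.2⟩ : T))
      (fun a b hab => Subtype.ext (Subtype.ext (congrArg (fun z : T => (z : G)) hab)))
  have : Finite (X.subgroupOf N) :=
    Finite.of_injective (fun x : X.subgroupOf N => (⟨x.1.1, x.2⟩ : X))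
      (fun a b hab => Subtype.ext (Subtype.ext (congrArg (fun z : X => (z : G)) hab)))
  have key := prod_fpf_eq_one α (T.subgroupOf N) (X.subgroupOf N)
    (fun y hy τ hτ => hnorm y hy τ hτ)
    (fun w hw => Subtype.ext (fixT w w.2 fun τ hτ => hα ⟨τ, hTZ hτ⟩ w (hw _ hτ)))
    (fun w hw => Subtype.ext (fixX w w.2 fun τ hτ => hα ⟨τ, hXZ hτ⟩ w (hw _ hτ)))
    (fun y hy hy1 τ hτ h => Subtype.ext (fix y hy (fun h1 => hy1 (Subtype.ext h1)) τ hτ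
      (congrArg Subtype.val h))) ⟨v, hv⟩
  rw [Nat.card_congr (Subgroup.subgroupOfEquivOfLe hTZ).toEquiv] at key
  exact congrArg Subtype.val key

theorem false_of_three_step {G : Type*} [Group G] [Finite G] (K W : Subgroup G) [K.Normal]
    [W.Normal] (hKW : K ≤ W) {t0 t1 t2 : ℕ} (p0 : t0.Prime) (p1 : t1.Prime) (p2 : t2.Prime)
    (h01 : t0 ≠ t1) (h02 : t0 ≠ t2) (h12 : t1 ≠ t2)
    (n01 : Nonadjacent G t0 t1) (n02 : Nonadjacent G t0 t2) (n12 : Nonadjacent G t1 t2)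
    (d0 : t0 ∣ Nat.card K) (d1 : ∃ w ∈ W, t1 ∣ orderOf (w : G ⧸ K))
    (d2 : ∃ g : G, t2 ∣ orderOf (g : G ⧸ W)) : False := by
  have := Fact.mk p0
  have := Fact.mk p1
  obtain ⟨T0, hT0K, hT0, hT0ne, -, fr0⟩ := exists_sylow_frattini K t0
  have fr0 : ∀ g : G, ∃ w ∈ K, w * g ∈ Subgroup.normalizer (T0 : Set G) := fun g =>
    fr0 g (by rw [Subgroup.normalizer_eq_top]; trivial)
  set N0 := Subgroup.normalizer (T0 : Set G) with hN0
  obtain ⟨T1, hT1, hT1p, hT1ne, -, fr1⟩ := exists_sylow_frattini (W ⊓ N0) t1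
  have hmk : ∀ (M : Subgroup G) [M.Normal] (k g : G), k ∈ M → orderOf
      ((k * g : G) : G ⧸ M) = orderOf (g : G ⧸ M) := by
    intro M _ k g hk
    rw [QuotientGroup.mk_mul, (QuotientGroup.eq_one_iff k).2 hk, one_mul]
  have hdvd : ∀ (M : Subgroup G) [M.Normal] (g : G), orderOf (g : G ⧸ M) ∣ orderOf g :=
    fun M _ g => orderOf_map_dvd (QuotientGroup.mk' M) g
  obtain ⟨w, hw, hw1⟩ := d1
  obtain ⟨k, hk, hkw⟩ := fr0 w
  have e1 : t1 ∣ Nat.card ↥(W ⊓ N0) := by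
    have hmem : k * w ∈ W ⊓ N0 := ⟨mul_mem (hKW hk) hw, hkw⟩
    refine ((hw1.trans ?_).trans (hdvd K (k * w))).trans ?_
    · rw [hmk K k w hk]
    · rw [← Subgroup.orderOf_mk _ hmem]
      exact orderOf_dvd_natCard _
  have hT1ne := hT1ne e1
  obtain ⟨g, hg⟩ := d2
  obtain ⟨k2, hk2, hk2g⟩ := fr0 g
  obtain ⟨w2, hw2, hw2g⟩ := fr1 (k2 * g) (by
    rw [Subgroup.mem_normalizer_iff]
    intro h
    have a1 : h ∈ W ↔ (k2 * g) * h * (k2 * g)⁻¹ ∈ W := by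
      constructor
      · exact fun h1 => Subgroup.Normal.conj_mem ‹_› h h1 _
      · intro h1
        have := Subgroup.Normal.conj_mem ‹_› _ h1 (k2 * g)⁻¹
        simpa [mul_assoc] using this
    have a2 : h ∈ N0 ↔ (k2 * g) * h * (k2 * g)⁻¹ ∈ N0 := by
      rw [mul_mem_cancel_right (inv_mem hk2g), mul_mem_cancel_left hk2g]
    rw [Subgroup.mem_inf, Subgroup.mem_inf, ← a1, ← a2])
  have e2 : t2 ∣ orderOf (w2 * (k2 * g)) := by
    refine (hg.trans ?_).trans (hdvd W _)
    rw [hmk W w2 _ hw2.1, hmk W k2 _ (hKW hk2)]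
  obtain ⟨x, hx, hxo⟩ := exists_orderOf_of_dvd (N0 ⊓ Subgroup.normalizer (T1 : Set G)) _
    ⟨mul_mem hw2.2 hk2g, hw2g⟩ e2
  obtain ⟨Z, hZT, hZne, hZc, hZn⟩ := exists_central_subgroup p0 hT0 (hT0ne d0)
  have hX : ∀ y ∈ Subgroup.zpowers x, y ≠ 1 → t2 ∣ orderOf y := by
    intro y hy hy1
    have : IsPGroup t2 (Subgroup.zpowers x) := IsPGroup.of_card (n := 1) (by rw [Nat.card_zpowers,
        hxo, pow_one])
    exact dvd_orderOf_of_isPGroup p2 this hy hy1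
  have hXN : Subgroup.zpowers x ≤ N0 ⊓ Subgroup.normalizer (T1 : Set G) := by
    rwa [Subgroup.zpowers_le]
  have c01 := (Nat.coprime_primes p0 p1).2 h01
  have c02 := (Nat.coprime_primes p0 p2).2 h02
  have c12 := (Nat.coprime_primes p1 p2).2 h12
  obtain ⟨v, hv, hv1⟩ := Z.bot_or_exists_ne_one.resolve_left hZne
  have hZ0 : ∀ v ∈ Z, v ≠ 1 → t0 ∣ orderOf v := fun v hv h1 =>
    dvd_orderOf_of_isPGroup p0 hT0 (hZT hv) h1
  have hT1o : ∀ v ∈ T1, v ≠ 1 → t1 ∣ orderOf v := fun v hv h1 =>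
    dvd_orderOf_of_isPGroup p1 hT1p hv h1
  obtain ⟨τ, hτ, hτ1⟩ := T1.bot_or_exists_ne_one.resolve_left hT1ne
  have hx1 : x ≠ 1 := by
    rintro rfl
    rw [orderOf_one] at hxo
    exact p2.one_lt.ne hxo
  have key := pow_card_eq_one_of_fpf Z T1 (Subgroup.zpowers x) (fun a ha b hb => hZc a ha b
      (hZT hb))
    ((hT1.trans inf_le_right).trans hZn) ((hXN.trans inf_le_left).trans hZn)
    (fun y hy τ hτ => (Subgroup.mem_normalizer_iff.1 (hXN hy).2 τ).1 hτ)
    (fun v hv h => by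
      by_contra hv1
      exact n01.not_commute c01 (hZ0 v hv hv1) (hT1o τ hτ hτ1) (h τ hτ).symm)
    (fun v hv h => by
      by_contra hv1
      exact n02.not_commute c02 (hZ0 v hv hv1) (hX x (Subgroup.mem_zpowers x) hx1)
        (h x (Subgroup.mem_zpowers x)).symm)
    (fun y hy hy1 τ hτ h => by
      by_contra hτ1
      exact n12.not_commute c12 (hT1o τ hτ hτ1) (hX y hy hy1) h.symm) v hv
  obtain ⟨j, hj⟩ := IsPGroup.iff_card.1 hT1p
  rw [hj] at key
  have := eq_one_of_isPGroup_pow p0 hT0 (n := t1 ^ j) (fun h => h01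
      ((Nat.prime_dvd_prime_iff_eq p0 p1).1 (p0.dvd_of_dvd_pow h)))
    ⟨v, hZT hv⟩ (Subtype.ext key)
  exact hv1 (congrArg Subtype.val this)

def iterDerived {G : Type*} [Group G] (K : Subgroup G) : ℕ → Subgroup G
  | 0 => K
  | i + 1 => ⁅iterDerived K i, iterDerived K i⁆

theorem iterDerived_normal {G : Type*} [Group G] (K : Subgroup G) [K.Normal] :
    ∀ i, (iterDerived K i).Normal
  | 0 => ‹K.Normal›
  | i + 1 => by
    have := iterDerived_normal K i
    exact Subgroup.commutator_normal _ _

theorem iterDerived_eq_map {G : Type*} [Group G] (K : Subgroup G) :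
    ∀ i, iterDerived K i = (derivedSeries K i).map K.subtype
  | 0 => by simp [iterDerived, ← MonoidHom.range_eq_map]
  | i + 1 => by
    rw [iterDerived, derivedSeries_succ, Subgroup.map_commutator, iterDerived_eq_map K i]

theorem iterDerived_le {G : Type*} [Group G] (K : Subgroup G) (i : ℕ) : iterDerived K i ≤ K := by
  rw [iterDerived_eq_map]
  rintro _ ⟨x, -, rfl⟩
  exact x.2

/-- A normal subgroup inside `K` that has an abelian section above it, chosen as large as
possible with `P` failing. -/
theorem exists_abelian_section {G : Type*} [Group G] (K : Subgroup G) [K.Normal]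
    [Group.IsSolvable K]
    (P : Subgroup G → Prop) (hK : P K) (hbot : ¬ P ⊥) :
    ∃ D M : Subgroup G, D.Normal ∧ M.Normal ∧ M ≤ D ∧ D ≤ K ∧ P D ∧ ¬ P M ∧
      ∀ x ∈ D, ∀ y ∈ D, ((x * y : G) : G ⧸ M) = ((y * x : G) : G ⧸ M) := by
  classical
  have hex : ∃ i, ¬ P (iterDerived K i) := by
    obtain ⟨i, hi⟩ := (Group.isSolvable_def K).1 ‹_›
    refine ⟨i, ?_⟩
    rw [iterDerived_eq_map, hi, Subgroup.map_bot]
    exact hbot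
  obtain ⟨j, hj⟩ : ∃ j, Nat.find hex = j + 1 := by
    refine Nat.exists_eq_succ_of_ne_zero fun h0 => ?_
    have := Nat.find_spec hex
    rw [h0] at this
    exact this hK
  have h1 := Nat.find_spec hex
  rw [hj] at h1
  have h2 : P (iterDerived K j) := not_not.1 (Nat.find_min hex (m := j) (by omega))
  have n1 := iterDerived_normal K j
  refine ⟨iterDerived K j, iterDerived K (j + 1), n1, iterDerived_normal K _,
    Subgroup.commutator_le_right _ _, iterDerived_le K j, h2, h1, fun x hx y hy => ?_⟩
  have n2 := iterDerived_normal K (j + 1)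
  rw [QuotientGroup.eq]
  have := Subgroup.commutator_mem_commutator (inv_mem hy) (inv_mem hx)
  rw [commutatorElement_def] at this
  simpa [iterDerived, mul_assoc] using this

theorem exists_orderOf_quotient_dvd {G : Type*} [Group G] [Finite G] {D M : Subgroup G} [M.Normal]
    {t : ℕ} (ht : t.Prime) (hD : t ∣ Nat.card D) (hM : ¬ t ∣ Nat.card M) :
    ∃ x ∈ D, t ∣ orderOf (x : G ⧸ M) := by
  have := Fact.mk ht
  obtain ⟨x, hx⟩ := exists_prime_orderOf_dvd_card' t hD
  refine ⟨x, x.2, ?_⟩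
  have hx' : orderOf (x : G) = t := by rwa [Subgroup.orderOf_coe]
  have h1 : orderOf ((x : G) : G ⧸ M) ∣ t := by
    rw [← hx']
    exact orderOf_map_dvd (QuotientGroup.mk' M) (x : G)
  rcases (Nat.dvd_prime ht).1 h1 with h | h
  · exfalso
    rw [orderOf_eq_one_iff, QuotientGroup.eq_one_iff] at h
    apply hM
    have h3 := orderOf_dvd_natCard (⟨x, h⟩ : M)
    rwa [Subgroup.orderOf_mk, hx'] at h3
  · rw [h]

theorem exists_split {G : Type*} [Group G] [Finite G] (K : Subgroup G) [K.Normal]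
    [Group.IsSolvable K]
    {t s : ℕ} (pt : t.Prime) (ps : s.Prime) (hts : t ≠ s) (hn : Nonadjacent G t s)
    (ht : t ∣ Nat.card K) (hs : s ∣ Nat.card K) :
    ∃ M : Subgroup G, ∃ _ : M.Normal, M ≤ K ∧
      ((t ∣ Nat.card M ∧ ∃ x ∈ K, s ∣ orderOf (x : G ⧸ M)) ∨
       (s ∣ Nat.card M ∧ ∃ x ∈ K, t ∣ orderOf (x : G ⧸ M))) := by
  obtain ⟨D, M, hD, hM, hMD, hDK, hPD, hPM, hab⟩ := exists_abelian_section K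
    (fun D => t ∣ Nat.card D ∧ s ∣ Nat.card D) ⟨ht, hs⟩ (by
      rintro ⟨h, -⟩
      rw [Subgroup.card_bot] at h
      exact pt.one_lt.ne' (Nat.dvd_one.1 h))
  refine ⟨M, hM, hMD.trans hDK, ?_⟩
  by_cases h1 : t ∣ Nat.card M
  · left
    obtain ⟨x, hx, h⟩ := exists_orderOf_quotient_dvd ps hPD.2 (fun h => hPM ⟨h1, h⟩)
    exact ⟨h1, x, hDK hx, h⟩
  · obtain ⟨x, hx, hxt⟩ := exists_orderOf_quotient_dvd pt hPD.1 h1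
    by_cases h2 : s ∣ Nat.card M
    · exact Or.inr ⟨h2, x, hDK hx, hxt⟩
    · exfalso
      obtain ⟨y, hy, hys⟩ := exists_orderOf_quotient_dvd ps hPD.2 h2
      exact (hn.of_surjective (QuotientGroup.mk' M) (QuotientGroup.mk'_surjective M)).not_commute
        ((Nat.coprime_primes pt ps).2 hts) hxt hys (hab x hx y hy)

/-- Two primes dividing the order of a solvable normal subgroup and a third one dividing the
order of the group cannot be pairwise nonadjacent. -/
theorem false_of_two_in_solvable {G : Type*} [Group G] [Finite G] (K : Subgroup G) [K.Normal]
    [Group.IsSolvable K] {t0 t1 t2 : ℕ} (p0 : t0.Prime) (p1 : t1.Prime) (p2 : t2.Prime)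
    (h01 : t0 ≠ t1) (h02 : t0 ≠ t2) (h12 : t1 ≠ t2)
    (n01 : Nonadjacent G t0 t1) (n02 : Nonadjacent G t0 t2) (n12 : Nonadjacent G t1 t2)
    (d0 : t0 ∣ Nat.card K) (d1 : t1 ∣ Nat.card K) (d2 : t2 ∣ Nat.card G) : False := by
  have step : ∀ (W : Subgroup G) [W.Normal] [Group.IsSolvable W] {a b c : ℕ}, a.Prime → b.Prime →
      c.Prime → a ≠ b → a ≠ c → b ≠ c → Nonadjacent G a b → Nonadjacent G a c →
      Nonadjacent G b c → a ∣ Nat.card W → b ∣ Nat.card W →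
      (∃ g : G, c ∣ orderOf (g : G ⧸ W)) → False := by
    intro W _ _ a b c pa pb pc hab hac hbc nab nac nbc da db dc
    obtain ⟨M, hM, hMW, h | h⟩ := exists_split W pa pb hab nab da db
    · exact false_of_three_step M W hMW pa pb pc hab hac hbc nab nac nbc h.1 h.2 dc
    · exact false_of_three_step M W hMW pb pa pc hab.symm hbc hac nab.symm nbc nac h.1 h.2 dc
  by_cases d2K : t2 ∣ Nat.card K
  · obtain ⟨D, M, hD, hM, hMD, hDK, ⟨e0, e1, e2⟩, hPM, hab⟩ := exists_abelian_section K
      (fun D => t0 ∣ Nat.card D ∧ t1 ∣ Nat.card D ∧ t2 ∣ Nat.card D) ⟨d0, d1, d2K⟩ (by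
        rintro ⟨h, -⟩
        rw [Subgroup.card_bot] at h
        exact p0.one_lt.ne' (Nat.dvd_one.1 h))
    have hMs : Group.IsSolvable M :=
      Group.isSolvable_of_isSolvable_injective (f := Subgroup.inclusion (hMD.trans hDK))
        (Subgroup.inclusion_injective _)
    have comm : ∀ {a b : ℕ}, a.Prime → b.Prime → a ≠ b → Nonadjacent G a b → a ∣ Nat.card D →
        b ∣ Nat.card D → ¬ a ∣ Nat.card M → ¬ b ∣ Nat.card M → False := by
      intro a b pa pb hne hn ha hb ha' hb'
      obtain ⟨x, hx, hxt⟩ := exists_orderOf_quotient_dvd pa ha ha'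
      obtain ⟨y, hy, hys⟩ := exists_orderOf_quotient_dvd pb hb hb'
      exact (hn.of_surjective (QuotientGroup.mk' M) (QuotientGroup.mk'_surjective M)).not_commute
        ((Nat.coprime_primes pa pb).2 hne) hxt hys (hab x hx y hy)
    have top : ∀ {a : ℕ}, a.Prime → a ∣ Nat.card D → ¬ a ∣ Nat.card M →
        ∃ g : G, a ∣ orderOf (g : G ⧸ M) := by
      intro a pa ha ha'
      obtain ⟨x, -, h⟩ := exists_orderOf_quotient_dvd pa ha ha'
      exact ⟨x, h⟩
    by_cases m0 : t0 ∣ Nat.card M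
    · by_cases m1 : t1 ∣ Nat.card M
      · exact step M p0 p1 p2 h01 h02 h12 n01 n02 n12 m0 m1 (top p2 e2 fun m2 => hPM ⟨m0, m1, m2⟩)
      · by_cases m2 : t2 ∣ Nat.card M
        · exact step M p0 p2 p1 h02 h01 h12.symm n02 n01 n12.symm m0 m2 (top p1 e1 m1)
        · exact comm p1 p2 h12 n12 e1 e2 m1 m2
    · by_cases m1 : t1 ∣ Nat.card M
      · by_cases m2 : t2 ∣ Nat.card M
        · exact step M p1 p2 p0 h12 h01.symm h02.symm n12 n01.symm n02.symm m1 m2 (top p0 e0 m0)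
        · exact comm p0 p2 h02 n02 e0 e2 m0 m2
      · exact comm p0 p1 h01 n01 e0 e1 m0 m1
  · obtain ⟨x, -, hx⟩ := exists_orderOf_quotient_dvd (D := ⊤) (M := K) p2
      (by rwa [Subgroup.card_top]) d2K
    exact step K p0 p1 p2 h01 h02 h12 n01 n02 n12 d0 d1 ⟨x, hx⟩

theorem mul_pow_of_central_commutator {P : Type*} [Group P] {a b z : P}
    (hz : ∀ g, z * g = g * z) (h : b * a = a * b * z) (n : ℕ) :
    b ^ n * a = a * b ^ n * z ^ n ∧ (a * b) ^ n = a ^ n * b ^ n * z ^ (n * (n - 1) / 2) := by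
  have hzn : ∀ m g, z ^ m * g = g * z ^ m := fun m g => (Commute.pow_left (hz g) m)
  induction n with
  | zero => simp
  | succ n ih =>
    obtain ⟨h1, h2⟩ := ih
    have e1 : b ^ (n + 1) * a = a * b ^ (n + 1) * z ^ (n + 1) := by
      rw [pow_succ, mul_assoc, h, ← mul_assoc, ← mul_assoc, h1, pow_succ z, mul_assoc (a * b ^ n),
        hzn n b]
      simp only [mul_assoc]
    refine ⟨e1, ?_⟩
    have e3 : (n + 1) * (n + 1 - 1) / 2 = n * (n - 1) / 2 + n := by
      cases n with
      | zero => rfl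
      | succ k =>
        simp only [Nat.add_sub_cancel]
        have : (k + 1 + 1) * (k + 1) = (k + 1) * k + (k + 1) * 2 := by ring
        rw [this, Nat.add_mul_div_right _ _ (by norm_num)]
    rw [pow_succ (a * b), h2, e3, pow_add z]
    calc a ^ n * b ^ n * z ^ (n * (n - 1) / 2) * (a * b)
        = a ^ n * b ^ n * (z ^ (n * (n - 1) / 2) * (a * b)) := by simp only [mul_assoc]
      _ = a ^ n * (b ^ n * a) * b * z ^ (n * (n - 1) / 2) := by
          rw [hzn]; simp only [mul_assoc]
      _ = a ^ n * a * b ^ n * (z ^ n * b) * z ^ (n * (n - 1) / 2) := by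
          rw [h1]; simp only [mul_assoc]
      _ = a ^ (n + 1) * b ^ (n + 1) * (z ^ n * z ^ (n * (n - 1) / 2)) := by
          rw [hzn, pow_succ, pow_succ]; simp only [mul_assoc]
      _ = _ := by rw [hzn n]

theorem normal_and_quotient_of_index_prime {P : Type*} [Group P] [Finite P] {s : ℕ} (hs : s.Prime)
    (hP : IsPGroup s P) (M : Subgroup P) (hM : M.index = s) :
    M.Normal ∧ (∀ a, a ^ s ∈ M) ∧ ∀ a b, b⁻¹ * a⁻¹ * b * a ∈ M := by
  have := Fact.mk hs
  have hn : M.Normal := by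
    apply Subgroup.normal_of_index_eq_minFac_card
    obtain ⟨k, hk⟩ := IsPGroup.iff_card.1 hP
    have hk0 : k ≠ 0 := by
      rintro rfl
      have := M.index_dvd_card
      rw [hM, hk, pow_zero] at this
      exact hs.one_lt.ne' (Nat.dvd_one.1 this)
    rw [hM, hk, hs.pow_minFac hk0]
  have hc : Nat.card (P ⧸ M) = s := hM
  refine ⟨hn, fun a => ?_, fun a b => ?_⟩
  · rw [← QuotientGroup.eq_one_iff, QuotientGroup.mk_pow, ← hc]
    exact pow_card_eq_one'
  · have := isCyclic_of_prime_card hc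
    let _ : CommGroup (P ⧸ M) := IsCyclic.commGroup
    rw [← QuotientGroup.eq_one_iff]
    simp only [QuotientGroup.mk_mul, QuotientGroup.mk_inv]
    rw [mul_comm (b : P ⧸ M)⁻¹]
    simp [mul_assoc]

theorem isCyclic_of_unique_order_prime {s : ℕ} (hs : s.Prime) (hodd : Odd s) (N : ℕ) :
    ∀ (P : Type*) [Group P] [Finite P], Nat.card P = N → IsPGroup s P →
      (∀ x y : P, orderOf x = s → orderOf y = s → y ∈ Subgroup.zpowers x) → IsCyclic P := by
  induction N using Nat.strong_induction_on with
  | _ N ih =>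
  intro P _ _ hN hP hu
  have := Fact.mk hs
  by_contra hcyc
  have hsub : ∀ H : Subgroup P, H ≠ ⊤ → IsCyclic H := by
    intro H hH
    refine ih (Nat.card H) ?_ H rfl (hP.to_subgroup H) ?_
    · rw [← hN]
      refine lt_of_le_of_ne (Subgroup.card_le_card_group H) ?_
      intro h
      exact hH (Subgroup.eq_top_of_card_eq H h)
    · intro x y hx hy
      obtain ⟨k, hk⟩ := hu x y (by rwa [Subgroup.orderOf_coe]) (by rwa [Subgroup.orderOf_coe])
      exact ⟨k, Subtype.ext (by simpa using hk)⟩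
  obtain ⟨n, hn⟩ := IsPGroup.iff_card.1 hP
  have hbig : ∀ H : Subgroup P, H ≠ ⊤ → ∃ M : Subgroup P, H ≤ M ∧ M.index = s := by
    intro H hH
    obtain ⟨k, hk⟩ := IsPGroup.iff_card.1 (hP.to_subgroup H)
    have hkn : k < n := by
      have h1 : Nat.card H < Nat.card P :=
        lt_of_le_of_ne (Subgroup.card_le_card_group H) fun h => hH (Subgroup.eq_top_of_card_eq H h)
      rw [hk, hn] at h1
      exact (Nat.pow_lt_pow_iff_right hs.one_lt).1 h1
    obtain ⟨M, hM, hHM⟩ := Sylow.exists_subgroup_card_pow_prime_le s (n := k) (m := n - 1)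
      (by rw [hn]; exact pow_dvd_pow _ (by omega)) H hk (by omega)
    refine ⟨M, hHM, ?_⟩
    have h2 := M.card_mul_index
    rw [hM, hn] at h2
    have h3 : s ^ n = s ^ (n - 1) * s := by rw [← pow_succ]; congr 1; omega
    rw [h3] at h2
    exact Nat.eq_of_mul_eq_mul_left (pow_pos hs.pos _) h2
  have hne : ∀ x : P, Subgroup.zpowers x ≠ ⊤ := by
    intro x hx
    exact hcyc ⟨x, fun y => show y ∈ Subgroup.zpowers x by rw [hx]; trivial⟩
  obtain ⟨M, -, hM⟩ := hbig _ (hne 1)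
  have hMtop : M ≠ ⊤ := by
    rintro rfl
    rw [Subgroup.index_top] at hM
    exact hs.one_lt.ne hM
  obtain ⟨x, hx⟩ : ∃ x, x ∉ M := by
    by_contra! h
    exact hMtop ((Subgroup.eq_top_iff' M).2 h)
  obtain ⟨M2, hxM2, hM2⟩ := hbig _ (hne x)
  have hM2top : M2 ≠ ⊤ := by
    rintro rfl
    rw [Subgroup.index_top] at hM2
    exact hs.one_lt.ne hM2
  have hxM2 : x ∈ M2 := hxM2 (Subgroup.mem_zpowers x)
  obtain ⟨n1, p1, c1⟩ := normal_and_quotient_of_index_prime hs hP M hM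
  obtain ⟨n2, p2, c2⟩ := normal_and_quotient_of_index_prime hs hP M2 hM2
  have comm : ∀ H : Subgroup P, H ≠ ⊤ → ∀ a ∈ H, ∀ b ∈ H, a * b = b * a := by
    intro H hH a ha b hb
    have := hsub H hH
    let _ : CommGroup H := IsCyclic.commGroup
    exact congrArg Subtype.val (mul_comm (⟨a, ha⟩ : H) ⟨b, hb⟩)
  have hcent : ∀ z ∈ M ⊓ M2, ∀ g, z * g = g * z := by
    intro z hz g
    have hle : M ⊔ M2 ≤ Subgroup.centralizer {z} := by
      rw [sup_le_iff]
      constructor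
      · intro h hh
        rw [Subgroup.mem_centralizer_singleton_iff]
        exact comm M hMtop _ hh _ hz.1
      · intro h hh
        rw [Subgroup.mem_centralizer_singleton_iff]
        exact comm M2 hM2top _ hh _ hz.2
    have htop : M ⊔ M2 = ⊤ := by
      have h1 : (M ⊔ M2).index ∣ s := hM ▸ Subgroup.index_dvd_of_le le_sup_left
      rcases (Nat.dvd_prime hs).1 h1 with h | h
      · exact Subgroup.index_eq_one.1 h
      · exfalso
        have h4 : M.relIndex (M ⊔ M2) *
            (M ⊔ M2).index = M.index := Subgroup.relIndex_mul_index le_sup_left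
        rw [h, hM] at h4
        have h5 : M.relIndex (M ⊔ M2) = 1 := Nat.eq_of_mul_eq_mul_right hs.pos (by rw [h4, one_mul])
        rw [Subgroup.relIndex_eq_one] at h5
        exact hx (h5 ((le_sup_right : M2 ≤ _) hxM2))
    have := hle (htop ▸ Subgroup.mem_top g)
    rw [Subgroup.mem_centralizer_singleton_iff] at this
    exact this.symm
  have hpow : ∀ a b : P, (a * b) ^ s = a ^ s * b ^ s := by
    intro a b
    set z := b⁻¹ * a⁻¹ * b * a with hz
    have hzc := hcent z ⟨c1 a b, c2 a b⟩
    obtain ⟨h1, h2⟩ := mul_pow_of_central_commutator (a := a) (b := b) hzc (by rw [hz]; group) s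
    have h3 : z ^ s = 1 := by
      have := hcent (b ^ s) ⟨p1 b, p2 b⟩ a
      rw [this] at h1
      exact (left_eq_mul.1 h1)
    obtain ⟨k, hk⟩ := hodd
    have h4 : s * (s - 1) / 2 = s * k := by
      have : s * (s - 1) = s * k * 2 := by rw [hk]; simp; ring
      rw [this]; simp
    rw [h2, h4, pow_mul, h3, one_pow, mul_one]
  let f : P →* ↥(M ⊓ M2) :=
    { toFun := fun a => ⟨a ^ s, p1 a, p2 a⟩
      map_one' := by simp
      map_mul' := fun a b => Subtype.ext (hpow a b) }
  have hker : Nat.card f.ker ≤ s := by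
    by_cases h : ∃ x ∈ f.ker, x ≠ 1
    · obtain ⟨x, hx, hx1⟩ := h
      have hord : ∀ y ∈ f.ker, y ≠ 1 → orderOf y = s := by
        intro y hy hy1
        exact orderOf_eq_prime (congrArg Subtype.val hy) hy1
      have hle : f.ker ≤ Subgroup.zpowers x := by
        intro y hy
        by_cases hy1 : y = 1
        · rw [hy1]; exact one_mem _
        · exact hu x y (hord x hx hx1) (hord y hy hy1)
      rw [← hord x hx hx1, ← Nat.card_zpowers]
      exact Subgroup.card_le_of_le hle
    · push Not at h
      have : f.ker = ⊥ := (Subgroup.eq_bot_iff_forall _).2 h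
      rw [this, Subgroup.card_bot]
      exact hs.one_lt.le
  have h1 : Nat.card P = Nat.card f.ker * Nat.card f.range := by
    rw [← Subgroup.card_mul_index f.ker, Subgroup.index_ker]
  have h2 : Nat.card f.range ≤ Nat.card ↥(M ⊓ M2) := Subgroup.card_le_card_group _
  have h3 : Nat.card ↥(M ⊓ M2) * s ≤ Nat.card M := by
    have hri : (M ⊓ M2).relIndex M * Nat.card ↥(M ⊓ M2) = Nat.card M := by
      have := Subgroup.relIndex_mul_relIndex ⊥ (M ⊓ M2) M bot_le inf_le_left
      rwa [Subgroup.relIndex_bot_left, Subgroup.relIndex_bot_left, mul_comm] at this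
    have hne1 : (M ⊓ M2).relIndex M ≠ 1 := by
      intro h
      rw [Subgroup.relIndex_eq_one] at h
      have hle : M ≤ M2 := h.trans inf_le_right
      have h4 : M.relIndex M2 * M2.index = M.index := Subgroup.relIndex_mul_index hle
      rw [hM, hM2] at h4
      have h5 : M.relIndex M2 = 1 := Nat.eq_of_mul_eq_mul_right hs.pos (by rw [h4, one_mul])
      rw [Subgroup.relIndex_eq_one] at h5
      exact hx (h5 hxM2)
    have hsd : s ∣ (M ⊓ M2).relIndex M := by
      obtain ⟨j, hj⟩ := IsPGroup.iff_card.1 (hP.to_subgroup M)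
      have : (M ⊓ M2).relIndex M ∣ s ^ j := hj ▸ ⟨_, hri.symm⟩
      obtain ⟨i, _, hi⟩ := (Nat.dvd_prime_pow hs).1 this
      rw [hi] at hne1 ⊢
      exact dvd_pow_self _ (by rintro rfl; simp at hne1)
    rw [← hri, mul_comm]
    refine Nat.mul_le_mul_right _ (Nat.le_of_dvd ?_ hsd)
    exact Nat.pos_of_ne_zero (by
      intro h0
      rw [h0, zero_mul] at hri
      exact Nat.card_pos.ne hri)
  have h4 : Nat.card M * s = Nat.card P := by rw [← M.card_mul_index, hM]
  have hpos : 0 < Nat.card P := Nat.card_pos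
  have hs3 := hs.two_le
  have h5 : Nat.card P ≤ s * Nat.card ↥(M ⊓ M2) := h1 ▸ Nat.mul_le_mul hker h2
  nlinarith

theorem prod_range_pow_fixed {H V : Type*} [Group H] [CommGroup V] (α : H →* MulAut V) {s : ℕ}
    {w : H} (hw : w ^ s = 1) (hfix : ∀ v, α w v = v → v = 1) (v : V) :
    ∏ j ∈ Finset.range s, α (w ^ j) v = 1 := by
  apply hfix
  rw [map_prod]
  have h : ∀ j, α w (α (w ^ j) v) = α (w ^ (j + 1)) v := fun j => by
    rw [← MulAut.mul_apply, ← map_mul, pow_succ']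
  simp only [h]
  cases s with
  | zero => rfl
  | succ n => rw [Finset.prod_range_succ, Finset.prod_range_succ', hw, pow_zero]

theorem pow_eq_one_of_rank_two_fpf {H V : Type*} [Group H] [CommGroup V] (α : H →* MulAut V)
    {s : ℕ} {z y : H} (hcomm : Commute z y) (hz : z ^ s = 1) (hy : y ^ s = 1) (hs : 0 < s)
    (fz : ∀ j, 0 < j → j < s → ∀ v, α (z ^ j) v = v → v = 1)
    (fy : ∀ i v, α (z ^ i * y) v = v → v = 1) (v : V) : v ^ s = 1 := by
  have h1 : ∏ i ∈ Finset.range s, ∏ j ∈ Finset.range s, α ((z ^ i * y) ^ j) v = 1 := by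
    refine Finset.prod_eq_one fun i _ => ?_
    refine prod_range_pow_fixed α ?_ (fy i) v
    rw [(hcomm.pow_left i).mul_pow, ← pow_mul, mul_comm i, pow_mul, hz, one_pow, one_mul, hy]
  rw [Finset.prod_comm, Finset.prod_eq_single_of_mem 0 (Finset.mem_range.2 hs)] at h1
  · simpa using h1
  · intro j hj hj0
    rw [← prod_range_pow_fixed α (w := z ^ j) (s := s) (by rw [← pow_mul, mul_comm, pow_mul, hz,
        one_pow])
      (fz j (Nat.pos_of_ne_zero hj0) (Finset.mem_range.1 hj)) (α (y ^ j) v)]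
    refine Finset.prod_congr rfl fun i _ => ?_
    rw [← MulAut.mul_apply, ← map_mul, (hcomm.pow_left i).mul_pow, ← pow_mul, ← pow_mul, mul_comm i]

theorem exists_rank_two_of_not_isCyclic {P : Type*} [Group P] [Finite P] {s : ℕ} (hs : s.Prime)
    (hodd : Odd s) (hP : IsPGroup s P) (hc : ¬ IsCyclic P) :
    ∃ z y : P, Commute z y ∧ orderOf z = s ∧ orderOf y = s ∧ y ∉ Subgroup.zpowers z := by
  have := Fact.mk hs
  have h1 : ¬ ∀ x y : P, orderOf x = s → orderOf y = s → y ∈ Subgroup.zpowers x :=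
    fun h => hc (isCyclic_of_unique_order_prime hs hodd _ P rfl hP h)
  push Not at h1
  obtain ⟨x, y, hx, hy, hxy⟩ := h1
  have : Nontrivial P := ⟨x, 1, fun h => by
    rw [h, orderOf_one] at hx
    exact hs.one_lt.ne hx⟩
  have hcn := hP.center_nontrivial
  have hd : s ∣ Nat.card (Subgroup.center P) := by
    obtain ⟨k, hk⟩ := IsPGroup.iff_card.1 (hP.to_subgroup (Subgroup.center P))
    rw [hk]
    apply dvd_pow_self
    rintro rfl
    rw [pow_zero] at hk
    have := Finite.one_lt_card (α := Subgroup.center P)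
    omega
  obtain ⟨c, hc⟩ := exists_prime_orderOf_dvd_card' s hd
  have hc' : orderOf (c : P) = s := by rwa [Subgroup.orderOf_coe]
  have hcomm : ∀ g, Commute (c : P) g := fun g => (Subgroup.mem_center_iff.1 c.2 g).symm
  by_cases h : x ∈ Subgroup.zpowers (c : P)
  · refine ⟨c, y, hcomm y, hc', hy, fun hyc => hxy ?_⟩
    have hle : Subgroup.zpowers x ≤ Subgroup.zpowers (c : P) := by rwa [Subgroup.zpowers_le]
    have : Subgroup.zpowers x = Subgroup.zpowers (c : P) :=
      Subgroup.eq_of_le_of_card_ge hle (by rw [Nat.card_zpowers, Nat.card_zpowers, hx, hc'])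
    rwa [this]
  · exact ⟨c, x, hcomm x, hc', hx, h⟩

theorem not_dvd_card_of_noncyclic_quotient {G : Type*} [Group G] [Finite G] (K : Subgroup G)
    [K.Normal] {t s : ℕ} (pt : t.Prime) (ps : s.Prime) (hts : t ≠ s) (hodd : Odd s)
    (hn : Nonadjacent G t s) (E : Subgroup (G ⧸ K)) (hE : IsPGroup s E) (hEc : ¬ IsCyclic E) :
    ¬ t ∣ Nat.card K := by
  intro htK
  have := Fact.mk pt
  have := Fact.mk ps
  obtain ⟨T0, hT0K, hT0, hT0ne, -, fr0⟩ := exists_sylow_frattini K t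
  have fr0 : ∀ g : G, ∃ w ∈ K, w * g ∈ Subgroup.normalizer (T0 : Set G) := fun g =>
    fr0 g (by rw [Subgroup.normalizer_eq_top]; trivial)
  set N0 := Subgroup.normalizer (T0 : Set G) with hN0
  obtain ⟨Z, hZT, hZne, hZc, hZn⟩ := exists_central_subgroup pt hT0 (hT0ne htK)
  let f : N0 →* G ⧸ K := (QuotientGroup.mk' K).comp N0.subtype
  have hf : Function.Surjective f := by
    intro a
    obtain ⟨g, rfl⟩ := QuotientGroup.mk'_surjective K a
    obtain ⟨k, hk, hkg⟩ := fr0 g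
    refine ⟨⟨k * g, hkg⟩, ?_⟩
    simp [f, (QuotientGroup.eq_one_iff k).2 hk]
  have hg := MonoidHom.subgroupComap_surjective_of_surjective f E hf
  set g := f.subgroupComap E
  obtain ⟨Q⟩ : Nonempty (Sylow s (E.comap f)) := inferInstance
  have hQc : ¬ IsCyclic Q := by
    intro h
    apply hEc
    have htop : (Q.mapSurjective hg : Subgroup E) = ⊤ := by
      have := (Q.mapSurjective hg).3 (Q := ⊤) (by
        intro x
        obtain ⟨k, hk⟩ := hE x.1
        exact ⟨k, Subtype.ext hk⟩) le_top
      exact this.symm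
    refine isCyclic_of_surjective (g.comp (Q : Subgroup (E.comap f)).subtype) ?_
    intro e
    have he : e ∈ (Q.mapSurjective hg : Subgroup E) := by rw [htop]; trivial
    obtain ⟨x, hx, rfl⟩ := he
    exact ⟨⟨x, hx⟩, rfl⟩
  obtain ⟨z, y, hcomm, hz, hy, hyz⟩ := exists_rank_two_of_not_isCyclic ps hodd Q.2 hQc
  let emb : Q →* Subgroup.normalizer (Z : Set G) :=
    (Subgroup.inclusion hZn).comp ((E.comap f).subtype.comp (Q : Subgroup (E.comap f)).subtype)
  have hemb : Function.Injective emb :=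
    (Subgroup.inclusion_injective hZn).comp (Subtype.val_injective.comp Subtype.val_injective)
  let _ : CommGroup Z := { (inferInstance : Group Z) with
    mul_comm := fun a b => Subtype.ext (hZc a a.2 b (hZT b.2)) }
  let α : Subgroup.normalizer (Z : Set G) →* MulAut Z := Subgroup.normalizerMonoidHom Z
  have hα : ∀ (h : Subgroup.normalizer (Z : Set G)) (w : Z), α h w = w → (h : G) * w = w * h := by
    intro h w hw
    have h1 : ((α h w : Z) : G) = h * w * (h : G)⁻¹ := rfl
    rw [hw] at h1
    exact (eq_mul_inv_iff_mul_eq.1 h1).symm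
  have fix : ∀ x : Q, x ≠ 1 → ∀ v, α (emb x) v = v → v = 1 := by
    intro x hx v hv
    by_contra hv1
    have hvo : t ∣ orderOf (v : G) :=
      dvd_orderOf_of_isPGroup pt hT0 (hZT v.2) fun h => hv1 (Subtype.ext h)
    have hxo : s ∣ orderOf ((emb x : Subgroup.normalizer (Z : Set G)) : G) := by
      rw [Subgroup.orderOf_coe, orderOf_injective emb hemb]
      have := dvd_orderOf_of_isPGroup ps Q.2 x.2 (fun h => hx (Subtype.ext h))
      rwa [Subgroup.orderOf_coe] at this
    exact hn.not_commute ((Nat.coprime_primes pt ps).2 hts) hvo hxo (hα _ _ hv).symm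
  obtain ⟨v, hv, hv1⟩ := Z.bot_or_exists_ne_one.resolve_left hZne
  have key := pow_eq_one_of_rank_two_fpf α (s := s) (z := emb z) (y := emb y) (hcomm.map emb)
    (by rw [← map_pow, orderOf_dvd_iff_pow_eq_one.1 hz.dvd, map_one])
    (by rw [← map_pow, orderOf_dvd_iff_pow_eq_one.1 hy.dvd, map_one]) ps.pos
    (fun j hj hjs v hv => fix (z ^ j) (pow_ne_one_of_lt_orderOf hj.ne' (by rwa [hz])) v
      (by rwa [map_pow]))
    (fun i v hv => fix (z ^ i * y) (fun h => hyz (by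
      rw [eq_inv_of_mul_eq_one_right h]
      exact inv_mem (pow_mem (Subgroup.mem_zpowers z) i))) v (by rwa [map_mul, map_pow])) ⟨v, hv⟩
  have key' : v ^ s = 1 := congrArg Subtype.val key
  have := eq_one_of_isPGroup_pow pt hT0 (n := s)
    (fun h => hts ((Nat.prime_dvd_prime_iff_eq pt ps).1 h))
    ⟨v, hZT hv⟩ (Subtype.ext key')
  exact hv1 (congrArg Subtype.val this)

theorem factorization_kpart (i q : ℕ) :
    (kpart i q).factorization =
      ((q ^ i - 1).factorization).filter (fun r => orderOf (q : ZMod r) = i) := by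
  classical
  have h : kpart i q = (((q ^ i - 1).factorization).filter
      (fun r => orderOf (q : ZMod r) = i)).prod (fun r m => r ^ m) := by
    rw [kpart, Finsupp.prod, Finsupp.prod, Finsupp.support_filter, Finset.prod_filter]
    refine Finset.prod_congr rfl fun r _ => ?_
    by_cases hr : orderOf (q : ZMod r) = i
    · rw [if_pos hr, if_pos hr, Finsupp.filter_apply_pos (fun r : ℕ => orderOf
        (q : ZMod r) = i) _ hr]
    · rw [if_neg hr, if_neg hr]
  rw [h]
  refine Nat.prod_pow_factorization_eq_self fun p hp => ?_
  rw [Finsupp.support_filter, Finset.mem_filter] at hp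
  exact Nat.prime_of_mem_primeFactors (by simpa using hp.1)

theorem kpart_ne_zero (i q : ℕ) : kpart i q ≠ 0 := by
  rw [kpart, Finsupp.prod, Finset.prod_ne_zero_iff]
  intro r hr
  have : r.Prime := Nat.prime_of_mem_primeFactors (by simpa using hr)
  split_ifs
  · exact pow_ne_zero _ this.ne_zero
  · exact one_ne_zero

theorem prime_pow_dvd_kpart_iff {i q r k : ℕ} (hr : r.Prime) (hk : k ≠ 0) (hi : i ≠ 0)
    (hq : 2 ≤ q) : r ^ k ∣ kpart i q ↔ orderOf (q : ZMod r) = i ∧ r ^ k ∣ q ^ i - 1 := by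
  have h0 : q ^ i - 1 ≠ 0 := by
    have : 1 < q ^ i := Nat.one_lt_pow hi (by omega)
    omega
  rw [hr.pow_dvd_iff_le_factorization (kpart_ne_zero i q), hr.pow_dvd_iff_le_factorization h0,
    factorization_kpart]
  by_cases h : orderOf (q : ZMod r) = i
  · rw [Finsupp.filter_apply_pos (fun r : ℕ => orderOf (q : ZMod r) = i) _ h]
    simp [h]
  · rw [Finsupp.filter_apply_neg (fun r : ℕ => orderOf (q : ZMod r) = i) _ h]
    simp [h, hk]

theorem dvd_pow_sub_one_iff {r q j : ℕ} (hq : 1 ≤ q) :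
    r ∣ q ^ j - 1 ↔ orderOf (q : ZMod r) ∣ j := by
  rw [orderOf_dvd_iff_pow_eq_one, show (q : ZMod r) ^ j = 1 ↔ ((q ^ j : ℕ) : ZMod r) =
      ((1 : ℕ) : ZMod r)
    by push_cast; rfl, ZMod.natCast_eq_natCast_iff,
    Nat.ModEq.comm, Nat.modEq_iff_dvd' (Nat.one_le_pow _ _ hq)]

theorem prime_dvd_kpart_iff {i q r : ℕ} (hr : r.Prime) (hi : i ≠ 0) (hq : 2 ≤ q) :
    r ∣ kpart i q ↔ orderOf (q : ZMod r) = i := by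
  have := prime_pow_dvd_kpart_iff (k := 1) hr one_ne_zero hi hq
  rw [pow_one] at this
  rw [this, and_iff_left_iff_imp]
  intro h
  rw [dvd_pow_sub_one_iff (by omega), h]

theorem kpart_dvd_of_forall {i q N : ℕ} (hi : i ≠ 0) (hq : 2 ≤ q)
    (h : ∀ r k, r.Prime → k ≠ 0 → orderOf (q : ZMod r) = i → r ^ k ∣ q ^ i - 1 → r ^ k ∣ N) :
    kpart i q ∣ N := by
  refine (Nat.dvd_iff_prime_pow_dvd_dvd _ _).2 fun r k hr hk => ?_
  rcases eq_or_ne k 0 with rfl | hk0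
  · simp
  · obtain ⟨h1, h2⟩ := (prime_pow_dvd_kpart_iff hr hk0 hi hq).1 hk
    exact h r k hr hk0 h1 h2

theorem kpart_dvd_pow_sub_one {i q : ℕ} (hi : i ≠ 0) (hq : 2 ≤ q) : kpart i q ∣ q ^ i - 1 :=
  kpart_dvd_of_forall hi hq fun _ _ _ _ _ h => h

theorem prime_pow_dvd_pow_add_one {j q r k : ℕ} (hr : r.Prime) (hj : j ≠ 0)
    (hq : 1 ≤ q) (h : orderOf (q : ZMod r) = 2 * j) (hd : r ^ k ∣ q ^ (2 * j) - 1) :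
    r ^ k ∣ q ^ j + 1 := by
  have h1 : q ^ (2 * j) - 1 = (q ^ j + 1) * (q ^ j - 1) := by
    rw [mul_comm 2, pow_mul, ← Nat.sq_sub_sq, one_pow]
  rw [h1] at hd
  refine Nat.Coprime.dvd_of_dvd_mul_right (Nat.Coprime.pow_left k ?_) hd
  rw [hr.coprime_iff_not_dvd, dvd_pow_sub_one_iff hq, h]
  intro h2
  have := Nat.le_of_dvd (Nat.pos_of_ne_zero hj) h2
  omega

theorem kpart_two_mul_dvd {j q : ℕ} (hj : j ≠ 0) (hq : 2 ≤ q) : kpart (2 * j) q ∣ q ^ j + 1 :=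
  kpart_dvd_of_forall (by omega) hq fun _ _ hr _ h1 h2 =>
    prime_pow_dvd_pow_add_one hr hj (by omega) h1 h2

theorem orderOf_natCast_zmod_two {q : ℕ} (hq : Odd q) : orderOf (q : ZMod 2) = 1 := by
  rw [orderOf_eq_one_iff, ZMod.natCast_eq_one_iff_odd]
  exact hq

theorem odd_kpart {i q : ℕ} (hi : 2 ≤ i) (hq : 2 ≤ q) (hodd : Odd q) : Odd (kpart i q) := by
  rw [← Nat.not_even_iff_odd, even_iff_two_dvd, prime_dvd_kpart_iff Nat.prime_two (by omega) hq,
    orderOf_natCast_zmod_two hodd]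
  omega

open Polynomial in
theorem cyclotomic_eval_mul_dvd {q r j : ℕ} (hr : r.Prime) (hj : j ≠ 0) :
    ((q : ℤ) ^ j - 1) * (cyclotomic (r * j) ℤ).eval (q : ℤ) ∣ (q : ℤ) ^ (r * j) - 1 := by
  have h := X_pow_sub_one_mul_cyclotomic_dvd_X_pow_sub_one_of_dvd ℤ (d := j) (n := r * j)
    (Nat.mem_properDivisors.2 ⟨Dvd.intro_left r rfl, by
      have := hr.two_le
      nlinarith [Nat.pos_of_ne_zero hj]⟩)
  have := eval_dvd (x := (q : ℤ)) h
  simpa using this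

open Polynomial in
theorem odd_cyclotomic_eval {q j : ℕ} (hq : Odd q) (hj : Odd j) (hj3 : 3 ≤ j) :
    Odd ((cyclotomic (2 * j) ℤ).eval (q : ℤ)) := by
  have h1 : (cyclotomic (2 * j) ℤ).eval (1 : ℤ) = 1 := by
    apply eval_one_cyclotomic_not_prime_pow
    intro p hp k h
    have hk : k ≠ 0 := by
      rintro rfl
      rw [pow_zero] at h
      omega
    have h2 : 2 ∣ p ^ k := h ▸ Dvd.intro _ rfl
    have h3 : p = 2 := ((Nat.prime_dvd_prime_iff_eq Nat.prime_two hp).1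
        (Nat.prime_two.dvd_of_dvd_pow h2)).symm
    subst h3
    obtain ⟨k, rfl⟩ := Nat.exists_eq_succ_of_ne_zero hk
    rw [pow_succ'] at h
    have h4 : 2 ^ k = j := by omega
    rcases k with _ | k
    · simp at h4; omega
    · rw [← h4, pow_succ', Nat.odd_mul] at hj
      exact absurd hj.1 (by decide)
  have h2 : (q : ℤ) - 1 ∣ (cyclotomic (2 * j) ℤ).eval (q : ℤ) - (cyclotomic (2 * j) ℤ).eval 1 :=
    sub_dvd_eval_sub _ _ _
  have h3 : (2 : ℤ) ∣ (q : ℤ) - 1 := by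
    obtain ⟨a, rfl⟩ := hq
    exact ⟨a, by push_cast; ring⟩
  have h4 := h3.trans h2
  rw [h1] at h4
  obtain ⟨c, hc⟩ := h4
  exact ⟨c, by omega⟩

open Polynomial in
theorem not_sq_dvd_cyclotomic_eval {q r i : ℕ} (hr : r.Prime) (hri : r ∣ i) (hi : 3 ≤ i)
    (hq : 2 ≤ q) (hodd : Odd q) : ¬ (r : ℤ) ^ 2 ∣ (cyclotomic i ℤ).eval (q : ℤ) := by
  intro hd
  obtain ⟨j, rfl⟩ := hri
  have hj : j ≠ 0 := by rintro rfl; omega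
  have hmul := cyclotomic_eval_mul_dvd (q := q) hr hj
  have hqj : 1 < q ^ j := Nat.one_lt_pow hj (by omega)
  rcases hr.eq_two_or_odd' with rfl | hr2
  · rcases Nat.even_or_odd j with he | ho
    · have h1 : (q : ℤ) ^ (2 * j) - 1 = ((q : ℤ) ^ j - 1) * ((q : ℤ) ^ j + 1) := by ring
      rw [h1] at hmul
      have h2 := Int.dvd_of_mul_dvd_mul_left (by
        have : (1 : ℤ) < (q : ℤ) ^ j := by exact_mod_cast hqj
        omega) hmul
      have h3 := hd.trans h2
      obtain ⟨a, rfl⟩ := he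
      obtain ⟨b, rfl⟩ := hodd
      obtain ⟨d, hd⟩ : Odd (((2 * b + 1 : ℕ) : ℤ) ^ a) := by
        apply Odd.pow
        exact_mod_cast (⟨b, rfl⟩ : Odd (2 * b + 1))
      rw [pow_add, hd] at h3
      obtain ⟨c, hc⟩ := h3
      have : 4 * (d * d + d) + 2 = 4 * c := by push_cast at hc; linarith
      omega
    · have := odd_cyclotomic_eval hodd ho (by
        obtain ⟨a, rfl⟩ := ho
        omega)
      obtain ⟨c, hc⟩ := this
      have := (dvd_pow_self (((2 : ℕ) : ℤ)) two_ne_zero).trans hd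
      push_cast at this
      omega
  · have := Fact.mk hr
    have e1 : r ∣ q ^ (r * j) - 1 := by
      have h1 : (r : ℤ) ∣ (q : ℤ) ^ (r * j) - 1 :=
        ((dvd_pow_self _ two_ne_zero).trans hd).trans ((Dvd.intro_left _ rfl).trans hmul)
      have h2 : ((q ^ (r * j) - 1 : ℕ) : ℤ) = (q : ℤ) ^ (r * j) - 1 := by
        rw [Nat.cast_sub (Nat.one_le_pow _ _ (by omega))]
        push_cast; rfl
      rw [← h2] at h1
      exact_mod_cast h1
    have e2 : r ∣ q ^ j - 1 := by
      rw [dvd_pow_sub_one_iff (by omega), orderOf_dvd_iff_pow_eq_one] at e1 ⊢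
      rw [mul_comm, pow_mul, ZMod.pow_card] at e1
      exact e1
    have e3 : ¬ r ∣ q ^ j := by
      intro h
      have := (Nat.dvd_sub_iff_right hqj.le h).1 e2
      exact hr.one_lt.ne' (Nat.dvd_one.1 this)
    have e4 := padicValNat.pow_sub_pow (p := r) hr2 hqj e2 e3 (n := r) hr.ne_zero
    rw [one_pow, padicValNat_self, ← pow_mul, mul_comm j] at e4
    have e5 : r ^ (padicValNat r (q ^ j - 1) + 2) ∣ q ^ (r * j) - 1 := by
      have h1 : ((r : ℤ) ^ padicValNat r (q ^ j - 1)) ∣ (q : ℤ) ^ j - 1 := by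
        have : ((q ^ j - 1 : ℕ) : ℤ) = (q : ℤ) ^ j - 1 := by
          rw [Nat.cast_sub hqj.le]
          push_cast; rfl
        rw [← this]
        exact_mod_cast pow_padicValNat_dvd
      have h2 := (mul_dvd_mul h1 hd).trans hmul
      have h3 : ((q ^ (r * j) - 1 : ℕ) : ℤ) = (q : ℤ) ^ (r * j) - 1 := by
        rw [Nat.cast_sub (Nat.one_le_pow _ _ (by omega))]
        push_cast; rfl
      rw [← h3, ← pow_add] at h2
      exact_mod_cast h2
    rw [padicValNat_dvd_iff_le (by
      have : 1 < q ^ (r * j) := Nat.one_lt_pow (mul_ne_zero hr.ne_zero hj) (by omega)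
      omega), e4] at e5
    omega

open Polynomial in
theorem cyclotomic_eval_dvd {q i : ℕ} (hi : 3 ≤ i) (hq : 2 ≤ q) (hodd : Odd q) :
    (cyclotomic i ℤ).eval (q : ℤ) ∣ ((i * kpart i q : ℕ) : ℤ) := by
  rw [← Int.natAbs_dvd_natAbs, Int.natAbs_natCast]
  refine (Nat.dvd_iff_prime_pow_dvd_dvd _ _).2 fun r k hr hk => ?_
  rcases eq_or_ne k 0 with rfl | hk0
  · simp
  have hk' : (r : ℤ) ^ k ∣ (cyclotomic i ℤ).eval (q : ℤ) := by
    rw [← Int.dvd_natAbs]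
    exact_mod_cast hk
  have hdvd : (cyclotomic i ℤ).eval (q : ℤ) ∣ (q : ℤ) ^ i - 1 := by
    simpa using eval_dvd (x := (q : ℤ)) (cyclotomic.dvd_X_pow_sub_one i ℤ)
  have h1 : r ^ k ∣ q ^ i - 1 := by
    have h3 : ((q ^ i - 1 : ℕ) : ℤ) = (q : ℤ) ^ i - 1 := by
      rw [Nat.cast_sub (Nat.one_le_pow _ _ (by omega))]
      push_cast; rfl
    have := hk'.trans hdvd
    rw [← h3] at this
    exact_mod_cast this
  by_cases ho : orderOf (q : ZMod r) = i
  · exact dvd_mul_of_dvd_right ((prime_pow_dvd_kpart_iff hr hk0 (by omega) hq).2 ⟨ho, h1⟩) _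
  · have := Fact.mk hr
    have hri : r ∣ i := by
      by_contra hri
      have : NeZero (i : ZMod r) := ⟨by rwa [Ne, ZMod.natCast_eq_zero_iff]⟩
      apply ho
      have hroot : IsRoot (cyclotomic i (ZMod r)) (q : ZMod r) := by
        rw [IsRoot.def, ← map_cyclotomic_int, show (q : ZMod r) = Int.castRingHom (ZMod r)
            (q : ℤ) by simp, eval_map,
          eval₂_at_apply]
        simp only [eq_intCast]
        rw [ZMod.intCast_zmod_eq_zero_iff_dvd]
        exact (dvd_pow_self _ hk0).trans hk'
      exact (isRoot_cyclotomic_iff.1 hroot).eq_orderOf.symm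
    have hk1 : k = 1 := by
      by_contra hk1
      exact not_sq_dvd_cyclotomic_eval hr hri hi hq hodd
        ((pow_dvd_pow _ (by omega)).trans hk')
    subst hk1
    rw [pow_one]
    exact dvd_mul_of_dvd_left hri _

open Polynomial in
theorem exists_primitive_prime {q i : ℕ} (hi : 3 ≤ i) (hφ : i ≤ 2 ^ i.totient) (hq : 3 ≤ q)
    (hodd : Odd q) : ∃ r, r.Prime ∧ orderOf (q : ZMod r) = i := by
  have h1 := sub_one_pow_totient_lt_cyclotomic_eval (n := i) (q := (q : ℝ)) (by omega)
    (by exact_mod_cast (by omega : 1 < q))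
  have h2 : (2 : ℝ) ^ i.totient ≤ ((q : ℝ) - 1) ^ i.totient := by
    apply pow_le_pow_left₀ (by norm_num)
    have : (3 : ℝ) ≤ q := by exact_mod_cast hq
    linarith
  have h3 : (cyclotomic i ℝ).eval (q : ℝ) = (((cyclotomic i ℤ).eval (q : ℤ) : ℤ) : ℝ) := by
    rw [← map_cyclotomic_int, show (q : ℝ) = Int.castRingHom ℝ (q : ℤ) by simp, eval_map,
      eval₂_at_apply]
    rfl
  rw [h3] at h1
  have h4 : ((i : ℕ) : ℝ) ≤ (2 : ℝ) ^ i.totient := by exact_mod_cast hφ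
  have h5 : (i : ℤ) < (cyclotomic i ℤ).eval (q : ℤ) := by
    exact_mod_cast (h4.trans h2).trans_lt h1
  have h6 := Int.le_of_dvd (by
    have := Nat.mul_pos (by omega : 0 < i) (Nat.pos_of_ne_zero (kpart_ne_zero i q))
    exact_mod_cast this) (cyclotomic_eval_dvd hi (by omega) hodd)
  have h7 : kpart i q ≠ 1 := by
    intro h
    rw [h, mul_one] at h6
    omega
  obtain ⟨r, hr, hrd⟩ := Nat.exists_prime_and_dvd h7
  exact ⟨r, hr, (prime_dvd_kpart_iff hr (by omega) (by omega)).1 hrd⟩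

open Polynomial in
theorem le_mul_kpart_of_mul_eq {q i b : ℕ} {A B : ℤ} (hi : 3 ≤ i) (hq : 2 ≤ q) (hodd : Odd q)
    (hb : i = b ∨ (i = 2 * b ∧ Odd b ∧ 3 ≤ b)) (hA : 0 ≤ A)
    (hAB : (cyclotomic i ℤ).eval (q : ℤ) * A = B) : B ≤ b * kpart i q * A := by
  have hdvd : (cyclotomic i ℤ).eval (q : ℤ) ∣ ((b * kpart i q : ℕ) : ℤ) := by
    have h := cyclotomic_eval_dvd hi hq hodd
    rcases hb with rfl | ⟨rfl, ho, h3⟩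
    · exact h
    · have h1 := odd_cyclotomic_eval hodd ho h3
      have h2 : IsCoprime ((cyclotomic (2 * b) ℤ).eval (q : ℤ)) 2 := by
        obtain ⟨c, hc⟩ := h1
        exact ⟨1, -c, by rw [hc]; ring⟩
      refine h2.dvd_of_dvd_mul_left ?_
      rw [mul_assoc] at h
      push_cast at h ⊢
      exact h
  have hpos : (0 : ℤ) < ((b * kpart i q : ℕ) : ℤ) := by
    have hb0 : 0 < b := by omega
    exact_mod_cast Nat.mul_pos hb0 (Nat.pos_of_ne_zero (kpart_ne_zero i q))
  have h6 := Int.le_of_dvd hpos hdvd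
  rw [← hAB]
  push_cast at h6
  exact mul_le_mul_of_nonneg_right h6 hA

open Polynomial in
theorem kpart_lower_bound {q a : ℕ} (ha : a.Prime) (ha3 : 3 ≤ a) (hq : 3 ≤ q) (hodd : Odd q)
    (i : ℕ) (hi : i = a ∨ i = 2 * a) : q ^ a + 1 ≤ a * kpart i q * (q + 1) := by
  have hao : Odd a := ha.odd_of_ne_two (by omega)
  have hk : 0 < a * kpart i q := Nat.mul_pos ha.pos (Nat.pos_of_ne_zero (kpart_ne_zero i q))
  have hq3 : (3 : ℤ) ≤ q := by exact_mod_cast hq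
  rcases hi with rfl | rfl
  · have h1 := congrArg (eval (q : ℤ)) (cyclotomic_expand_eq_cyclotomic_mul
      (n := 1) ha ha.not_dvd_one ℤ)
    simp only [expand_eval, one_mul, cyclotomic_one, eval_mul, eval_sub, eval_X, eval_one] at h1
    have := le_mul_kpart_of_mul_eq ha3 (by omega) hodd (Or.inl rfl) (by omega) h1.symm
    zify
    zify at hk
    nlinarith
  · have h1 := congrArg (eval (q : ℤ)) (cyclotomic_expand_eq_cyclotomic_mul (n := 2) ha
      (fun h => by have := Nat.le_of_dvd two_pos h; omega) ℤ)
    simp only [expand_eval, cyclotomic_two, eval_mul, eval_add, eval_X, eval_one] at h1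
    have := le_mul_kpart_of_mul_eq (i := 2 * a) (by omega) (by omega) hodd (Or.inr ⟨rfl, hao,
        ha3⟩) (by omega) h1.symm
    zify
    exact this

open Polynomial in
theorem kpart_lower_bound_nine {q : ℕ} (hq : 3 ≤ q) (hodd : Odd q)
    (i : ℕ) (hi : i = 9 ∨ i = 18) : q ^ 9 + 1 ≤ 9 * kpart i q * (q ^ 3 + 1) := by
  have hk : 0 < kpart i q := Nat.pos_of_ne_zero (kpart_ne_zero i q)
  have hq3 : (3 : ℤ) ≤ q := by exact_mod_cast hq
  have hq27 : (27 : ℤ) ≤ (q : ℤ) ^ 3 := by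
    have := pow_le_pow_left₀ (by norm_num) hq3 3
    linarith
  rcases hi with rfl | rfl
  · have h1 := congrArg (eval ((q : ℤ))) (cyclotomic_expand_eq_cyclotomic (p := 3)
      (n := 3) Nat.prime_three dvd_rfl ℤ)
    have h2 := congrArg (eval ((q : ℤ) ^ 3)) (cyclotomic_expand_eq_cyclotomic_mul
        (n := 1) Nat.prime_three (by norm_num) ℤ)
    simp only [expand_eval, one_mul, cyclotomic_one, eval_mul, eval_sub, eval_X, eval_one] at h1 h2
    rw [h1, ← pow_mul] at h2
    have := le_mul_kpart_of_mul_eq (i := 9) (by omega) (by omega) hodd (Or.inl rfl)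
        (by omega) h2.symm
    zify
    zify at hk
    norm_num at this ⊢
    nlinarith
  · have h1 := congrArg (eval ((q : ℤ))) (cyclotomic_expand_eq_cyclotomic (p := 3)
      (n := 6) Nat.prime_three (by norm_num) ℤ)
    have h2 := congrArg (eval ((q : ℤ) ^ 3)) (cyclotomic_expand_eq_cyclotomic_mul
        (n := 2) Nat.prime_three (by norm_num) ℤ)
    simp only [expand_eval, cyclotomic_two, eval_mul, eval_add, eval_X, eval_one] at h1 h2
    norm_num only at h1 h2
    rw [h1, ← pow_mul] at h2
    have := le_mul_kpart_of_mul_eq (i := 18) (b := 9) (by omega) (by omega) hodd (Or.inr ⟨rfl,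
        by decide, by omega⟩) (by omega) h2.symm
    zify
    norm_num at this ⊢
    exact this

theorem cube_bound_aux {q a n k e : ℕ} (hq : 3 ≤ q) (hn : 1 ≤ n)
    (h : 3 * q ^ (a - 1) ≤ 4 * e * k) (han : n ≤ 3 * (a - 1))
    (hnum : 192 * e ^ 3 < 27 * 3 ^ (3 * (a - 1) - n)) : 2 * q ^ n + 3 < k ^ 3 := by
  by_contra! hk
  have h1 : (3 * q ^ (a - 1)) ^ 3 ≤ (4 * e * k) ^ 3 := Nat.pow_le_pow_left h 3
  have h2 : (3 * q ^ (a - 1)) ^ 3 = 27 * q ^ (3 * (a - 1) - n) * q ^ n := by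
    rw [mul_assoc, ← pow_add, Nat.sub_add_cancel han, mul_pow, ← pow_mul, mul_comm (a - 1)]
    norm_num
  have h3 : q ≤ q ^ n := Nat.le_self_pow (by omega) q
  have h4 : 3 ^ (3 * (a - 1) - n) ≤ q ^ (3 * (a - 1) - n) := Nat.pow_le_pow_left hq _
  have h5 : (4 * e * k) ^ 3 = 64 * e ^ 3 * k ^ 3 := by ring
  rw [h2, h5] at h1
  have h6 : 64 * e ^ 3 * k ^ 3 ≤ 64 * e ^ 3 * (3 * q ^ n) := Nat.mul_le_mul_left _ (by omega)
  have h7 : 27 * q ^ (3 * (a - 1) - n) * q ^ n ≤ 192 * e ^ 3 * q ^ n := by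
    calc _ ≤ _ := h1.trans h6
      _ = _ := by ring
  have h8 := Nat.le_of_mul_le_mul_right h7 (by omega)
  omega

theorem cube_bound {q n : ℕ} (hq : 3 ≤ q) (hodd : Odd q) (hn1 : 6 ≤ n) (hn2 : n ≤ 16)
    (hne : Even n) (a : ℕ) (ha : a = if n = 16 then 13 else n - 1) (i : ℕ)
    (hi : i = a ∨ i = 2 * a) : 2 * q ^ n + 3 < kpart i q ^ 3 := by
  have main : ∀ a n : ℕ, a.Prime → 3 ≤ a → 1 ≤ n → (i = a ∨ i = 2 * a) → n ≤ 3 * (a - 1) →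
      192 * a ^ 3 < 27 * 3 ^ (3 * (a - 1) - n) → 2 * q ^ n + 3 < kpart i q ^ 3 := by
    intro a n hap ha3 hn hi h1 h2
    refine cube_bound_aux (a := a) (e := a) hq hn ?_ h1 h2
    have h3 := kpart_lower_bound hap ha3 hq hodd i hi
    have h4 : q ^ a = q ^ (a - 1) * q := by rw [← pow_succ]; congr 1; omega
    rw [h4] at h3
    rw [mul_assoc]
    generalize q ^ (a - 1) = X at *
    generalize a * kpart i q = Y at *
    by_contra! h5
    have h6 : 3 * (Y * (q + 1)) ≤ 4 * Y * q := by nlinarith [Nat.mul_le_mul_left Y hq]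
    have h7 : 4 * Y * q ≤ 3 * X * q := Nat.mul_le_mul_right q (by linarith)
    have h8 : 3 * (X * q + 1) ≤ 3 * (Y * (q + 1)) := Nat.mul_le_mul_left 3 h3
    linarith
  obtain ⟨c, hc⟩ := hne
  have : c = 3 ∨ c = 4 ∨ c = 5 ∨ c = 6 ∨ c = 7 ∨ c = 8 := by omega
  rcases this with rfl | rfl | rfl | rfl | rfl | rfl <;> subst hc <;> simp at ha <;> subst ha
  · have h := kpart_lower_bound (a := 5) (by norm_num) (by norm_num) hq hodd i hi
    generalize kpart i q = k at *
    by_contra! hk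
    obtain ⟨x, rfl⟩ := Nat.exists_eq_add_of_le hq
    have h1 : (x + 3) ^ 4 + (x + 3) ^ 2 + 1 ≤ 5 * k + (x + 3) ^ 3 + (x + 3) := by
      have : ((3 + x) ^ 4 + (3 + x) ^ 2 + 1) * (3 + x + 1) ≤ (5 * k + (3 + x) ^ 3 + (3 + x)) *
          (3 + x + 1) := by
        nlinarith
      have := Nat.le_of_mul_le_mul_right this (by omega)
      rwa [add_comm 3 x] at this
    have h2 : x ^ 4 + 11 * x ^ 3 + 46 * x ^ 2 + 86 * x + 61 ≤ 5 * k := by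
      nlinarith
    have h3 := Nat.pow_le_pow_left h2 3
    have h4 : (5 * k) ^ 3 = 125 * k ^ 3 := by ring
    rw [h4] at h3
    have h5 := h3.trans (Nat.mul_le_mul_left 125 hk)
    ring_nf at h5
    nlinarith [Nat.zero_le x, Nat.zero_le (x^2), Nat.zero_le (x^3), Nat.zero_le (x^4), Nat.zero_le
        (x^5), Nat.zero_le (x^6), Nat.zero_le (x^7), Nat.zero_le (x^8), Nat.zero_le (x^9),
            Nat.zero_le (x^10), Nat.zero_le (x^11), Nat.zero_le (x^12)]
  · exact main 7 8 (by norm_num) (by norm_num) (by norm_num) hi (by norm_num) (by norm_num)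
  · have h := kpart_lower_bound_nine hq hodd i hi
    refine cube_bound_aux (a := 7) (e := 7) hq (by norm_num) ?_ (by norm_num) (by norm_num)
    have h4 : q ^ 9 = q ^ 6 * q ^ 3 := by ring
    have h5 : 27 ≤ q ^ 3 := by
      have := Nat.pow_le_pow_left hq 3
      omega
    rw [h4] at h
    norm_num
    by_contra! h6
    nlinarith
  · exact main 11 12 (by norm_num) (by norm_num) (by norm_num) hi (by norm_num) (by norm_num)
  · exact main 13 14 (by norm_num) (by norm_num) (by norm_num) hi (by norm_num) (by norm_num)
  · exact main 13 16 (by norm_num) (by norm_num) (by norm_num) hi (by norm_num) (by norm_num)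

open Polynomial in
theorem exists_mem_spectrum_pow_ne_one {K A : Type*} [Field K] [IsAlgClosed K] [Ring A]
    [Nontrivial A] [Algebra K A] [FiniteDimensional K A] (g : A) {M r : ℕ} (hg : g ^ (M * r) = 1)
    (hgr : g ^ M ≠ 1) (hrK : (r : K) ≠ 0) :
    ∃ c ∈ spectrum K g, c ^ (M * r) = 1 ∧ c ^ M ≠ 1 := by
  let Q : K[X] := ∑ i ∈ Finset.range r, (X ^ M) ^ i
  have hQ : Q * (X ^ M - 1) = X ^ (M * r) - 1 := by
    rw [pow_mul]; exact geom_sum_mul _ _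
  have hunit : (0 : K) ∈ spectrum K (aeval g Q) := by
    rw [spectrum.zero_mem_iff]
    intro hu
    have h1 := congrArg (aeval g) hQ
    simp only [map_mul, map_sub, map_pow, aeval_X, map_one, hg, sub_self] at h1
    exact hgr (sub_eq_zero.1 ((hu.mul_right_eq_zero).1 h1))
  rw [spectrum.map_polynomial_aeval_of_nonempty g Q
    (spectrum.nonempty_of_isAlgClosed_of_finiteDimensional K g)] at hunit
  obtain ⟨c, hc, hcQ⟩ := hunit
  refine ⟨c, hc, ?_, ?_⟩
  · have h1 := congrArg (eval c) hQ
    simp only [eval_mul, hcQ, zero_mul, eval_sub, eval_pow, eval_X, eval_one] at h1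
    exact (sub_eq_zero.1 h1.symm)
  · intro h
    apply hrK
    simpa [Q, eval_finsetSum, h] using hcQ

theorem pow_dvd_of_not_dvd_div {r a d M : ℕ} (hr : r.Prime) (h1 : d ∣ M * r) (h2 : ¬ d ∣ M)
    (h3 : r ^ a ∣ M * r) : r ^ a ∣ d := by
  obtain ⟨c, hc⟩ := h1
  have hrc : ¬ r ∣ c := by
    rintro ⟨e, rfl⟩
    exact h2 ⟨e, Nat.eq_of_mul_eq_mul_right hr.pos (by rw [hc]; ring)⟩
  rw [hc] at h3
  exact (Nat.Coprime.pow_left a ((Nat.Prime.coprime_iff_not_dvd hr).2 hrc)).dvd_of_dvd_mul_right h3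

open Polynomial in
theorem exists_root_charpoly_pow_dvd_orderOf {F ι : Type*} [Field F] [Fintype ι] [DecidableEq ι]
    (g : Matrix ι ι F) (hfin : orderOf g ≠ 0) {r a : ℕ} (hr : r.Prime) (hrF : (r : F) ≠ 0)
    (ha : a ≠ 0) (h : r ^ a ∣ orderOf g) :
    ∃ c : AlgebraicClosure F, aeval c g.charpoly = 0 ∧ c ≠ 0 ∧ orderOf c ≠ 0 ∧
      r ^ a ∣ orderOf c := by
  let φ : Matrix ι ι F →+* Matrix ι ι (AlgebraicClosure F) :=
    (algebraMap F (AlgebraicClosure F)).mapMatrix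
  have hφ : Function.Injective φ := fun A B hAB => by
    ext i j
    have := congrFun (congrFun hAB i) j
    exact (algebraMap F (AlgebraicClosure F)).injective this
  have hord : orderOf (φ g) = orderOf g := orderOf_injective φ.toMonoidHom hφ g
  obtain ⟨M, hM⟩ := (dvd_pow_self r ha).trans h
  rw [mul_comm] at hM
  have hM0 : M ≠ 0 := by rintro rfl; simp at hM; exact hfin (by simp [hM])
  have hne : φ g ^ M ≠ 1 := by
    intro h1
    have h2 := Nat.le_of_dvd (by omega) (orderOf_dvd_of_pow_eq_one h1)
    rw [hord, hM] at h2
    have := hr.two_le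
    nlinarith [Nat.pos_of_ne_zero hM0]
  have : Nontrivial (Matrix ι ι (AlgebraicClosure F)) := by
    by_contra hn
    rw [not_nontrivial_iff_subsingleton] at hn
    exact hne (Subsingleton.elim _ _)
  obtain ⟨c, hc, hc1, hc2⟩ := exists_mem_spectrum_pow_ne_one (K := AlgebraicClosure F) (φ g)
    (M := M) (r := r) (by rw [← hM, ← hord]; exact pow_orderOf_eq_one _) hne (by
      rw [← map_natCast (algebraMap F (AlgebraicClosure F))]
      exact (_root_.map_ne_zero _).2 hrF)
  rw [Matrix.mem_spectrum_iff_isRoot_charpoly] at hc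
  have hroot : aeval c g.charpoly = 0 := by
    have : (φ g).charpoly = g.charpoly.map (algebraMap F (AlgebraicClosure F)) :=
      Matrix.charpoly_map g _
    rw [this] at hc
    rwa [aeval_def, eval₂_eq_eval_map]
  have hpos : 0 < M * r := Nat.mul_pos (Nat.pos_of_ne_zero hM0) hr.pos
  refine ⟨c, hroot, ?_, ?_, ?_⟩
  · rintro rfl
    rw [zero_pow hpos.ne'] at hc1
    exact zero_ne_one hc1
  · exact (orderOf_pos_iff.2 (isOfFinOrder_iff_pow_eq_one.2 ⟨_, hpos, hc1⟩)).ne'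
  · refine pow_dvd_of_not_dvd_div hr (orderOf_dvd_of_pow_eq_one hc1) (fun hd => hc2 ?_) (hM ▸ h)
    exact orderOf_dvd_iff_pow_eq_one.1 hd

open Polynomial in
theorem aeval_pow_card_eq_zero {F K : Type*} [Field F] [Fintype F] [Field K] [Algebra F K]
    (f : F[X]) {c : K} (hc : aeval c f = 0) (k : ℕ) : aeval (c ^ Fintype.card F ^ k) f = 0 := by
  induction k with
  | zero => simpa using hc
  | succ k ih =>
    rw [pow_succ, pow_mul, ← expand_aeval, FiniteField.expand_card, map_pow, ih,
      zero_pow Fintype.card_ne_zero]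

open Polynomial in
theorem aeval_inv_charpoly_of_symplectic {F K l : Type*} [Field F] [Fintype l] [DecidableEq l]
    [Field K] [Algebra F K] {g : Matrix (l ⊕ l) (l ⊕ l) F} (hg : g ∈ Matrix.symplecticGroup l F)
    {c : K} (hc : aeval c g.charpoly = 0) : aeval c⁻¹ g.charpoly = 0 := by
  let φ := (algebraMap F K).mapMatrix (m := l ⊕ l)
  have hcp : g.charpoly.map (algebraMap F K) = (φ g).charpoly := (Matrix.charpoly_map g _).symm
  rw [aeval_def, eval₂_eq_eval_map, hcp] at hc ⊢
  let G : Matrix.symplecticGroup l F := ⟨g, hg⟩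
  let u : (Matrix (l ⊕ l) (l ⊕ l) K)ˣ :=
    Units.map (φ : _ →* _) (Units.map (Matrix.symplecticGroup l F).subtype (toUnits G))
  have hu : (u : Matrix (l ⊕ l) (l ⊕ l) K) = φ g := rfl
  have hui : ((u⁻¹ : (Matrix (l ⊕ l) (l ⊕ l) K)ˣ) : Matrix (l ⊕ l) (l ⊕ l) K)
      = (-Matrix.J l K) * Matrix.transpose (φ g) * Matrix.J l K := by
    have h1 : ((u⁻¹ : (Matrix (l ⊕ l) (l ⊕ l) K)ˣ) : Matrix (l ⊕ l) (l ⊕ l) K)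
      = φ ((G⁻¹ : Matrix.symplecticGroup l F) : Matrix (l ⊕ l) (l ⊕ l) F) := rfl
    rw [h1, SymplecticGroup.coe_inv]
    have hJ : φ (Matrix.J l F) = Matrix.J l K := Matrix.map_J l (algebraMap F K)
    simp only [map_mul, map_neg, hJ]
    rfl
  let j : (Matrix (l ⊕ l) (l ⊕ l) K)ˣ := ⟨-Matrix.J l K, Matrix.J l K,
    by rw [neg_mul, Matrix.J_squared, neg_neg], by rw [mul_neg, Matrix.J_squared, neg_neg]⟩
  have hchar : ((u⁻¹ : (Matrix (l ⊕ l) (l ⊕ l) K)ˣ) : Matrix (l ⊕ l) (l ⊕ l) K).charpoly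
      = (φ g).charpoly := by
    rw [hui, ← Matrix.charpoly_transpose (φ g)]
    have h := Matrix.charpoly_units_conj j (Matrix.transpose (φ g))
    have h3 : (j : Matrix (l ⊕ l) (l ⊕ l) K)⁻¹ = Matrix.J l K := by
      rw [← Matrix.coe_units_inv]; rfl
    rw [h3] at h
    exact h
  have hc0 : c ≠ 0 := by
    rintro rfl
    have h1 : (0 : K) ∈ spectrum K (u : Matrix (l ⊕ l) (l ⊕ l) K) := by
      rw [Matrix.mem_spectrum_iff_isRoot_charpoly]
      exact hc
    rw [spectrum.zero_mem_iff] at h1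
    exact h1 u.isUnit
  have h2 : ((Units.mk0 c hc0 : Kˣ) : K) ∈ spectrum K
      ((u⁻¹ : (Matrix (l ⊕ l) (l ⊕ l) K)ˣ) : Matrix (l ⊕ l) (l ⊕ l) K) := by
    rw [Matrix.mem_spectrum_iff_isRoot_charpoly, hchar]
    exact hc
  rw [spectrum.inv_mem_iff, inv_inv, Matrix.mem_spectrum_iff_isRoot_charpoly] at h2
  rw [hu, Polynomial.IsRoot.def, Units.val_inv_eq_inv_val] at h2
  exact h2

/-- The orbit of `c` under inversion and the `q`-power map. -/
def powOrbit {M : Type*} [Group M] (q : ℕ) (c : M) : Set M :=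
  {x | ∃ i : ℕ, x = c ^ q ^ i ∨ x = (c ^ q ^ i)⁻¹}

/-- A lower bound for the size of `powOrbit q c` when the order of `c` is divisible by two odd
primes modulo which `q` has multiplicative orders `i` and `j`. -/
def orbitBound (i j : ℕ) : ℕ := i.lcm j * if Even i ∧ Even j then 1 else 2

theorem natCast_pow_eq_of_pow_eq {M : Type*} [Group M] {c : M} {r x y : ℕ} (hr : r ∣ orderOf c)
    (h : c ^ x = c ^ y) : (x : ZMod r) = y := by
  rw [pow_eq_pow_iff_modEq] at h
  exact (ZMod.natCast_eq_natCast_iff _ _ _).2 (h.of_dvd hr)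

theorem natCast_add_eq_zero_of_pow_eq_inv {M : Type*} [Group M] {c : M} {r x y : ℕ}
    (hr : r ∣ orderOf c) (h : c ^ x = (c ^ y)⁻¹) : (x : ZMod r) + y = 0 := by
  have : c ^ (x + y) = 1 := by rw [pow_add, h, inv_mul_cancel]
  have := hr.trans (orderOf_dvd_of_pow_eq_one this)
  rw [← ZMod.natCast_eq_zero_iff] at this
  exact_mod_cast this

theorem modEq_of_pow_eq {M : Type*} [Group M] {c : M} {r q i j : ℕ} (hr : r ∣ orderOf c)
    (hq : orderOf (q : ZMod r) ≠ 0) (h : c ^ q ^ i = c ^ q ^ j) :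
    i ≡ j [MOD orderOf (q : ZMod r)] := by
  have h1 := natCast_pow_eq_of_pow_eq hr h
  push_cast at h1
  exact (IsOfFinOrder.pow_eq_pow_iff_modEq (orderOf_pos_iff.1 (Nat.pos_of_ne_zero hq))).1 h1

theorem modEq_two_mul_of_pow_eq_inv {M : Type*} [Group M] {c : M} {r q i j : ℕ}
    (hr : r ∣ orderOf c) (hq : orderOf (q : ZMod r) ≠ 0) (h : c ^ q ^ i = (c ^ q ^ j)⁻¹) :
    2 * i ≡ 2 * j [MOD orderOf (q : ZMod r)] := by
  have h1 := natCast_add_eq_zero_of_pow_eq_inv hr h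
  push_cast at h1
  refine (IsOfFinOrder.pow_eq_pow_iff_modEq (orderOf_pos_iff.1 (Nat.pos_of_ne_zero hq))).1 ?_
  rw [eq_neg_of_add_eq_zero_left h1 |> fun h => show (q : ZMod r) ^ (2 * i) = (q ^ i) ^ 2 by ring,
    eq_neg_of_add_eq_zero_left h1]
  ring

theorem pow_ne_inv_pow_of_odd {M : Type*} [Group M] {c : M} {r q i j : ℕ}
    (hr : r ∣ orderOf c) (hrp : r.Prime) (hr2 : r ≠ 2) (hq : Odd (orderOf (q : ZMod r))) :
    c ^ q ^ i ≠ (c ^ q ^ j)⁻¹ := by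
  intro h
  have hq0 : orderOf (q : ZMod r) ≠ 0 := by rintro h0; rw [h0] at hq; exact absurd hq (by decide)
  have h1 := modEq_two_mul_of_pow_eq_inv hr hq0 h
  have h2 : i ≡ j [MOD orderOf (q : ZMod r)] :=
    Nat.ModEq.cancel_left_of_coprime (by simpa using hq) h1
  have h3 : (q : ZMod r) ^ i = q ^ j :=
    (IsOfFinOrder.pow_eq_pow_iff_modEq (orderOf_pos_iff.1 (Nat.pos_of_ne_zero hq0))).2 h2
  have h4 := natCast_add_eq_zero_of_pow_eq_inv hr h
  push_cast at h4
  have : Fact r.Prime := ⟨hrp⟩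
  have hqu : (q : ZMod r) ≠ 0 := by
    intro h0
    rw [h0] at hq0
    exact hq0 (orderOf_eq_zero (by
      rw [isOfFinOrder_iff_pow_eq_one]
      rintro ⟨n, hn, h⟩
      rw [zero_pow hn.ne'] at h
      exact zero_ne_one h))
  rw [h3, ← two_mul, mul_eq_zero] at h4
  rcases h4 with h4 | h4
  · have : ((2 : ℕ) : ZMod r) = 0 := by exact_mod_cast h4
    rw [ZMod.natCast_eq_zero_iff] at this
    exact hr2 ((Nat.prime_dvd_prime_iff_eq hrp Nat.prime_two).1 this)
  · exact pow_ne_zero j hqu h4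

theorem orbitBound_le_ncard {M : Type*} [Group M] {c : M} {q a b : ℕ} (ha : a.Prime) (hb : b.Prime)
    (ha2 : a ≠ 2) (hb2 : b ≠ 2) (hac : a ∣ orderOf c) (hbc : b ∣ orderOf c)
    (hqa : orderOf (q : ZMod a) ≠ 0) (hqb : orderOf (q : ZMod b) ≠ 0) {T : Set M} (hT : T.Finite)
    (hcT : powOrbit q c ⊆ T) :
    orbitBound (orderOf (q : ZMod a)) (orderOf (q : ZMod b)) ≤ T.ncard := by
  have hinj : ∀ i < (orderOf (q : ZMod a)).lcm (orderOf (q : ZMod b)),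
      ∀ j < (orderOf (q : ZMod a)).lcm (orderOf (q : ZMod b)), c ^ q ^ i = c ^ q ^ j → i = j := by
    intro i hi j hj h
    have h1 := modEq_of_pow_eq hac hqa h
    have h2 := modEq_of_pow_eq hbc hqb h
    have h3 := Nat.mod_lcm h1 h2
    exact h3.eq_of_lt_of_lt hi hj
  unfold orbitBound
  split_ifs with hev
  · rw [mul_one]
    have := Set.ncard_le_ncard_of_injOn (s := Set.Iio ((orderOf (q : ZMod a)).lcm
      (orderOf (q : ZMod b)))) (t := T) (fun i => c ^ q ^ i)
      (fun i _ => hcT ⟨i, Or.inl rfl⟩) (fun i hi j hj h => hinj i hi j hj h) hT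
    simpa [Set.ncard_eq_toFinset_card'] using this
  · have hne : ∀ i j : ℕ, c ^ q ^ i ≠ (c ^ q ^ j)⁻¹ := by
      rw [not_and_or, Nat.not_even_iff_odd, Nat.not_even_iff_odd] at hev
      rcases hev with h | h
      · exact fun i j => pow_ne_inv_pow_of_odd hac ha ha2 h
      · exact fun i j => pow_ne_inv_pow_of_odd hbc hb hb2 h
    have := Set.ncard_le_ncard_of_injOn (s := (Set.Iio ((orderOf (q : ZMod a)).lcm
      (orderOf (q : ZMod b)))) ×ˢ (Set.univ : Set Bool)) (t := T)
      (fun x => if x.2 then c ^ q ^ x.1 else (c ^ q ^ x.1)⁻¹)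
      (by
        rintro ⟨i, _ | _⟩ _
        · exact hcT ⟨i, Or.inr rfl⟩
        · exact hcT ⟨i, Or.inl rfl⟩)
      (by
        rintro ⟨i, _ | _⟩ ⟨hi, -⟩ ⟨j, _ | _⟩ ⟨hj, -⟩ h
        · simp only [Bool.false_eq_true, if_false, inv_inj] at h
          rw [hinj i hi j hj h]
        · simp only [Bool.false_eq_true, if_false, if_true] at h
          exact absurd h.symm (hne _ _)
        · simp only [Bool.false_eq_true, if_false, if_true] at h
          exact absurd h (hne _ _)
        · simp only [if_true] at h
          rw [hinj i hi j hj h]) hT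
    rw [Set.ncard_prod] at this
    simpa [Set.ncard_eq_toFinset_card'] using this

theorem dvd_orderOf_pow_of_coprime {M : Type*} [Monoid M] {c : M} {b m : ℕ} (hb : b ∣ orderOf c)
    (hco : b.Coprime m) : b ∣ orderOf (c ^ m) :=
  hco.dvd_of_dvd_mul_left (hb.trans (orderOf_dvd_of_pow_eq_one (by rw [pow_mul,
      pow_orderOf_eq_one])))

theorem coprime_of_orderOf_ne_zero {r q : ℕ} (h : orderOf (q : ZMod r) ≠ 0) : r.Coprime q := by
  have h1 : IsUnit (q : ZMod r) :=
    (orderOf_pos_iff.1 (Nat.pos_of_ne_zero h)).isUnit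
  exact ((ZMod.isUnit_iff_coprime q r).1 h1).symm

theorem orbitBound_add_le_or {M : Type*} [Group M] {c d : M} {q a b : ℕ} (ha : a.Prime)
    (hb : b.Prime) (ha2 : a ≠ 2) (hb2 : b ≠ 2) (hac : a ∣ orderOf c) (hbd : b ∣ orderOf d)
    (hqa : orderOf (q : ZMod a) ≠ 0) (hqb : orderOf (q : ZMod b) ≠ 0) {T : Set M} (hT : T.Finite)
    (hcT : powOrbit q c ⊆ T) (hdT : powOrbit q d ⊆ T) :
    orbitBound (orderOf (q : ZMod a)) (orderOf (q : ZMod a)) +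
      orbitBound (orderOf (q : ZMod b)) (orderOf (q : ZMod b)) ≤ T.ncard ∨
    orbitBound (orderOf (q : ZMod a)) (orderOf (q : ZMod b)) ≤ T.ncard := by
  by_cases hdis : Disjoint (powOrbit q c) (powOrbit q d)
  · left
    have h1 := orbitBound_le_ncard ha ha ha2 ha2 hac hac hqa hqa (hT.subset hcT) subset_rfl
    have h2 := orbitBound_le_ncard hb hb hb2 hb2 hbd hbd hqb hqb (hT.subset hdT) subset_rfl
    have h3 := Set.ncard_union_eq hdis (hT.subset hcT) (hT.subset hdT)
    have h4 := Set.ncard_le_ncard (Set.union_subset hcT hdT) hT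
    omega
  · right
    rw [Set.not_disjoint_iff] at hdis
    obtain ⟨x, ⟨i, hi⟩, j, hj⟩ := hdis
    have h1 : b ∣ orderOf x := by
      have := dvd_orderOf_pow_of_coprime hbd ((coprime_of_orderOf_ne_zero hqb).pow_right j)
      rcases hj with rfl | rfl
      · exact this
      · rwa [orderOf_inv]
    have h2 : orderOf x ∣ orderOf c := by
      rcases hi with rfl | rfl
      · exact orderOf_pow_dvd _
      · rw [orderOf_inv]; exact orderOf_pow_dvd _
    exact orbitBound_le_ncard ha hb ha2 hb2 hac (h1.trans h2) hqa hqb hT hcT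

section Symplectic

open Polynomial

variable {F : Type*} [Field F] {l : Type*} [Fintype l] [DecidableEq l]

/-- The nonzero eigenvalues of a symplectic matrix in the algebraic closure. -/
def symplecticEigenvalues (g : Matrix.symplecticGroup l F) : Set (AlgebraicClosure F)ˣ :=
  {c | aeval (c : AlgebraicClosure F) (g : Matrix (l ⊕ l) (l ⊕ l) F).charpoly = 0}

open scoped Classical in
theorem coe_image_symplecticEigenvalues_subset (g : Matrix.symplecticGroup l F) :
    Units.val '' symplecticEigenvalues g ⊆
      ((((g : Matrix (l ⊕ l) (l ⊕ l) F).charpoly.aroots (AlgebraicClosure F)).toFinset :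
        Finset (AlgebraicClosure F)) : Set (AlgebraicClosure F)) := by
  rintro _ ⟨c, hc, rfl⟩
  rw [Finset.mem_coe, Multiset.mem_toFinset, mem_aroots]
  exact ⟨(Matrix.charpoly_monic _).ne_zero, hc⟩

open scoped Classical in
theorem symplecticEigenvalues_finite (g : Matrix.symplecticGroup l F) :
    (symplecticEigenvalues g).Finite :=
  Set.Finite.of_finite_image ((Finset.finite_toSet _).subset
    (coe_image_symplecticEigenvalues_subset g)) (Units.val_injective.injOn)

open scoped Classical in
theorem ncard_symplecticEigenvalues_le_toFinset (g : Matrix.symplecticGroup l F) :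
    (symplecticEigenvalues g).ncard ≤
      ((g : Matrix (l ⊕ l) (l ⊕ l) F).charpoly.aroots (AlgebraicClosure F)).toFinset.card := by
  rw [← Set.ncard_image_of_injective _ Units.val_injective, ← Set.ncard_coe_finset]
  exact Set.ncard_le_ncard (coe_image_symplecticEigenvalues_subset g) (Finset.finite_toSet _)

theorem card_aroots_charpoly_le (g : Matrix.symplecticGroup l F) :
    Multiset.card ((g : Matrix (l ⊕ l) (l ⊕ l) F).charpoly.aroots (AlgebraicClosure F)) ≤
      2 * Fintype.card l := by
  refine (card_roots' _).trans ?_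
  rw [natDegree_map, Matrix.charpoly_natDegree_eq_dim, Fintype.card_sum]
  omega

open scoped Classical in
theorem ncard_symplecticEigenvalues_le (g : Matrix.symplecticGroup l F) :
    (symplecticEigenvalues g).ncard ≤ 2 * Fintype.card l :=
  (ncard_symplecticEigenvalues_le_toFinset g).trans
    ((Multiset.toFinset_card_le _).trans (card_aroots_charpoly_le g))

variable [Fintype F]

theorem powOrbit_subset_symplecticEigenvalues {g : Matrix.symplecticGroup l F}
    {c : (AlgebraicClosure F)ˣ} (hc : c ∈ symplecticEigenvalues g) :
    powOrbit (Fintype.card F) c ⊆ symplecticEigenvalues g := by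
  rintro x ⟨i, hi⟩
  have h1 := aeval_pow_card_eq_zero _ hc i
  rcases hi with rfl | rfl
  · exact h1
  · have := aeval_inv_charpoly_of_symplectic g.2 h1
    simpa [symplecticEigenvalues] using this

theorem exists_mem_symplecticEigenvalues (g : Matrix.symplecticGroup l F) {r a : ℕ}
    (hr : r.Prime) (hrF : (r : F) ≠ 0) (ha : a ≠ 0) (h : r ^ a ∣ orderOf g) :
    ∃ c ∈ symplecticEigenvalues g, r ^ a ∣ orderOf c := by
  have hfin : orderOf g ≠ 0 := (orderOf_pos g).ne'
  rw [← orderOf_submonoid] at h hfin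
  obtain ⟨c, h1, h2, h3, h4⟩ := exists_root_charpoly_pow_dvd_orderOf _ hfin hr hrF ha h
  refine ⟨Units.mk0 c h2, h1, ?_⟩
  rwa [← orderOf_units]

theorem natCast_ne_zero_of_orderOf_ne_zero {r : ℕ} (hr : r.Prime)
    (h : orderOf (Fintype.card F : ZMod r) ≠ 0) : (r : F) ≠ 0 := by
  intro h0
  obtain ⟨p, hp⟩ := CharP.exists F
  have hpp : p.Prime := (CharP.char_is_prime_or_zero F p).resolve_right
    (CharP.char_ne_zero_of_finite F p)
  have h1 : p = r := (Nat.prime_dvd_prime_iff_eq hpp hr).1 ((CharP.cast_eq_zero_iff F p r).1 h0)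
  subst h1
  obtain ⟨n, -, hn⟩ := FiniteField.card F p
  have h2 := coprime_of_orderOf_ne_zero h
  rw [hn] at h2
  exact hpp.ne_one (Nat.Coprime.eq_one_of_dvd h2 (dvd_pow_self p n.2.ne'))

end Symplectic

theorem nonadjacent_psp {F : Type*} [Field F] [Fintype F] {n a b : ℕ} (ha : a.Prime)
    (hb : b.Prime) (ha2 : a ≠ 2) (hb2 : b ≠ 2)
    (hqa : orderOf (Fintype.card F : ZMod a) ≠ 0) (hqb : orderOf (Fintype.card F : ZMod b) ≠ 0)
    (h1 : 2 * n < orbitBound (orderOf (Fintype.card F : ZMod a)) (orderOf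
        (Fintype.card F : ZMod a)) +
      orbitBound (orderOf (Fintype.card F : ZMod b)) (orderOf (Fintype.card F : ZMod b)))
    (h2 : 2 * n < orbitBound (orderOf (Fintype.card F : ZMod a)) (orderOf
        (Fintype.card F : ZMod b))) :
    Nonadjacent (PSp n F) a b := by
  intro x hx
  obtain ⟨g, rfl⟩ := QuotientGroup.mk_surjective x
  have hg : a * b ∣ orderOf g := hx.trans (orderOf_map_dvd (QuotientGroup.mk' _) g)
  obtain ⟨c, hc, hca⟩ := exists_mem_symplecticEigenvalues g ha
    (natCast_ne_zero_of_orderOf_ne_zero ha hqa) one_ne_zero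
    (by rw [pow_one]; exact (dvd_mul_right a b).trans hg)
  obtain ⟨d, hd, hdb⟩ := exists_mem_symplecticEigenvalues g hb
    (natCast_ne_zero_of_orderOf_ne_zero hb hqb) one_ne_zero
    (by rw [pow_one]; exact (dvd_mul_left b a).trans hg)
  rw [pow_one] at hca hdb
  have h3 := ncard_symplecticEigenvalues_le g
  rw [Fintype.card_fin] at h3
  rcases orbitBound_add_le_or ha hb ha2 hb2 hca hdb hqa hqb (symplecticEigenvalues_finite g)
    (powOrbit_subset_symplecticEigenvalues hc) (powOrbit_subset_symplecticEigenvalues hd) with h | h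
  · omega
  · omega

open Polynomial in
theorem dvd_half_of_dvd_orderOf_psp {F : Type*} [Field F] [Fintype F]
    (hodd : Odd (Fintype.card F)) {n r : ℕ} (hn : n ≠ 0) (hr : r.Prime)
    (hqr : orderOf (Fintype.card F : ZMod r) = 2 * n) (x : PSp n F) (hx : r ∣ orderOf x) :
    orderOf x ∣ (Fintype.card F ^ n + 1) / 2 := by
  classical
  set q := Fintype.card F with hq
  obtain ⟨g, rfl⟩ := QuotientGroup.mk_surjective x
  have hg : r ∣ orderOf g := hx.trans (orderOf_map_dvd (QuotientGroup.mk' _) g)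
  have hqr0 : orderOf (q : ZMod r) ≠ 0 := by omega
  have hr2 : r ≠ 2 := by
    rintro rfl
    have h1 : (q : ZMod 2) = 1 := ZMod.natCast_eq_one_iff_odd.2 hodd
    rw [h1, orderOf_one] at hqr
    omega
  obtain ⟨c, hc, hcr⟩ := exists_mem_symplecticEigenvalues g hr
    (natCast_ne_zero_of_orderOf_ne_zero hr hqr0) one_ne_zero (by rwa [pow_one])
  rw [pow_one] at hcr
  have hinj : Set.InjOn (fun i => c ^ q ^ i) (Set.Iio (2 * n)) := by
    intro i hi j hj h
    have := modEq_of_pow_eq hcr hqr0 h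
    rw [hqr] at this
    exact this.eq_of_lt_of_lt hi hj
  have hsub : (fun i => c ^ q ^ i) '' Set.Iio (2 * n) ⊆ symplecticEigenvalues g := by
    rintro _ ⟨i, -, rfl⟩
    exact powOrbit_subset_symplecticEigenvalues hc ⟨i, Or.inl rfl⟩
  have hcardI : ((fun i => c ^ q ^ i) '' Set.Iio (2 * n)).ncard = 2 * n := by
    rw [hinj.ncard_image]
    simp [Set.ncard_eq_toFinset_card']
  have hle := ncard_symplecticEigenvalues_le g
  rw [Fintype.card_fin] at hle
  have heq : (fun i => c ^ q ^ i) '' Set.Iio (2 * n) = symplecticEigenvalues g :=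
    Set.eq_of_subset_of_ncard_le hsub (by omega) (symplecticEigenvalues_finite g)
  have hinv : c⁻¹ ∈ symplecticEigenvalues g :=
    powOrbit_subset_symplecticEigenvalues hc ⟨0, Or.inr (by simp)⟩
  have hcn : c ^ (q ^ n + 1) = 1 := by
    rw [← heq] at hinv
    obtain ⟨i, hi, h⟩ := hinv
    have h1 : c ^ q ^ i = (c ^ q ^ 0)⁻¹ := by simpa using h
    have h2 := modEq_two_mul_of_pow_eq_inv hcr hqr0 h1
    rw [hqr] at h2
    have h3 : i ≡ 0 [MOD n] := Nat.ModEq.mul_left_cancel' (c := 2) (by norm_num) h2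
    rw [Nat.modEq_zero_iff_dvd] at h3
    obtain ⟨k, rfl⟩ := h3
    have h4 : n * k < n * 2 := by simpa [mul_comm] using hi
    have h5 : k < 2 := Nat.lt_of_mul_lt_mul_left h4
    interval_cases k
    · rw [mul_zero] at h1
      have h5 := natCast_add_eq_zero_of_pow_eq_inv hcr h1
      have : ((2 : ℕ) : ZMod r) = 0 := by
        rw [← h5]; norm_num
      rw [ZMod.natCast_eq_zero_iff] at this
      exact absurd ((Nat.prime_dvd_prime_iff_eq hr Nat.prime_two).1 this) hr2
    · rw [mul_one] at h1
      rw [pow_succ, h1]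
      simp
  have hev : 2 * ((q ^ n + 1) / 2) = q ^ n + 1 := Nat.mul_div_cancel'
      (hodd.pow.add_odd odd_one).two_dvd
  set M := (q ^ n + 1) / 2
  have hM0 : M ≠ 0 := by
    rintro h0; rw [h0] at hev; omega
  obtain ⟨e, he, hee⟩ : ∃ e : ℤ, (e = 1 ∨ e = -1) ∧ (c : AlgebraicClosure F) ^ M = e := by
    have h1 : ((c : AlgebraicClosure F) ^ M) ^ 2 = 1 := by
      rw [← pow_mul, mul_comm, hev]
      rw [← Units.val_pow_eq_pow_val, hcn, Units.val_one]
    rcases mul_self_eq_one_iff.1 ((sq _).symm.trans h1) with h | h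
    · exact ⟨1, Or.inl rfl, by simpa using h⟩
    · exact ⟨-1, Or.inr rfl, by simpa using h⟩
  have hpow : ∀ i : ℕ, (e : AlgebraicClosure F) ^ q ^ i = e := by
    intro i
    rcases he with rfl | rfl
    · simp
    · simp [(hodd.pow (n := i)).neg_one_pow]
  have hall : ∀ d ∈ symplecticEigenvalues g, (d : AlgebraicClosure F) ^ M = e := by
    intro d hd
    rw [← heq] at hd
    obtain ⟨i, -, rfl⟩ := hd
    simp only [Units.val_pow_eq_pow_val]
    rw [pow_right_comm, hee, hpow]
  set f := (g : Matrix (Fin n ⊕ Fin n) (Fin n ⊕ Fin n) F).charpoly with hf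
  have hnodup : (f.aroots (AlgebraicClosure F)).Nodup := by
    rw [← Multiset.toFinset_card_eq_card_iff_nodup]
    refine le_antisymm (Multiset.toFinset_card_le _) ?_
    refine (card_aroots_charpoly_le g).trans ?_
    rw [Fintype.card_fin, ← hcardI, heq]
    exact ncard_symplecticEigenvalues_le_toFinset g
  have hdvd : f.map (algebraMap F (AlgebraicClosure F)) ∣
      (X ^ M - C (e : F)).map (algebraMap F (AlgebraicClosure F)) := by
    refine (IsAlgClosed.splits _).dvd_of_roots_le_roots
      ((Matrix.charpoly_monic _).map _).ne_zero ?_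
    rw [Multiset.le_iff_subset hnodup]
    intro d hd
    have hd1 := mem_aroots.1 hd
    have hd0 : d ≠ 0 := by
      rintro rfl
      have h1 : (f.aroots (AlgebraicClosure F)).toFinset.card ≤ 2 * n := by
        refine (Multiset.toFinset_card_le _).trans ?_
        simpa using card_aroots_charpoly_le g
      have h2 : Units.val '' symplecticEigenvalues g =
          (((f.aroots (AlgebraicClosure F)).toFinset : Finset _) : Set (AlgebraicClosure F)) := by
        refine Set.eq_of_subset_of_ncard_le (coe_image_symplecticEigenvalues_subset g) ?_
          (Finset.finite_toSet _)
        rw [Set.ncard_coe_finset, Set.ncard_image_of_injective _ Units.val_injective, ← heq, hcardI]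
        exact h1
      have h3 : (0 : AlgebraicClosure F) ∈ Units.val '' symplecticEigenvalues g := by
        rw [h2, Finset.mem_coe, Multiset.mem_toFinset]
        exact hd
      obtain ⟨y, -, hy⟩ := h3
      exact y.ne_zero hy
    have := hall (Units.mk0 d hd0) hd1.2
    rw [mem_roots (Monic.ne_zero (by
      rw [Polynomial.map_sub, Polynomial.map_pow, map_X, map_C]
      exact monic_X_pow_sub_C _ hM0))]
    simp only [Polynomial.map_sub, Polynomial.map_pow, map_X, map_C, IsRoot.def, eval_sub,
      eval_pow, eval_X, eval_C]
    rw [sub_eq_zero, map_intCast (algebraMap F (AlgebraicClosure F))]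
    exact this
  have hdvd' : f ∣ X ^ M - C (e : F) := (map_dvd_map' _).1 hdvd
  have hgM : (g : Matrix (Fin n ⊕ Fin n) (Fin n ⊕ Fin n) F) ^ M = algebraMap F _ (e : F) := by
    obtain ⟨w, hw⟩ := hdvd'
    have := congrArg (aeval (g : Matrix (Fin n ⊕ Fin n) (Fin n ⊕ Fin n) F)) hw
    rw [map_mul, hf, Matrix.aeval_self_charpoly, zero_mul, map_sub, map_pow, aeval_X,
        aeval_C] at this
    exact sub_eq_zero.1 this
  refine orderOf_dvd_of_pow_eq_one ?_
  rw [← QuotientGroup.mk_pow, QuotientGroup.eq_one_iff, Subgroup.mem_center_iff]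
  intro h
  apply Subtype.ext
  rw [Submonoid.coe_mul, Submonoid.coe_mul, SubmonoidClass.coe_pow, hgM]
  exact (Algebra.commutes _ _).symm

theorem exists_finite_field_extension (F : Type*) [Field F] [Finite F] {j : ℕ} (hj : j ≠ 0) :
    ∃ (E : Type) (_ : Field E) (_ : Finite E) (_ : Algebra F E),
      Nat.card E = Nat.card F ^ j ∧ Module.finrank F E = j := by
  obtain ⟨p, hp⟩ := CharP.exists F
  have : Fact p.Prime := ⟨(CharP.char_is_prime_or_zero F p).resolve_right
    (CharP.char_ne_zero_of_finite F p)⟩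
  have : NeZero j := ⟨hj⟩
  exact ⟨FiniteField.Extension F p j, inferInstance, inferInstance, inferInstance,
    FiniteField.natCard_extension F p j, FiniteField.finrank_extension F p j⟩

theorem exists_units_orderOf_eq (E : Type*) [Field E] [Finite E] :
    ∃ y : Eˣ, orderOf y = Nat.card E - 1 := by
  obtain ⟨y, hy⟩ := IsCyclic.exists_generator (α := Eˣ)
  exact ⟨y, by rw [orderOf_eq_card_of_forall_mem_zpowers hy, Nat.card_units]⟩

theorem exists_gl_orderOf_eq (F : Type*) [Field F] [Finite F] {j : ℕ} (hj : j ≠ 0) :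
    ∃ g : GL (Fin j) F, orderOf g = Nat.card F ^ j - 1 := by
  obtain ⟨E, _, _, _, hE, hr⟩ := exists_finite_field_extension F hj
  have : FiniteDimensional F E := FiniteDimensional.of_finrank_pos (by omega)
  obtain ⟨y, hy⟩ := exists_units_orderOf_eq E
  let b := Module.finBasisOfFinrankEq F E hr
  let φ : E →* Matrix (Fin j) (Fin j) F := (Algebra.leftMulMatrix b).toRingHom.toMonoidHom
  have hφ : Function.Injective φ := Algebra.leftMulMatrix_injective b
  refine ⟨Units.map φ y, ?_⟩
  rw [orderOf_injective (Units.map φ) (Units.map_injective hφ), hy, hE]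

theorem exists_sl_orderOf_eq (F : Type*) [Field F] [Finite F] {j : ℕ} (hj : j ≠ 0) :
    ∃ g : Matrix.SpecialLinearGroup (Fin j) F,
      orderOf g = (Nat.card F ^ j - 1) / (Nat.card F - 1) := by
  obtain ⟨E, _, _, _, hE, hr⟩ := exists_finite_field_extension F hj
  have : FiniteDimensional F E := FiniteDimensional.of_finrank_pos (by omega)
  obtain ⟨y, hy⟩ := exists_units_orderOf_eq E
  have hq : 1 < Nat.card F := Finite.one_lt_card
  have hqj : 1 < Nat.card F ^ j := Nat.one_lt_pow hj hq
  have hdvd : Nat.card F - 1 ∣ Nat.card F ^ j - 1 := by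
    simpa using Nat.sub_dvd_pow_sub_pow (Nat.card F) 1 j
  let b := Module.finBasisOfFinrankEq F E hr
  let w : Eˣ := y ^ (Nat.card F - 1)
  have hw : orderOf w = (Nat.card F ^ j - 1) / (Nat.card F - 1) := by
    rw [orderOf_pow, hy, hE, Nat.gcd_eq_right hdvd]
  have hnorm : Algebra.norm F (w : E) = 1 := by
    apply (algebraMap F E).injective
    rw [FiniteField.algebraMap_norm_eq_pow, hE, map_one, ← Units.val_pow_eq_pow_val, ← hw,
      pow_orderOf_eq_one, Units.val_one]
  refine ⟨⟨Algebra.leftMulMatrix b (w : E), by rw [← Algebra.norm_eq_matrix_det, hnorm]⟩, ?_⟩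
  let φ : E →* Matrix (Fin j) (Fin j) F := (Algebra.leftMulMatrix b).toRingHom.toMonoidHom
  have hφ : Function.Injective φ := Algebra.leftMulMatrix_injective b
  rw [← hw, ← orderOf_units, ← orderOf_injective φ hφ]
  let ψ : Matrix.SpecialLinearGroup (Fin j) F →* Matrix (Fin j) (Fin j) F :=
    { toFun := fun g => g, map_one' := rfl, map_mul' := fun _ _ => rfl }
  exact (orderOf_injective ψ (fun _ _ h => Subtype.ext h) _).symm

open Matrix in
theorem exists_hom_symplectic_of_self_adjoint {E F l : Type*} [CommRing E] [Field F] [Fintype l]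
    [DecidableEq l] (N : E →ₙ+* Matrix l l F) (hN : Function.Injective N) (T T' : Matrix l l F)
    (h1 : T * T' = 1) (hT : Tᵀ = T) (hNT : ∀ x, (N x)ᵀ * T = T * N x) :
    ∃ Ψ : SpecialLinearGroup (Fin 2) E →* symplecticGroup l F, Function.Injective Ψ := by
  have h2 : T' * T = 1 := mul_eq_one_comm.1 h1
  have hT' : T'ᵀ = T' := by
    have h3 : T'ᵀ * T = 1 := by
      calc T'ᵀ * T = T'ᵀ * Tᵀ := by rw [hT]
        _ = 1 := by rw [← transpose_mul, h1, transpose_one]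
    calc T'ᵀ = T'ᵀ * (T * T') := by rw [h1, mul_one]
      _ = T' := by rw [← mul_assoc, h3, one_mul]
  let P : E → Matrix l l F := fun x => N x + (1 - N 1)
  have hPP : ∀ a b, P a * P b = P (a * b) := by
    intro a b
    have e1 : N a * N 1 = N a := by rw [← map_mul, mul_one]
    have e2 : N 1 * N b = N b := by rw [← map_mul, one_mul]
    have e3 : N 1 * N 1 = N 1 := by rw [← map_mul, one_mul]
    simp only [P, map_mul]
    simp only [add_mul, mul_add, mul_sub, sub_mul, mul_one, one_mul, e1, e2, e3]
    abel
  have hPN : ∀ a b, P a * N b = N (a * b) := by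
    intro a b
    have e2 : N 1 * N b = N b := by rw [← map_mul, one_mul]
    simp only [P, map_mul, add_mul, sub_mul, one_mul, e2]
    abel
  have hNP : ∀ a b, N a * P b = N (a * b) := by
    intro a b
    have e2 : N a * N 1 = N a := by rw [← map_mul, mul_one]
    simp only [P, map_mul, mul_add, mul_sub, mul_one, e2]
    abel
  have hPadd : ∀ a b, P a + N b = P (a + b) := by
    intro a b
    simp only [P, map_add]
    abel
  have hPadd' : ∀ a b, P (a - b) = P a - N b := by
    intro a b
    simp only [P, map_sub]
    abel
  have hPT : ∀ x, (P x)ᵀ * T = T * P x := by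
    intro x
    simp only [P, transpose_add, transpose_sub, transpose_one, add_mul, sub_mul, mul_add, mul_sub,
      hNT, one_mul, mul_one]
  have hP1 : P 1 = 1 := by simp [P]
  have hNT' : ∀ x, T' * (N x)ᵀ = N x * T' := by
    intro x
    calc T' * (N x)ᵀ = T' * ((N x)ᵀ * T) * T' := by rw [mul_assoc, mul_assoc, h1, mul_one]
      _ = N x * T' := by rw [hNT, ← mul_assoc, h2, one_mul]
  have hPT' : ∀ x, T' * (P x)ᵀ = P x * T' := by
    intro x
    calc T' * (P x)ᵀ = T' * ((P x)ᵀ * T) * T' := by rw [mul_assoc, mul_assoc, h1, mul_one]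
      _ = P x * T' := by rw [hPT, ← mul_assoc, h2, one_mul]
  let Φ : SpecialLinearGroup (Fin 2) E → Matrix (l ⊕ l) (l ⊕ l) F := fun g =>
    fromBlocks (P (g 0 0)) (N (g 0 1) * T') (T * N (g 1 0)) (T * P (g 1 1) * T')
  have assoc {X Y Z W : Matrix l l F} (h : X * Y = Z * W) (V) : X * (Y * V) = Z * (W * V) := by
    rw [← mul_assoc, h, mul_assoc]
  have assoc' {X Y Z : Matrix l l F} (h : X * Y = Z) (V) : X * (Y * V) = Z * V := by
    rw [← mul_assoc, h]
  have hNN : ∀ a b, N a * N b = N (a * b) := fun a b => (map_mul N a b).symm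
  have h2' (V) : T' * (T * V) = V := by rw [assoc' h2, one_mul]
  have hPP' := fun a b => assoc' (hPP a b)
  have hPN' := fun a b => assoc' (hPN a b)
  have hNP' := fun a b => assoc' (hNP a b)
  have hNN' := fun a b => assoc' (hNN a b)
  have hPTa := fun a => assoc (hPT a)
  have hNTa := fun a => assoc (hNT a)
  have hmem : ∀ g, Φ g ∈ symplecticGroup l F := by
    intro g
    have hdet : g 0 0 * g 1 1 - g 0 1 * g 1 0 = 1 := by
      have := g.det_coe
      rwa [det_fin_two] at this
    simp only [Φ]
    generalize g 0 0 = a at *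
    generalize g 0 1 = b at *
    generalize g 1 0 = c at *
    generalize g 1 1 = d at *
    rw [SymplecticGroup.fromBlocks_mem_iff]
    simp only [transpose_mul, hT, hT', mul_assoc, one_mul, h2, h2', hNT, hPTa, hPT',
      hNT', hPN, hNP, hPP', hPN', hNP', hNN']
    refine ⟨by rw [mul_comm a], by rw [mul_comm b], ?_⟩
    rw [← mul_sub, ← sub_mul, ← hPadd' , mul_comm c, hdet, hP1, one_mul, h1]
  let Ψ : SpecialLinearGroup (Fin 2) E →* symplecticGroup l F :=
    MonoidHom.mk' (fun g => ⟨Φ g, hmem g⟩) (by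
      intro g h
      apply Subtype.ext
      change Φ (g * h) = Φ g * Φ h
      have hgh (i j) : (g * h) i j = g i 0 * h 0 j + g i 1 * h 1 j := by
        simp [mul_apply, Fin.sum_univ_two]
      simp only [Φ, fromBlocks_multiply, hgh]
      simp only [mul_assoc, h2', hPP, hPN, hNP, hNN, hPP', hPN', hNP', hNN',
        ← mul_add, ← add_mul, hPadd, ← map_add]
      rw [add_comm (N _) (P _), hPadd, add_comm (g 1 0 * h 0 1)])
  refine ⟨Ψ, fun g h hgh => ?_⟩
  have hΦ : Φ g = Φ h := congrArg Subtype.val hgh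
  obtain ⟨e1, e2, e3, e4⟩ := fromBlocks_inj.1 hΦ
  have c1 : ∀ {X Y : Matrix l l F}, X * T' = Y * T' → X = Y := fun {X Y} h => by
    have := congrArg (· * T) h
    simpa [mul_assoc, h2] using this
  have c2 : ∀ {X Y : Matrix l l F}, T * X = T * Y → X = Y := fun {X Y} h => by
    have := congrArg (T' * ·) h
    simpa [← mul_assoc, h2] using this
  ext i j
  fin_cases i <;> fin_cases j
  · exact hN (add_right_cancel e1)
  · exact hN (c1 e2)
  · exact hN (c2 e3)
  · exact hN (add_right_cancel (c2 (c1 e4)))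

open Matrix in
theorem exists_hom_symplectic_of_finrank_le {E F : Type*} [Field E] [Field F] [Algebra F E]
    [FiniteDimensional F E] [Algebra.IsSeparable F E] {j n : ℕ} (hj : Module.finrank F E = j)
    (hjn : j ≤ n) :
    ∃ Ψ : SpecialLinearGroup (Fin 2) E →* symplecticGroup (Fin n) F, Function.Injective Ψ := by
  let b : Module.Basis (Fin j) F E := Module.finBasisOfFinrankEq F E hj
  let e : Fin j ⊕ Fin (n - j) ≃ Fin n :=
    finSumFinEquiv.trans (finCongr (by omega))
  let N : E →ₙ+* Matrix (Fin n) (Fin n) F :=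
    { toFun := fun x => reindexAlgEquiv F F e (fromBlocks (Algebra.leftMulMatrix b x) 0 0 0)
      map_mul' := fun x y => by rw [← map_mul, fromBlocks_multiply]; simp
      map_zero' := by simp
      map_add' := fun x y => by rw [← map_add, fromBlocks_add]; simp }
  have hN : Function.Injective N := by
    intro x y h
    have h1 := (reindexAlgEquiv F F e).injective h
    exact Algebra.leftMulMatrix_injective b (fromBlocks_inj.1 h1).1
  let M := Algebra.traceMatrix F b
  have hM : IsUnit M.det := by
    have := det_traceForm_ne_zero b
    exact isUnit_iff_ne_zero.2 (by simpa [M, Algebra.traceMatrix_of_basis] using this)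
  have hMT : Mᵀ = M := by
    ext i k
    simp [M, Algebra.traceMatrix_apply, Algebra.traceForm_apply, mul_comm]
  have hMx : ∀ x, (Algebra.leftMulMatrix b x)ᵀ * M = M * Algebra.leftMulMatrix b x := by
    intro x
    have key : ∀ i k, (M * Algebra.leftMulMatrix b x) i k = Algebra.trace F E (x * b i * b k) := by
      intro i k
      have hx := b.sum_repr (x * b k)
      rw [mul_apply]
      simp only [M, Algebra.traceMatrix_apply, Algebra.traceForm_apply,
        Algebra.leftMulMatrix_eq_repr_mul]
      calc _ = Algebra.trace F E (b i * ∑ t, b.repr (x * b k) t • b t) := by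
            rw [Finset.mul_sum, map_sum]
            refine Finset.sum_congr rfl fun t _ => ?_
            rw [mul_smul_comm, map_smul, smul_eq_mul, mul_comm]
        _ = _ := by rw [hx]; congr 1; ring
    ext i k
    rw [key, ← transpose_apply ((Algebra.leftMulMatrix b x)ᵀ * M), transpose_mul,
      transpose_transpose, hMT, key]
    congr 1; ring
  refine exists_hom_symplectic_of_self_adjoint N hN
    (reindexAlgEquiv F F e (fromBlocks M 0 0 1)) (reindexAlgEquiv F F e (fromBlocks M⁻¹ 0 0 1))
    ?_ ?_ fun x => ?_
  · rw [← map_mul, fromBlocks_multiply]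
    simp [mul_nonsing_inv _ hM]
  · simp only [coe_reindexAlgEquiv, transpose_reindex, fromBlocks_transpose, hMT]
    simp
  · change (reindex e e _)ᵀ * reindexAlgEquiv F F e _ = _ * reindexAlgEquiv F F e _
    rw [transpose_reindex, ← coe_reindexAlgEquiv F F, ← map_mul]
    rw [← map_mul]
    simp only [fromBlocks_transpose, fromBlocks_multiply, hMx]
    simp

open Matrix in
theorem symplectic_unipotent_mem {l F : Type*} [Fintype l] [DecidableEq l] [Field F]
    {B : Matrix l l F} (hB : Bᵀ = B) : fromBlocks 1 B 0 1 ∈ symplecticGroup l F := by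
  rw [SymplecticGroup.fromBlocks_mem_iff]
  simp [hB]

open Matrix in
theorem symplectic_unipotent_mem' {l F : Type*} [Fintype l] [DecidableEq l] [Field F] :
    fromBlocks 1 0 1 1 ∈ symplecticGroup l F := by
  rw [SymplecticGroup.fromBlocks_mem_iff]
  simp

open Matrix in
theorem sq_eq_one_of_mem_center_symplecticGroup {l F : Type*} [Fintype l] [DecidableEq l] [Field F]
    (z : symplecticGroup l F) (hz : z ∈ Subgroup.center (symplecticGroup l F)) : z ^ 2 = 1 := by
  obtain ⟨Z, hZ⟩ := z
  obtain ⟨A, B, C, D, rfl⟩ : ∃ A B C D, Z = fromBlocks A B C D :=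
    ⟨_, _, _, _, (fromBlocks_toBlocks Z).symm⟩
  have hc : ∀ X ∈ symplecticGroup l F, X * fromBlocks A B C D = fromBlocks A B C D * X :=
    fun X hX => congrArg Subtype.val (Subgroup.mem_center_iff.1 hz ⟨X, hX⟩)
  have h1 := hc _ (symplectic_unipotent_mem (B := 1) transpose_one)
  have h2 := hc _ symplectic_unipotent_mem'
  simp only [fromBlocks_multiply, fromBlocks_inj, one_mul, mul_one, zero_mul, mul_zero, add_zero,
    zero_add, add_eq_left, left_eq_add] at h1 h2
  obtain ⟨hC, hAD, -⟩ := h1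
  obtain ⟨hB, -, -⟩ := h2
  rw [hB, zero_add, add_zero] at hAD
  subst hC hB
  obtain rfl := hAD.symm
  have hs : ∀ i, Commute (single i i 1) A := by
    intro i
    have h3 := hc _ (symplectic_unipotent_mem (B := single i i 1) (by simp))
    simp only [fromBlocks_multiply, fromBlocks_inj, one_mul, mul_one, zero_mul, mul_zero, add_zero,
      zero_add] at h3
    exact h3.2.1
  have hAT : Aᵀ = A := by
    ext i j
    by_cases hij : i = j
    · rw [hij, transpose_apply]
    · rw [transpose_apply, col_eq_zero_of_commute_single (hs i) (Ne.symm hij),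
        col_eq_zero_of_commute_single (hs j) hij]
  have h4 := (SymplecticGroup.fromBlocks_mem_iff.1 hZ).2.2
  rw [hAT] at h4
  apply Subtype.ext
  change fromBlocks A 0 0 A ^ 2 = 1
  rw [sq, fromBlocks_multiply]
  rw [transpose_zero, zero_mul, sub_zero] at h4
  simp [h4, fromBlocks_one]

theorem orderOf_mk_center_symplecticGroup {l F : Type*} [Fintype l] [DecidableEq l] [Field F]
    (x : Matrix.symplecticGroup l F) (hx : Odd (orderOf x)) :
    orderOf (x : Matrix.symplecticGroup l F ⧸ Subgroup.center (Matrix.symplecticGroup l F)) =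
      orderOf x := by
  refine Nat.dvd_antisymm (orderOf_map_dvd (QuotientGroup.mk' _) x) ?_
  have h1 := pow_orderOf_eq_one
    (x : Matrix.symplecticGroup l F ⧸ Subgroup.center (Matrix.symplecticGroup l F))
  rw [← QuotientGroup.mk_pow, QuotientGroup.eq_one_iff] at h1
  have h2 := sq_eq_one_of_mem_center_symplecticGroup _ h1
  rw [← pow_mul] at h2
  exact (Nat.Coprime.symm (Nat.coprime_two_left.2 hx)).dvd_of_dvd_mul_right
    (orderOf_dvd_of_pow_eq_one h2)

open Matrix in
theorem exists_sl_two_orderOf_eq (E : Type*) [Field E] [Finite E] :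
    ∃ g : SpecialLinearGroup (Fin 2) E, orderOf g = Nat.card E - 1 := by
  obtain ⟨y, hy⟩ := exists_units_orderOf_eq E
  let f : Eˣ →* SpecialLinearGroup (Fin 2) E :=
    { toFun := fun y => ⟨!![(y : E), 0; 0, ((y⁻¹ : Eˣ) : E)], by simp⟩
      map_one' := by ext i j; fin_cases i <;> fin_cases j <;> simp
      map_mul' := fun a b => by
        apply Subtype.ext
        change _ = !![(a : E), 0; 0, ((a⁻¹ : Eˣ) : E)] * !![(b : E), 0; 0, ((b⁻¹ : Eˣ) : E)]
        simp [mul_comm] }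
  refine ⟨f y, ?_⟩
  rw [orderOf_injective f, hy]
  intro a b h
  exact Units.ext (congrFun (congrFun (congrArg Subtype.val h) 0) 0)

theorem odd_dvd_mem_elementOrders_psp {F : Type*} [Field F] [Fintype F] {j n d : ℕ} (hj : j ≠ 0)
    (hjn : j ≤ n) (hd : Odd d)
    (h : d ∣ Fintype.card F ^ j - 1 ∨ d ∣ Fintype.card F ^ j + 1) :
    d ∈ elementOrders (PSp n F) := by
  obtain ⟨E, hE, hA, hE', hcard, hfr⟩ := exists_finite_field_extension F hj
  have _ : FiniteDimensional F E := Module.finite_of_finrank_pos (by omega)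
  obtain ⟨Ψ, hΨ⟩ := exists_hom_symplectic_of_finrank_le hfr hjn
  rw [Nat.card_eq_fintype_card (α := F)] at hcard
  obtain ⟨g, hg⟩ : ∃ g : Matrix.SpecialLinearGroup (Fin 2) E, d ∣ orderOf g := by
    rcases h with h | h
    · obtain ⟨g, hg⟩ := exists_sl_two_orderOf_eq E
      exact ⟨g, by rwa [hg, hcard]⟩
    · obtain ⟨g, hg⟩ := exists_sl_orderOf_eq E two_ne_zero
      refine ⟨g, ?_⟩
      have h1 : 1 < Nat.card E := Finite.one_lt_card
      have h2 : (Nat.card E ^ 2 - 1) / (Nat.card E - 1) = Nat.card E + 1 := by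
        apply Nat.div_eq_of_eq_mul_left (by omega)
        simpa using Nat.sq_sub_sq (Nat.card E) 1
      rwa [hg, h2, hcard]
  have hpos : orderOf g ≠ 0 := (orderOf_pos g).ne'
  obtain ⟨c, hc⟩ := hg
  have hgc : orderOf (g ^ c) = d := by
    have hc0 : c ≠ 0 := by rintro rfl; simp [hc] at hpos
    rw [orderOf_pow_of_dvd hc0 ⟨d, by rw [hc, mul_comm]⟩, hc,
      Nat.mul_div_cancel _ (Nat.pos_of_ne_zero hc0)]
  refine ⟨(Ψ (g ^ c) : Matrix.symplecticGroup (Fin n) F), ?_⟩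
  rw [orderOf_mk_center_symplecticGroup, orderOf_injective Ψ hΨ, hgc]
  rwa [orderOf_injective Ψ hΨ, hgc]

open Matrix in
/-- The root subgroup `t ↦ 1 + t b fᵀ` of `SL` attached to a vector `b` and a covector `f` with
`f b = 0`. -/
noncomputable def rootHom {I E : Type*} [Fintype I] [DecidableEq I] [Field E] (b f : I → E)
    (h : f ⬝ᵥ b = 0) : Multiplicative E →* SpecialLinearGroup I E where
  toFun t := ⟨1 + t.toAdd • vecMulVec b f, by
    rw [← smul_vecMulVec, vecMulVec_eq Unit, det_one_add_replicateCol_mul_replicateRow,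
      dotProduct_smul, h, smul_zero, add_zero]⟩
  map_one' := Subtype.ext (by simp)
  map_mul' s t := Subtype.ext (by
    change 1 + (s.toAdd + t.toAdd) • vecMulVec b f =
      (1 + s.toAdd • vecMulVec b f) * (1 + t.toAdd • vecMulVec b f)
    rw [mul_add, add_mul, add_mul, mul_one, one_mul, mul_one, smul_mul_smul_comm,
      vecMulVec_mul_vecMulVec, h, zero_smul, vecMulVec_zero, smul_zero, add_zero, add_smul,
          add_assoc])

namespace rootHom

open Matrix

variable {I E : Type*} [Fintype I] [DecidableEq I] [Field E] {b f : I → E} (h : f ⬝ᵥ b = 0)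

theorem coe_apply (t : Multiplicative E) :
    (rootHom b f h t : Matrix I I E) = 1 + t.toAdd • vecMulVec b f := rfl

theorem pow_char (v : ℕ) [CharP E v] (t : Multiplicative E) : rootHom b f h t ^ v = 1 := by
  rw [← map_pow]
  have : t ^ v = 1 := by
    apply Multiplicative.toAdd.injective
    rw [toAdd_pow, nsmul_eq_mul, CharP.cast_eq_zero, zero_mul, toAdd_one]
  rw [this, map_one]

theorem injective (hb : b ≠ 0) (hf : f ≠ 0) : Function.Injective (rootHom b f h) := by
  intro s t hst
  have h1 : (1 : Matrix I I E) + s.toAdd • vecMulVec b f = 1 + t.toAdd • vecMulVec b f :=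
    congrArg Subtype.val hst
  have h2 : vecMulVec b f ≠ 0 := by
    obtain ⟨i, hi⟩ := Function.ne_iff.1 hb
    obtain ⟨j, hj⟩ := Function.ne_iff.1 hf
    intro h0
    have := congrFun (congrFun h0 i) j
    simp only [vecMulVec_apply, Matrix.zero_apply, mul_eq_zero] at this
    exact this.elim hi hj
  exact smul_left_injective E h2 (add_left_cancel h1)

theorem conj_apply (g : SpecialLinearGroup I E) (t : Multiplicative E)
    (h' : (f ᵥ* (g⁻¹ : SpecialLinearGroup I E).1) ⬝ᵥ (g.1 *ᵥ b) = 0) :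
    g * rootHom b f h t * g⁻¹ =
      rootHom (g.1 *ᵥ b) (f ᵥ* (g⁻¹ : SpecialLinearGroup I E).1) h' t := by
  apply Subtype.ext
  change g.1 * (1 + t.toAdd • vecMulVec b f) * (g⁻¹ : SpecialLinearGroup I E).1 = 1 + _
  have h1 : g.1 * (g⁻¹ : SpecialLinearGroup I E).1 = 1 :=
    congrArg Subtype.val (mul_inv_cancel g)
  rw [mul_add, mul_one, add_mul, h1, mul_smul_comm, smul_mul_assoc, mul_vecMulVec,
    vecMulVec_mul]

theorem conj_dotProduct (h : f ⬝ᵥ b = 0) (g : SpecialLinearGroup I E) :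
    (f ᵥ* (g⁻¹ : SpecialLinearGroup I E).1) ⬝ᵥ (g.1 *ᵥ b) = 0 := by
  have h1 : (g⁻¹ : SpecialLinearGroup I E).1 * g.1 = 1 :=
    congrArg Subtype.val (inv_mul_cancel g)
  rw [dotProduct_mulVec, vecMul_vecMul, h1, vecMul_one, h]

end rootHom

open Matrix in
theorem eq_one_of_mem_center_of_pow_char {I E : Type*} [Fintype I] [DecidableEq I] [Field E]
    {v : ℕ} [Fact v.Prime] [CharP E v] {z : SpecialLinearGroup I E}
    (hz : z ∈ Subgroup.center (SpecialLinearGroup I E)) (h : z ^ v = 1) : z = 1 := by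
  obtain ⟨c, -, hc⟩ := Matrix.SpecialLinearGroup.mem_center_iff.1 hz
  rcases isEmpty_or_nonempty I with hI | ⟨⟨i⟩⟩
  · exact Subsingleton.elim _ _
  have h1 : (scalar I c) ^ v = 1 := by
    rw [hc]
    exact congrArg Subtype.val h
  have h2 : c ^ v = 1 := by
    rw [← map_pow] at h1
    have := congrFun (congrFun h1 i) i
    simpa using this
  have h3 : c = 1 := frobenius_inj E v (by simp [frobenius_def, h2])
  apply Subtype.ext
  change z.1 = 1
  rw [← hc, h3, map_one]

open Matrix in
/-- An element commuting with a `v`-element modulo scalars commutes with it, in characteristic `v`. -/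
theorem commute_of_mul_mem_center {I E : Type*} [Fintype I] [DecidableEq I] [Field E]
    {v : ℕ} [Fact v.Prime] [CharP E v] {g x : SpecialLinearGroup I E} (hx : x ^ v = 1)
    (h : x⁻¹ * (g * x * g⁻¹) ∈ Subgroup.center (SpecialLinearGroup I E)) : g * x = x * g := by
  set z := x⁻¹ * (g * x * g⁻¹) with hz
  have h1 : g * x * g⁻¹ = x * z := by rw [hz]; group
  have h2 : z ^ v = 1 := by
    have h3 : (g * x * g⁻¹) ^ v = x ^ v * z ^ v := by
      rw [h1, Commute.mul_pow (Subgroup.mem_center_iff.1 h x)]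
    rw [conj_pow, hx, mul_one, mul_inv_cancel, one_mul] at h3
    exact h3.symm
  have h3 := eq_one_of_mem_center_of_pow_char h h2
  rw [h3, mul_one] at h1
  exact mul_inv_eq_iff_eq_mul.1 h1

open Matrix in
theorem eq_scalar_add_of_commute {I E : Type*} [Fintype I] [DecidableEq I] [Field E] {o l : I}
    (hol : o ≠ l) (g : Matrix I I E) (h1 : ∀ j, j ≠ o → Commute (single o j 1) g)
    (h2 : ∀ i, i ≠ l → Commute (single i l 1) g) :
    g = g o o • 1 + g o l • single o l 1 := by
  have hd : ∀ j, g j j = g o o := by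
    intro j
    by_cases hj : j = o
    · rw [hj]
    have := congrFun (congrFun (h1 j hj) o) j
    simpa using this
  have hr : ∀ j, j ≠ o → ∀ k, k ≠ j → g j k = 0 := by
    intro j hj k hk
    exact row_eq_zero_of_commute_single (h1 j hj) hk
  have hc : ∀ i, i ≠ l → ∀ k, k ≠ i → g k i = 0 := by
    intro i hi k hk
    exact col_eq_zero_of_commute_single (h2 i hi) hk
  ext i j
  by_cases hij : i = j
  · subst hij
    have : ¬ (o = i ∧ l = i) := fun h => hol (h.1.trans h.2.symm)
    simp [hd i, this]
  · by_cases hi : o = i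
    · subst hi
      by_cases hj : l = j
      · subst hj; simp [hij]
      · simp [hij, hj, hc j (Ne.symm hj) o hij]
    · simp [hij, hi, hr i (Ne.symm hi) j (Ne.symm hij)]

theorem single_dotProduct_single_of_ne {I E : Type*} [Fintype I] [DecidableEq I] [Field E]
    {i j : I} (hij : i ≠ j) : (Pi.single j 1 : I → E) ⬝ᵥ Pi.single i 1 = 0 := by
  simp [hij]

open Matrix in
/-- The root subgroup `t ↦ 1 + t E_{ij}`. -/
noncomputable def stdRoot {I : Type*} (E : Type*) [Fintype I] [DecidableEq I] [Field E]
    {i j : I} (hij : i ≠ j) : Multiplicative E →* SpecialLinearGroup I E :=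
  rootHom (Pi.single i 1) (Pi.single j 1) (single_dotProduct_single_of_ne hij)

open Matrix in
theorem coe_stdRoot {I E : Type*} [Fintype I] [DecidableEq I] [Field E] {i j : I} (hij : i ≠ j)
    (t : Multiplicative E) : (stdRoot E hij t : Matrix I I E) = 1 + single i j t.toAdd := by
  rw [stdRoot, rootHom.coe_apply, ← single_eq_single_vecMulVec_single, smul_single, smul_eq_mul,
    mul_one]

open Matrix in
theorem commute_single_of_commute_stdRoot {I E : Type*} [Fintype I] [DecidableEq I] [Field E]
    {i j : I} (hij : i ≠ j) {t : Multiplicative E} (ht : t ≠ 1) {g : SpecialLinearGroup I E}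
    (h : g * stdRoot E hij t = stdRoot E hij t * g) : Commute (single i j 1) g.1 := by
  have h1 : g.1 * (1 + single i j t.toAdd) = (1 + single i j t.toAdd) * g.1 := by
    rw [← coe_stdRoot hij]
    exact congrArg Subtype.val h
  rw [mul_add, add_mul, mul_one, one_mul, add_right_inj] at h1
  have ht' : t.toAdd ≠ 0 := ht
  have h2 : (single i j 1 : Matrix I I E) = t.toAdd⁻¹ • single i j t.toAdd := by
    rw [smul_single, smul_eq_mul, inv_mul_cancel₀ ht']
  rw [h2]
  exact Commute.smul_left h1.symm _

open Matrix in
theorem mem_center_of_commute_single {I E : Type*} [Fintype I] [DecidableEq I] [Field E]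
    {g : SpecialLinearGroup I E} (h : ∀ i j, i ≠ j → Commute (single i j 1) g.1) :
    g ∈ Subgroup.center (SpecialLinearGroup I E) := by
  obtain ⟨c, hc⟩ := mem_range_scalar_of_commute_single (M := g.1) fun i j hij => h i j hij
  rw [Subgroup.mem_center_iff]
  intro x
  apply Subtype.ext
  change x.1 * g.1 = g.1 * x.1
  rw [← hc]
  exact ((scalar_commute c (Commute.all _) x.1)).symm.eq

open Matrix in
theorem center_psl_eq_bot {I E : Type*} [Fintype I] [DecidableEq I] [Field E] (v : ℕ)
    [Fact v.Prime] [CharP E v] (x : SpecialLinearGroup I E ⧸ Subgroup.center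
        (SpecialLinearGroup I E))
    (hx : ∀ y, y * x = x * y) : x = 1 := by
  obtain ⟨g, rfl⟩ := QuotientGroup.mk_surjective x
  rw [QuotientGroup.eq_one_iff]
  refine mem_center_of_commute_single fun i j hij => ?_
  refine commute_single_of_commute_stdRoot hij (t := Multiplicative.ofAdd 1) ?_ ?_
  · exact one_ne_zero (α := E)
  refine commute_of_mul_mem_center (v := v) (rootHom.pow_char _ v _) ?_
  rw [← QuotientGroup.eq_one_iff]
  rw [QuotientGroup.mk_mul, QuotientGroup.mk_mul, QuotientGroup.mk_mul, QuotientGroup.mk_inv,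
    QuotientGroup.mk_inv, ← hx, mul_inv_cancel_right, inv_mul_cancel]

/-- `φ` exhibits `A` as a group with a normal subgroup `PSL` having trivial centralizer. -/
structure IsSLCover {I E A : Type*} [Fintype I] [DecidableEq I] [Field E] [Group A]
    (φ : Matrix.SpecialLinearGroup I E →* A) : Prop where
  map_eq_one_iff : ∀ g, φ g = 1 ↔ g ∈ Subgroup.center (Matrix.SpecialLinearGroup I E)
  normal : φ.range.Normal
  eq_one_of_centralizes : ∀ a, (∀ g, a * φ g = φ g * a) → a = 1

theorem exists_isSLCover {E A : Type*} [Field E] [Group A] {n : ℕ} (v : ℕ) [Fact v.Prime]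
    [CharP E v] (ι : A →* MulAut (PSL n E)) (hι : Function.Injective ι)
    (hInn : (MulAut.conj (G := PSL n E)).range ≤ ι.range) :
    ∃ φ : Matrix.SpecialLinearGroup (Fin n) E →* A, IsSLCover φ ∧
      ∀ g, ι (φ g) = MulAut.conj (g : PSL n E) := by
  let e := MonoidHom.ofInjective hι
  let c : PSL n E →* ι.range :=
    (MulAut.conj (G := PSL n E)).codRestrict ι.range fun x => hInn ⟨x, rfl⟩
  let φ : Matrix.SpecialLinearGroup (Fin n) E →* A :=
    e.symm.toMonoidHom.comp (c.comp (QuotientGroup.mk' _))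
  have hφ : ∀ g, ι (φ g) = MulAut.conj (g : PSL n E) := by
    intro g
    exact congrArg Subtype.val (e.apply_symm_apply (c (g : PSL n E)))
  refine ⟨φ, ⟨fun g => ?_, ⟨?_⟩, fun a ha => ?_⟩, hφ⟩
  · rw [← QuotientGroup.eq_one_iff]
    constructor
    · intro h
      refine center_psl_eq_bot v _ fun y => ?_
      have h1 := hφ g
      rw [h, map_one] at h1
      have h2 := congrArg (fun f : MulAut (PSL n E) => f y) h1
      simp only [MulAut.one_apply, MulAut.conj_apply] at h2
      exact (eq_mul_inv_iff_mul_eq.1 h2)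
    · intro h
      apply hι
      rw [hφ, h, map_one, map_one]
  · rintro _ ⟨g, rfl⟩ a
    obtain ⟨g', hg'⟩ := QuotientGroup.mk_surjective (ι a (g : PSL n E))
    refine ⟨g', hι ?_⟩
    rw [hφ, hg', map_mul, map_mul, hφ, map_inv]
    ext x
    simp
  · apply hι
    rw [map_one]
    ext x
    obtain ⟨g, rfl⟩ := QuotientGroup.mk_surjective x
    have h1 := congrArg ι (ha g)
    rw [map_mul, map_mul, hφ] at h1
    rw [MulAut.one_apply, ← mul_inv_eq_one]
    refine center_psl_eq_bot v _ fun y => ?_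
    have h2 := congrArg (fun f : MulAut (PSL n E) => f ((ι a)⁻¹ ((g : PSL n E)⁻¹ * y *
        (g : PSL n E)))) h1
    simp only [MulAut.mul_apply, MulAut.conj_apply, map_mul, map_inv, MulAut.apply_inv_self] at h2
    have h3 : (ι a (g : PSL n E)) * (g : PSL n E)⁻¹ * y *
        ((ι a (g : PSL n E)) * (g : PSL n E)⁻¹)⁻¹ = y := by
      rw [mul_inv_rev, inv_inv]
      simpa [mul_assoc] using h2
    exact (mul_inv_eq_iff_eq_mul.1 h3).symm

open Matrix in
/-- Relabelling the rows and columns of a matrix of determinant one. -/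
def slReindex {I J : Type*} (E : Type*) [Fintype I] [DecidableEq I] [Fintype J] [DecidableEq J]
    [Field E] (e : I ≃ J) : SpecialLinearGroup I E ≃* SpecialLinearGroup J E where
  toFun g := ⟨reindexAlgEquiv E E e g.1, by rw [coe_reindexAlgEquiv, det_reindex_self, g.2]⟩
  invFun g := ⟨reindexAlgEquiv E E e.symm g.1, by rw [coe_reindexAlgEquiv, det_reindex_self, g.2]⟩
  left_inv g := Subtype.ext (by simp)
  right_inv g := Subtype.ext (by simp)
  map_mul' g h := Subtype.ext (map_mul (reindexAlgEquiv E E e) g.1 h.1)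

theorem IsSLCover.comp_equiv {I J E A : Type*} [Fintype I] [DecidableEq I] [Fintype J]
    [DecidableEq J] [Field E] [Group A] {φ : Matrix.SpecialLinearGroup J E →* A}
    (h : IsSLCover φ) (e : I ≃ J) : IsSLCover (φ.comp (slReindex E e).toMonoidHom) := by
  have hr : (φ.comp (slReindex E e).toMonoidHom).range = φ.range := by
    ext x
    constructor
    · rintro ⟨g, rfl⟩
      exact ⟨_, rfl⟩
    · rintro ⟨g, rfl⟩
      exact ⟨(slReindex E e).symm g, congrArg φ ((slReindex E e).apply_symm_apply g)⟩
  refine ⟨fun g => ?_, by rw [hr]; exact h.normal,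
      fun a ha => h.eq_one_of_centralizes a fun g => ?_⟩
  · change φ (slReindex E e g) = 1 ↔ _
    rw [h.map_eq_one_iff, Subgroup.mem_center_iff, Subgroup.mem_center_iff]
    constructor
    · intro h1 x
      apply (slReindex E e).injective
      rw [map_mul, map_mul, h1]
    · intro h1 x
      obtain ⟨y, rfl⟩ := (slReindex E e).surjective x
      rw [← map_mul, h1, map_mul]
  · have := ha ((slReindex E e).symm g)
    simpa using this

theorem IsSLCover.commute_of_commute {I E A : Type*} [Fintype I] [DecidableEq I] [Field E] [Group A]
    {φ : Matrix.SpecialLinearGroup I E →* A} (h : IsSLCover φ) {v : ℕ} [Fact v.Prime] [CharP E v]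
    {g x : Matrix.SpecialLinearGroup I E} (hx : x ^ v = 1) (hgx : φ g * φ x = φ x * φ g) :
    g * x = x * g := by
  refine commute_of_mul_mem_center hx ((h.map_eq_one_iff _).1 ?_)
  rw [map_mul, map_mul, map_mul, map_inv, map_inv, hgx]
  group

section rootSubgroup

open Matrix

variable {I E A : Type*} [Fintype I] [DecidableEq I] [Field E] [Group A]

theorem stdRoot_commute {i j k l : I} (hij : i ≠ j) (hkl : k ≠ l) (hjk : j ≠ k) (hli : l ≠ i)
    (s t : Multiplicative E) :
    stdRoot E hij s * stdRoot E hkl t = stdRoot E hkl t * stdRoot E hij s := by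
  apply Subtype.ext
  change (stdRoot E hij s).1 * (stdRoot E hkl t).1 = (stdRoot E hkl t).1 * (stdRoot E hij s).1
  rw [coe_stdRoot, coe_stdRoot]
  simp only [mul_add, add_mul, mul_one, one_mul]
  rw [single_mul_single_of_ne _ _ _ _ hjk, single_mul_single_of_ne _ _ _ _ hli]
  abel

theorem stdRoot_pow_char {i j : I} (hij : i ≠ j) (v : ℕ) [CharP E v] (t : Multiplicative E) :
    stdRoot E hij t ^ v = 1 :=
  rootHom.pow_char _ v t

theorem stdRoot_injective {i j : I} (hij : i ≠ j) : Function.Injective (stdRoot E hij) :=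
  rootHom.injective _ (by simp) (by simp)

/-- The image of a root subgroup under a homomorphism from `SL`. -/
noncomputable def rootSubgroup (φ : SpecialLinearGroup I E →* A) {i j : I} (hij : i ≠ j) :
    Subgroup A :=
  (stdRoot E hij).range.map φ

variable {φ : SpecialLinearGroup I E →* A}

theorem mem_rootSubgroup {i j : I} {hij : i ≠ j} {a : A} :
    a ∈ rootSubgroup φ hij ↔ ∃ t, φ (stdRoot E hij t) = a := by
  simp [rootSubgroup]

theorem IsSLCover.eq_one_of_map_rootHom (h : IsSLCover φ) (v : ℕ) [Fact v.Prime] [CharP E v]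
    {x : SpecialLinearGroup I E} (hx : x ^ v = 1) (h1 : φ x = 1) : x = 1 :=
  eq_one_of_mem_center_of_pow_char ((h.map_eq_one_iff _).1 h1) hx

theorem IsSLCover.map_stdRoot_injective (h : IsSLCover φ) (v : ℕ) [Fact v.Prime] [CharP E v]
    {i j : I} (hij : i ≠ j) : Function.Injective fun t => φ (stdRoot E hij t) := by
  have : Function.Injective (φ.comp (stdRoot E hij)) := by
    rw [injective_iff_map_eq_one]
    intro t ht
    apply stdRoot_injective hij
    rw [map_one]
    exact h.eq_one_of_map_rootHom v (stdRoot_pow_char hij v t) ht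
  exact this

theorem IsSLCover.card_rootSubgroup (h : IsSLCover φ) (v : ℕ) [Fact v.Prime] [CharP E v]
    {i j : I} (hij : i ≠ j) : Nat.card (rootSubgroup φ hij) = Nat.card E := by
  have : rootSubgroup φ hij = (φ.comp (stdRoot E hij)).range := by
    rw [rootSubgroup, MonoidHom.map_range]
  rw [this, ← Nat.card_congr (MonoidHom.ofInjective (h.map_stdRoot_injective v hij)).toEquiv]
  rfl

theorem IsSLCover.mem_rootSubgroup_of_commute (h : IsSLCover φ) {o l : I} (hol : o ≠ l)
    {g : SpecialLinearGroup I E}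
    (h1 : ∀ (j : I) (hj : o ≠ j) t, g * stdRoot E hj t = stdRoot E hj t * g)
    (h2 : ∀ (i : I) (hi : i ≠ l) t, g * stdRoot E hi t = stdRoot E hi t * g) :
    φ g ∈ rootSubgroup φ hol := by
  have ht : Multiplicative.ofAdd (1 : E) ≠ 1 := one_ne_zero (α := E)
  have hg := eq_scalar_add_of_commute hol g.1
    (fun j hj => commute_single_of_commute_stdRoot hj.symm ht (h1 j hj.symm _))
    (fun i hi => commute_single_of_commute_stdRoot hi ht (h2 i hi _))
  set c := g.1 o o
  set d := g.1 o l
  have hc : c ≠ 0 := by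
    intro hc
    have hdet := g.2
    rw [hg, det_eq_zero_of_row_eq_zero l] at hdet
    · exact zero_ne_one hdet
    · intro j
      simp [hc, hol]
  rw [mem_rootSubgroup]
  refine ⟨Multiplicative.ofAdd (d / c), ?_⟩
  rw [eq_comm, ← mul_inv_eq_one, ← map_inv, ← map_inv, ← map_mul, h.map_eq_one_iff]
  refine mem_center_of_commute_single fun i j _ => ?_
  have : (g * stdRoot E hol (Multiplicative.ofAdd (d / c))⁻¹).1 = c • (1 : Matrix I I E) := by
    change g.1 * (stdRoot E hol (Multiplicative.ofAdd (d / c))⁻¹).1 = _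
    rw [coe_stdRoot, hg, mul_add, mul_one, add_mul, smul_mul_assoc, one_mul, smul_single,
      smul_single, single_mul_single_of_ne _ _ _ _ hol.symm, add_zero, add_assoc, ← single_add,
      toAdd_inv, toAdd_ofAdd, smul_eq_mul, smul_eq_mul, mul_one, mul_neg, mul_div_cancel₀ _ hc,
      add_neg_cancel, single_zero, add_zero]
  rw [this]
  exact (Commute.one_right _).smul_right c

theorem IsSLCover.mem_rootSubgroup_iff (h : IsSLCover φ) (v : ℕ) [Fact v.Prime] [CharP E v]
    {o l : I} (hol : o ≠ l) {t : Multiplicative E} (ht : t ≠ 1) (y : A) :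
    y ∈ rootSubgroup φ hol ↔ y ∈ φ.range ∧
      ∀ c ∈ φ.range, c * φ (stdRoot E hol t) = φ (stdRoot E hol t) * c → c * y = y * c := by
  constructor
  · intro hy
    obtain ⟨s, rfl⟩ := mem_rootSubgroup.1 hy
    refine ⟨⟨_, rfl⟩, ?_⟩
    rintro _ ⟨g, rfl⟩ hg
    have h1 := commute_single_of_commute_stdRoot hol ht
      (h.commute_of_commute (stdRoot_pow_char hol v t) hg)
    rw [← map_mul, ← map_mul]
    congr 1
    apply Subtype.ext
    change g.1 * (stdRoot E hol s).1 = (stdRoot E hol s).1 * g.1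
    have h2 : (single o l s.toAdd : Matrix I I E) = s.toAdd • single o l 1 := by
      rw [smul_single, smul_eq_mul, mul_one]
    rw [coe_stdRoot, h2]
    exact ((Commute.one_left g.1).add_left (h1.smul_left _)).symm.eq
  · rintro ⟨⟨g, rfl⟩, hg⟩
    refine h.mem_rootSubgroup_of_commute hol (fun j hj s => ?_) fun i hi s => ?_
    · refine h.commute_of_commute (stdRoot_pow_char hj v s) (hg _ ⟨_, rfl⟩ ?_).symm
      rw [← map_mul, ← map_mul, stdRoot_commute _ _ hj.symm hol.symm]
    · refine h.commute_of_commute (stdRoot_pow_char hi v s) (hg _ ⟨_, rfl⟩ ?_).symm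
      rw [← map_mul, ← map_mul, stdRoot_commute _ _ hol.symm hi.symm]

theorem IsSLCover.mem_normalizer_rootSubgroup [Finite A] (h : IsSLCover φ) (v : ℕ) [Fact v.Prime]
    [CharP E v] {o l : I} (hol : o ≠ l) {t : Multiplicative E} (ht : t ≠ 1) {a : A}
    (ha : a * φ (stdRoot E hol t) * a⁻¹ ∈ rootSubgroup φ hol) :
    a ∈ Subgroup.normalizer (rootSubgroup φ hol : Set A) := by
  obtain ⟨s, hs⟩ := mem_rootSubgroup.1 ha
  have hs1 : s ≠ 1 := by
    rintro rfl
    rw [map_one, map_one, eq_comm, conj_eq_one_iff] at hs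
    exact ht (h.map_stdRoot_injective v hol (by simp [hs]))
  refine Subgroup.mem_normalizer_fintype fun n hn => ?_
  have hn' := (h.mem_rootSubgroup_iff v hol ht n).1 hn
  refine (h.mem_rootSubgroup_iff v hol hs1 _).2 ⟨h.normal.conj_mem _ hn'.1 a, fun c hc hcs => ?_⟩
  have h1 := hn'.2 (a⁻¹ * c * a) (by simpa using h.normal.conj_mem _ hc a⁻¹) (by
    rw [hs] at hcs
    have := congrArg (fun x => a⁻¹ * x * a) hcs
    simpa [mul_assoc] using this)
  have := congrArg (fun x => a * x * a⁻¹) h1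
  simpa [mul_assoc] using this

end rootSubgroup

section unipotent

open Matrix

variable {I E A : Type*} [Fintype I] [DecidableEq I] [Field E] [Group A]

theorem isPGroup_closure_of_unipotent [Finite E] (v : ℕ) [Fact v.Prime] [CharP E v]
    (N : Set (Matrix I I E)) (h0 : 0 ∈ N) (hadd : ∀ a ∈ N, ∀ b ∈ N, a + b + a * b ∈ N)
    (h3 : ∀ a ∈ N, a ^ 3 = 0) (T : Set (SpecialLinearGroup I E)) (hT : ∀ g ∈ T, g.1 - 1 ∈ N) :
    IsPGroup v (Subgroup.closure T) := by
  have key : ∀ g ∈ Subgroup.closure T, g.1 - 1 ∈ N := by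
    intro g hg
    rw [← Subgroup.mem_toSubmonoid, Subgroup.closure_toSubmonoid_of_finite] at hg
    induction hg using Submonoid.closure_induction with
    | mem x hx => exact hT x hx
    | one =>
      change (1 : Matrix I I E) - 1 ∈ N
      rwa [sub_self]
    | mul x y _ _ hx hy =>
      change x.1 * y.1 - 1 ∈ N
      have := hadd _ hx _ hy
      rwa [show x.1 - 1 + (y.1 - 1) + (x.1 - 1) * (y.1 - 1) = x.1 * y.1 - 1 by noncomm_ring] at this
  rintro ⟨g, hg⟩
  refine ⟨2, Subtype.ext (Subtype.ext ?_)⟩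
  change g.1 ^ v ^ 2 = 1
  rcases isEmpty_or_nonempty I with hI | hI
  · exact Subsingleton.elim _ _
  have h1 : (g.1 - 1) ^ v ^ 2 = 0 := by
    have h2 : 3 ≤ v ^ 2 := by have := (Fact.out : v.Prime).two_le; nlinarith
    exact pow_eq_zero_of_le h2 (h3 _ (key g hg))
  rw [sub_pow_char_pow_of_commute _ _ (Commute.one_right _), one_pow] at h1
  exact sub_eq_zero.1 h1

theorem isPGroup_closure_stdRoot [Finite E] (v : ℕ) [Fact v.Prime] [CharP E v] {o l : I}
    (hol : o ≠ l) :
    IsPGroup v (Subgroup.closure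
      ({g : SpecialLinearGroup I E | (∃ (j : I) (hj : o ≠ j) (t : _), stdRoot E hj t = g) ∨
        ∃ (i : I) (hi : i ≠ l) (t : _), stdRoot E hi t = g})) := by
  refine isPGroup_closure_of_unipotent v
    {N | (∀ i j, i ≠ o → j ≠ l → N i j = 0) ∧ N o o = 0 ∧ N l l = 0} ?_ ?_ ?_ _ ?_
  · simp
  · rintro a ⟨ha, ha1, ha2⟩ b ⟨hb, hb1, hb2⟩
    refine ⟨fun i j hi hj => ?_, ?_, ?_⟩
    · rw [Matrix.add_apply, Matrix.add_apply, ha i j hi hj, hb i j hi hj, mul_apply,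
        Finset.sum_eq_zero, add_zero,
        add_zero]
      intro k _
      by_cases hk : k = l
      · subst hk; rw [hb _ _ hol.symm hj, mul_zero]
      · rw [ha _ _ hi hk, zero_mul]
    · rw [Matrix.add_apply, Matrix.add_apply, ha1, hb1, mul_apply, Finset.sum_eq_zero, add_zero,
        add_zero]
      intro k _
      by_cases hk : k = o
      · subst hk; rw [ha1, zero_mul]
      · rw [hb _ _ hk hol, mul_zero]
    · rw [Matrix.add_apply, Matrix.add_apply, ha2, hb2, mul_apply, Finset.sum_eq_zero, add_zero,
        add_zero]
      intro k _
      by_cases hk : k = l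
      · subst hk; rw [ha2, zero_mul]
      · rw [ha _ _ hol.symm hk, zero_mul]
  · rintro a ⟨ha, ha1, ha2⟩
    have h2 : ∀ i j, i ≠ o ∨ j ≠ l → (a * a) i j = 0 := by
      intro i j hij
      rw [mul_apply]
      refine Finset.sum_eq_zero fun k _ => ?_
      by_cases hi : i = o
      · subst hi
        have hj := hij.resolve_left (by simp)
        by_cases hk : k = i
        · rw [hk, ha1, zero_mul]
        · rw [ha k j hk hj, mul_zero]
      · by_cases hk : k = l
        · subst hk
          by_cases hj : j = k
          · rw [hj, ha2, mul_zero]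
          · rw [ha k j hol.symm hj, mul_zero]
        · rw [ha i k hi hk, zero_mul]
    ext i j
    rw [pow_succ, pow_two, mul_apply, Matrix.zero_apply]
    refine Finset.sum_eq_zero fun k _ => ?_
    by_cases hk : k = l
    · subst hk
      by_cases hj : j = k
      · rw [hj, ha2, mul_zero]
      · rw [ha k j hol.symm hj, mul_zero]
    · rw [h2 i k (Or.inr hk), zero_mul]
  · rintro g (⟨j, hj, t, rfl⟩ | ⟨i, hi, t, rfl⟩)
    · rw [coe_stdRoot, add_sub_cancel_left]
      refine ⟨fun a b ha _ => single_apply_of_row_ne (Ne.symm ha) _ _ _,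
        single_apply_of_col_ne _ _ hj.symm _, single_apply_of_row_ne hol _ _ _⟩
    · rw [coe_stdRoot, add_sub_cancel_left]
      refine ⟨fun a b _ hb => single_apply_of_col_ne _ _ (Ne.symm hb) _,
        single_apply_of_col_ne _ _ hol.symm _, single_apply_of_row_ne hi _ _ _⟩

theorem IsSLCover.exists_mul_mem_normalizer_rootSubgroup [Finite A] [Finite E]
    {φ : SpecialLinearGroup I E →* A} (h : IsSLCover φ) (v : ℕ) [Fact v.Prime]
    [CharP E v] {o l : I} (hol : o ≠ l) (a : A) :
    ∃ s, φ s * a ∈ Subgroup.normalizer (rootSubgroup φ hol : Set A) := by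
  have hN := h.normal
  obtain ⟨P, hP⟩ := ((isPGroup_closure_stdRoot v hol (E := E)).map φ.rangeRestrict).exists_le_sylow
  set P' := (P : Subgroup φ.range).map φ.range.subtype with hP'
  have hmem : ∀ g ∈ Subgroup.closure
      ({g : SpecialLinearGroup I E | (∃ (j : I) (hj : o ≠ j) (t : _), stdRoot E hj t = g) ∨
        ∃ (i : I) (hi : i ≠ l) (t : _), stdRoot E hi t = g}), φ g ∈ P' := fun g hg =>
    ⟨φ.rangeRestrict g, hP ⟨g, hg, rfl⟩, rfl⟩
  have hfr := P.normalizer_sup_eq_top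
  have ha : a ∈ φ.range ⊔ Subgroup.normalizer (P' : Set A) := by
    rw [sup_comm, hP', hfr]
    trivial
  rw [Subgroup.mem_sup_of_normal_left] at ha
  obtain ⟨_, ⟨s, rfl⟩, z, hz, rfl⟩ := ha
  refine ⟨s⁻¹, ?_⟩
  rw [map_inv, inv_mul_cancel_left]
  have hne : P' ≠ ⊥ := by
    intro hbot
    have h1 := hmem (stdRoot E hol (Multiplicative.ofAdd 1))
      (Subgroup.subset_closure (Or.inl ⟨l, hol, _, rfl⟩))
    rw [hbot, Subgroup.mem_bot] at h1
    have := h.map_stdRoot_injective v hol (a₁ := Multiplicative.ofAdd 1) (a₂ := 1) (by simp [h1])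
    exact one_ne_zero (α := E) this
  obtain ⟨Z, hZP, hZ, hZc, hZn⟩ := exists_central_subgroup (Fact.out : v.Prime)
    (P.2.map φ.range.subtype) hne
  have hZX : Z ≤ rootSubgroup φ hol := by
    intro w hw
    obtain ⟨⟨_, g, rfl⟩, -, rfl⟩ := hZP hw
    refine h.mem_rootSubgroup_of_commute hol (fun j hj t => ?_) fun i hi t => ?_
    · exact h.commute_of_commute (stdRoot_pow_char hj v t)
        (hZc _ hw _ (hmem _ (Subgroup.subset_closure (Or.inl ⟨j, hj, t, rfl⟩))))
    · exact h.commute_of_commute (stdRoot_pow_char hi v t)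
        (hZc _ hw _ (hmem _ (Subgroup.subset_closure (Or.inr ⟨i, hi, t, rfl⟩))))
  obtain ⟨⟨w, hw⟩, hw1⟩ := (Subgroup.ne_bot_iff_exists_ne_one).1 hZ
  obtain ⟨t, ht⟩ := mem_rootSubgroup.1 (hZX hw)
  have ht1 : t ≠ 1 := by
    rintro rfl
    rw [map_one, map_one] at ht
    exact hw1 (Subtype.ext ht.symm)
  refine h.mem_normalizer_rootSubgroup v hol ht1 (hZX ?_)
  rw [ht]
  exact (Subgroup.mem_normalizer_iff.1 (hZn hz) w).1 hw

end unipotent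

section rootPair

open Matrix

theorem rootHom_commute {I E : Type*} [Fintype I] [DecidableEq I] [Field E] {b f b' f' : I → E}
    (h : f ⬝ᵥ b = 0) (h' : f' ⬝ᵥ b' = 0) (h1 : f ⬝ᵥ b' = 0) (h2 : f' ⬝ᵥ b = 0)
    (s t : Multiplicative E) :
    rootHom b f h s * rootHom b' f' h' t = rootHom b' f' h' t * rootHom b f h s := by
  apply Subtype.ext
  change (1 + s.toAdd • vecMulVec b f) * (1 + t.toAdd • vecMulVec b' f') =
    (1 + t.toAdd • vecMulVec b' f') * (1 + s.toAdd • vecMulVec b f)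
  simp only [mul_add, add_mul, mul_one, one_mul, smul_mul_smul_comm, vecMulVec_mul_vecMulVec, h1,
    h2, zero_smul, vecMulVec_zero, smul_zero, add_zero]
  abel

theorem exists_conj_rootHom_eq_stdRoot {I E : Type*} [Fintype I] [DecidableEq I] [Field E]
    {o l : I} (hol : o ≠ l) {b f : I → E} (h : f ⬝ᵥ b = 0) (hb : b l ≠ 0) (hf : f o ≠ 0) :
    ∃ s : SpecialLinearGroup I E, (∀ t, s * stdRoot E hol t = stdRoot E hol t * s) ∧
      ∀ t, ∃ t', s * rootHom b f h t * s⁻¹ = stdRoot E hol.symm t' := by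
  set b₁ : I → E := (b l)⁻¹ • b - Pi.single l 1 with hb₁
  have h₁ : (Pi.single l 1 : I → E) ⬝ᵥ b₁ = 0 := by simp [hb₁, hb]
  set s₁ := (rootHom b₁ (Pi.single l 1) h₁ (Multiplicative.ofAdd 1))⁻¹ with hs₁
  have e1 : s₁.1 *ᵥ b = b l • Pi.single l 1 := by
    rw [hs₁, ← map_inv, rootHom.coe_apply, add_mulVec, one_mulVec, smul_mulVec, vecMulVec_mulVec,
      single_one_dotProduct, toAdd_inv, toAdd_ofAdd, hb₁]
    ext i
    simp
    field_simp
    ring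
  set f₁ : I → E := f ᵥ* (s₁⁻¹ : SpecialLinearGroup I E).1 with hf₁
  have e2 : f₁ o = f o := by
    rw [hf₁, hs₁, inv_inv, rootHom.coe_apply, vecMul_add, vecMul_one, toAdd_ofAdd, one_smul,
      vecMul_vecMulVec, Pi.add_apply, Pi.smul_apply, Pi.single_eq_of_ne hol, smul_zero, add_zero]
  have h₂ := rootHom.conj_dotProduct h s₁
  rw [e1] at h₂
  have e3 : f₁ l = 0 := by
    rw [dotProduct_smul, dotProduct_single, mul_one, smul_eq_mul] at h₂
    exact (mul_eq_zero.1 h₂).resolve_left hb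
  set g : I → E := (f o)⁻¹ • f₁ - Pi.single o 1 with hg
  have h₃ : g ⬝ᵥ Pi.single o 1 = 0 := by simp [hg, e2, hf]
  set s₂ := rootHom (Pi.single o 1) g h₃ (Multiplicative.ofAdd 1) with hs₂
  have e4 : s₂.1 *ᵥ (b l • Pi.single l 1) = b l • Pi.single l 1 := by
    rw [hs₂, rootHom.coe_apply, add_mulVec, one_mulVec, smul_mulVec, vecMulVec_mulVec,
      toAdd_ofAdd, one_smul, dotProduct_smul, dotProduct_single, hg, Pi.sub_apply, Pi.smul_apply,
      e3, Pi.single_eq_of_ne hol.symm]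
    simp
  have e5 : f₁ ᵥ* (s₂⁻¹ : SpecialLinearGroup I E).1 = f o • Pi.single o 1 := by
    rw [hs₂, ← map_inv, rootHom.coe_apply, vecMul_add, vecMul_one, vecMul_smul,
      vecMul_vecMulVec, dotProduct_single, e2, hg, toAdd_inv, toAdd_ofAdd]
    ext i
    simp
    field_simp
    ring
  refine ⟨s₂ * s₁, fun t => ?_, fun t => ⟨Multiplicative.ofAdd (b l * f o * t.toAdd), ?_⟩⟩
  · have c1 : s₁ * stdRoot E hol t = stdRoot E hol t * s₁ := by
      rw [hs₁, ← map_inv, stdRoot]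
      exact rootHom_commute _ _ (by simp [hol.symm]) h₁ _ _
    have c2 : s₂ * stdRoot E hol t = stdRoot E hol t * s₂ := by
      rw [hs₂, stdRoot]
      exact rootHom_commute _ _ h₃ (by simp [hol.symm]) _ _
    rw [mul_assoc, c1, ← mul_assoc, c2, mul_assoc]
  · have h₄ := rootHom.conj_dotProduct h₂ s₂
    have c1 := rootHom.conj_apply h s₁ t (rootHom.conj_dotProduct h s₁)
    calc s₂ * s₁ * rootHom b f h t * (s₂ * s₁)⁻¹
        = s₂ * (s₁ * rootHom b f h t * s₁⁻¹) * s₂⁻¹ := by group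
      _ = stdRoot E hol.symm (Multiplicative.ofAdd (b l * f o * t.toAdd)) := by
        rw [c1, rootHom.conj_apply _ _ _ (rootHom.conj_dotProduct
            (rootHom.conj_dotProduct h s₁) s₂)]
        apply Subtype.ext
        rw [rootHom.coe_apply, coe_stdRoot, e1, e4, ← hf₁, e5, smul_vecMulVec, vecMulVec_smul,
          ← single_eq_single_vecMulVec_single, smul_smul, smul_smul, smul_single, smul_eq_mul,
          mul_one, toAdd_ofAdd]
        congr 2
        ring

theorem isPGroup_closure_rootHom {I E : Type*} [Fintype I] [DecidableEq I] [Field E] [Finite E]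
    (v : ℕ) [Fact v.Prime] [CharP E v] {N M : Matrix I I E} (hN : N * N = 0) (hM : M * M = 0)
    (hMN : M * N = 0) :
    IsPGroup v (Subgroup.closure {g : SpecialLinearGroup I E |
      (∃ t : E, g.1 = 1 + t • N) ∨ ∃ t : E, g.1 = 1 + t • M}) := by
  have hMN' : ∀ Z, M * (N * Z) = 0 := fun Z => by rw [← mul_assoc, hMN, zero_mul]
  have hNN' : ∀ Z, N * (N * Z) = 0 := fun Z => by rw [← mul_assoc, hN, zero_mul]
  refine isPGroup_closure_of_unipotent v
    {P | ∃ s t r : E, P = s • N + t • M + r • (N * M)} ⟨0, 0, 0, by simp⟩ ?_ ?_ _ ?_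
  · rintro _ ⟨s, t, r, rfl⟩ _ ⟨s', t', r', rfl⟩
    refine ⟨s + s', t + t', r + r' + s * t', ?_⟩
    simp only [mul_add, add_mul, smul_mul_smul_comm, mul_assoc, hN, hM, hMN, hMN', hNN', mul_zero,
      smul_zero, add_zero, zero_add, add_smul]
    abel
  · rintro _ ⟨s, t, r, rfl⟩
    rw [pow_succ, pow_two]
    simp only [mul_add, add_mul, smul_mul_smul_comm, mul_assoc, hN, hM, hMN, hMN', hNN', mul_zero,
      smul_zero, add_zero, zero_add]
  · rintro g (⟨t, ht⟩ | ⟨t, ht⟩)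
    · exact ⟨t, 0, 0, by rw [ht]; simp⟩
    · exact ⟨0, t, 0, by rw [ht]; simp⟩

end rootPair

section block

open Matrix

/-- Block diagonal matrices of determinant one. -/
def slBlock (I J E : Type*) [Fintype I] [DecidableEq I] [Fintype J] [DecidableEq J] [Field E] :
    SpecialLinearGroup I E × SpecialLinearGroup J E →* SpecialLinearGroup (I ⊕ J) E where
  toFun g := ⟨fromBlocks g.1.1 0 0 g.2.1, by
    rw [det_fromBlocks_zero₂₁, g.1.2, g.2.2, mul_one]⟩
  map_one' := Subtype.ext fromBlocks_one
  map_mul' g h := Subtype.ext (by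
    change fromBlocks (g.1.1 * h.1.1) 0 0 (g.2.1 * h.2.1) =
      fromBlocks g.1.1 0 0 g.2.1 * fromBlocks h.1.1 0 0 h.2.1
    rw [fromBlocks_multiply]
    simp)

variable {I J E A : Type*} [Fintype I] [DecidableEq I] [Fintype J] [DecidableEq J] [Field E]
  [Group A]

theorem coe_slBlock (g : SpecialLinearGroup I E × SpecialLinearGroup J E) :
    (slBlock I J E g : Matrix (I ⊕ J) (I ⊕ J) E) = fromBlocks g.1.1 0 0 g.2.1 := rfl

theorem slBlock_stdRoot {i j : I} (hij : i ≠ j) (t : Multiplicative E) :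
    slBlock I J E (stdRoot E hij t, 1) = stdRoot E (Sum.inl_injective.ne hij) t := by
  apply Subtype.ext
  rw [coe_slBlock, coe_stdRoot, coe_stdRoot]
  change fromBlocks _ 0 0 1 = _
  ext a b
  rcases a with a | a <;> rcases b with b | b <;> simp [one_apply, single_apply]

/-- Two opposite root subgroups generate a block copy of `SL₂`. -/
theorem sup_rootSubgroup_eq_range (φ : SpecialLinearGroup (Fin 2 ⊕ J) E →* A) :
    rootSubgroup φ (Sum.inl_injective.ne (zero_ne_one (α := Fin 2))) ⊔
      rootSubgroup φ (Sum.inl_injective.ne (zero_ne_one (α := Fin 2))).symm =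
    ((φ.comp (slBlock (Fin 2) J E)).comp (MonoidHom.inl _ _)).range := by
  apply le_antisymm
  · rw [sup_le_iff]
    constructor
    · intro x hx
      obtain ⟨t, rfl⟩ := mem_rootSubgroup.1 hx
      exact ⟨stdRoot E zero_ne_one t, congrArg φ (slBlock_stdRoot _ t)⟩
    · intro x hx
      obtain ⟨t, rfl⟩ := mem_rootSubgroup.1 hx
      exact ⟨stdRoot E one_ne_zero t, congrArg φ (slBlock_stdRoot _ t)⟩
  · rintro _ ⟨g, rfl⟩
    change φ (slBlock (Fin 2) J E (g, 1)) ∈ _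
    induction g using SL2.transvection_induction with
    | htransvec i j hij c =>
      have hs : Matrix.SpecialLinearGroup.transvection hij c =
          stdRoot E hij (Multiplicative.ofAdd c) :=
        Subtype.ext (by rw [coe_stdRoot]; rfl)
      rw [hs, slBlock_stdRoot]
      fin_cases i
      · obtain rfl : j = 1 := by fin_cases j <;> tauto
        exact Subgroup.mem_sup_left (mem_rootSubgroup.2 ⟨_, rfl⟩)
      · obtain rfl : j = 0 := by fin_cases j <;> tauto
        exact Subgroup.mem_sup_right (mem_rootSubgroup.2 ⟨_, rfl⟩)
    | hmul x y hx hy =>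
      have : ((x * y, 1) : SpecialLinearGroup (Fin 2) E × SpecialLinearGroup J E) =
        (x, 1) * (y, 1) := by simp
      rw [this, map_mul, map_mul]
      exact mul_mem hx hy

theorem exists_conj_stdRoot_eq_opposite :
    ∃ w : SpecialLinearGroup (Fin 2 ⊕ J) E, ∀ t,
      stdRoot E (Sum.inl_injective.ne (zero_ne_one (α := Fin 2))).symm t =
      w * stdRoot E (Sum.inl_injective.ne (zero_ne_one (α := Fin 2))) t⁻¹ * w⁻¹ := by
  let w : SpecialLinearGroup (Fin 2) E := ⟨!![0, 1; -1, 0], by simp [det_fin_two]⟩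
  refine ⟨slBlock (Fin 2) J E (w, 1), fun t => ?_⟩
  rw [eq_mul_inv_iff_mul_eq, ← slBlock_stdRoot, ← slBlock_stdRoot, ← map_mul, ← map_mul]
  congr 1
  rw [Prod.mk_mul_mk, Prod.mk_mul_mk]
  congr 1
  apply Subtype.ext
  change (stdRoot E (one_ne_zero (α := Fin 2)) t).1 * w.1 =
    w.1 * (stdRoot E (zero_ne_one (α := Fin 2)) t⁻¹).1
  rw [coe_stdRoot, coe_stdRoot]
  ext i j
  fin_cases i <;> fin_cases j <;> simp [w, mul_apply, Fin.sum_univ_two, single_apply]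

end block

section normalizer

open Matrix

variable {J E A : Type*} [Fintype J] [DecidableEq J] [Field E] [Finite E] [Group A] [Finite A]
  {φ : SpecialLinearGroup (Fin 2 ⊕ J) E →* A}

/-- An element normalizing a root subgroup can be modified by an inner element so as to normalize the
opposite root subgroup as well. -/
theorem IsSLCover.exists_mul_mem_normalizer_opposite (h : IsSLCover φ) (v : ℕ) [Fact v.Prime]
    [CharP E v] (hE : ∃ c : E, c ≠ 0 ∧ c ^ 2 ≠ 1) (a : A) :
    ∃ s, φ s * a ∈ Subgroup.normalizer
        (rootSubgroup φ (Sum.inl_injective.ne (zero_ne_one (α := Fin 2))) : Set A) ∧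
      φ s * a ∈ Subgroup.normalizer
        (rootSubgroup φ (Sum.inl_injective.ne (zero_ne_one (α := Fin 2))).symm : Set A) := by
  set hol : (Sum.inl 0 : Fin 2 ⊕ J) ≠ Sum.inl 1 := Sum.inl_injective.ne (zero_ne_one (α := Fin 2))
  obtain ⟨s₀, hs₀⟩ := h.exists_mul_mem_normalizer_rootSubgroup v hol a
  set a₀ := φ s₀ * a with ha₀
  obtain ⟨w, hw⟩ := exists_conj_stdRoot_eq_opposite (E := E) (J := J)
  obtain ⟨x, hx⟩ := h.normal.conj_mem (φ w) ⟨_, rfl⟩ a₀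
  have hconj : ∀ t, ∃ t', a₀ * φ (stdRoot E hol t) * a₀⁻¹ = φ (stdRoot E hol t') := by
    intro t
    obtain ⟨t', ht'⟩ := mem_rootSubgroup.1
      ((Subgroup.mem_normalizer_iff.1 hs₀ _).1 (mem_rootSubgroup.2 ⟨t, rfl⟩))
    exact ⟨t', ht'.symm⟩
  have hstd := single_dotProduct_single_of_ne hol (E := E)
  set b := x.1 *ᵥ (Pi.single (Sum.inl 0) 1 : Fin 2 ⊕ J → E) with hb
  set f := (Pi.single (Sum.inl 1) 1 : Fin 2 ⊕ J → E) ᵥ* (x⁻¹ : SpecialLinearGroup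
      (Fin 2 ⊕ J) E).1 with hf
  have hbf : f ⬝ᵥ b = 0 := rootHom.conj_dotProduct hstd x
  have hY : ∀ t, ∃ t', a₀ * φ (stdRoot E hol.symm t) * a₀⁻¹ = φ (rootHom b f hbf t') := by
    intro t
    obtain ⟨t', ht'⟩ := hconj t⁻¹
    refine ⟨t', ?_⟩
    have e1 : a₀ * φ (w * stdRoot E hol t⁻¹ * w⁻¹) * a₀⁻¹ =
        φ x * (a₀ * φ (stdRoot E hol t⁻¹) * a₀⁻¹) * (φ x)⁻¹ := by
      rw [map_mul, map_mul, map_inv φ w, hx]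
      group
    rw [hw, e1, ht', ← map_inv, ← map_mul, ← map_mul]
    exact congrArg φ (rootHom.conj_apply hstd x t' hbf)
  have hnp : ∀ T : Set (SpecialLinearGroup (Fin 2 ⊕ J) E), (∀ t, stdRoot E hol t ∈ T) →
      (∀ t, rootHom b f hbf t ∈ T) → ¬ IsPGroup v (Subgroup.closure T) := by
    intro T h1 h2 hT
    obtain ⟨c, hc0, hc⟩ := hE
    have hle : rootSubgroup φ hol ⊔ rootSubgroup φ hol.symm ≤
        ((Subgroup.closure T).map φ).comap (MulAut.conj a₀).toMonoidHom := by
      rw [sup_le_iff]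
      constructor
      · intro y hy
        obtain ⟨t, rfl⟩ := mem_rootSubgroup.1 hy
        obtain ⟨t', ht'⟩ := hconj t
        exact ⟨_, Subgroup.subset_closure (h1 t'), ht'.symm⟩
      · intro y hy
        obtain ⟨t, rfl⟩ := mem_rootSubgroup.1 hy
        obtain ⟨t', ht'⟩ := hY t
        exact ⟨_, Subgroup.subset_closure (h2 t'), ht'.symm⟩
    let d : SpecialLinearGroup (Fin 2) E := Matrix.SpecialLinearGroup.diag2 c hc0
    have hd : φ (slBlock (Fin 2) J E (d, 1)) ∈ rootSubgroup φ hol ⊔ rootSubgroup φ hol.symm := by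
      rw [sup_rootSubgroup_eq_range]
      exact ⟨d, rfl⟩
    obtain ⟨y, hy, hya⟩ := hle hd
    obtain ⟨k, hk⟩ := hT ⟨y, hy⟩
    have hk' : y ^ v ^ k = 1 := congrArg Subtype.val hk
    have h3 : φ (slBlock (Fin 2) J E (d ^ v ^ k, 1)) = 1 := by
      have h4 := congrArg (fun z => z ^ v ^ k) hya
      simp only [← map_pow] at h4
      rw [hk', map_one, eq_comm] at h4
      have h5 := (MulAut.conj a₀).injective (a₂ := 1) (h4.trans (map_one _).symm)
      rwa [Prod.pow_mk, one_pow] at h5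
    rw [h.map_eq_one_iff, Subgroup.mem_center_iff] at h3
    have h6 := h3 (stdRoot E hol (Multiplicative.ofAdd 1))
    rw [← slBlock_stdRoot, ← map_mul, ← map_mul] at h6
    have h7 := congrFun (congrFun (congrArg Subtype.val h6) (Sum.inl 0)) (Sum.inl 1)
    have h8 : ((d ^ v ^ k : SpecialLinearGroup (Fin 2) E) : Matrix _ _ E) =
        diagonal ![c ^ v ^ k, c⁻¹ ^ v ^ k] := by
      have : d.1 = diagonal ![c, c⁻¹] := by
        rw [Matrix.SpecialLinearGroup.diag2_coe']
        ext i j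
        fin_cases i <;> fin_cases j <;> rfl
      change d.1 ^ v ^ k = _
      rw [this, diagonal_pow]
      congr 1
      ext i
      fin_cases i <;> rfl
    rw [coe_slBlock, coe_slBlock, fromBlocks_apply₁₁, fromBlocks_apply₁₁] at h7
    change ((stdRoot E (zero_ne_one (α := Fin 2)) (Multiplicative.ofAdd 1)).1 *
        (d ^ v ^ k : SpecialLinearGroup (Fin 2) E).1) 0 1 =
      ((d ^ v ^ k : SpecialLinearGroup (Fin 2) E).1 *
        (stdRoot E (zero_ne_one (α := Fin 2)) (Multiplicative.ofAdd 1)).1) 0 1 at h7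
    rw [h8, mul_diagonal, diagonal_mul, coe_stdRoot] at h7
    simp at h7
    have h9 : (c ^ 2) ^ v ^ k = 1 ^ v ^ k := by
      rw [one_pow, pow_two, mul_pow]
      nth_rewrite 1 [← h7]
      rw [inv_mul_cancel₀ (pow_ne_zero _ hc0)]
    exact hc (iterateFrobenius_inj E v k (by simpa only [iterateFrobenius_def] using h9))
  have hE' : (single (Sum.inl 0) (Sum.inl 1) 1 : Matrix (Fin 2 ⊕ J) (Fin 2 ⊕ J) E) =
      vecMulVec (Pi.single (Sum.inl 0) 1) (Pi.single (Sum.inl 1) 1) :=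
    single_eq_single_vecMulVec_single _ _
  have hsq : (single (Sum.inl 0) (Sum.inl 1) 1 : Matrix (Fin 2 ⊕ J) (Fin 2 ⊕ J) E) *
      single (Sum.inl 0) (Sum.inl 1) 1 = 0 := single_mul_single_of_ne _ _ _ _ hol.symm _
  have hsq' : vecMulVec b f * vecMulVec b f = 0 := by
    rw [vecMulVec_mul_vecMulVec, hbf, zero_smul, vecMulVec_zero]
  have hst : ∀ t, (stdRoot E hol t).1 = 1 + t.toAdd • single (Sum.inl 0) (Sum.inl 1) (1 : E) := by
    intro t
    rw [coe_stdRoot, smul_single, smul_eq_mul, mul_one]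
  have hf0 : f (Sum.inl 0) ≠ 0 := by
    intro h0
    refine hnp _ (fun t => Or.inl ⟨t.toAdd, hst t⟩) (fun t => Or.inr ⟨t.toAdd, rfl⟩)
      (isPGroup_closure_rootHom v hsq hsq' ?_)
    rw [hE', vecMulVec_mul_vecMulVec, dotProduct_single, h0, zero_mul, zero_smul, vecMulVec_zero]
  have hb0 : b (Sum.inl 1) ≠ 0 := by
    intro h0
    refine hnp _ (fun t => Or.inr ⟨t.toAdd, hst t⟩) (fun t => Or.inl ⟨t.toAdd, rfl⟩)
      (isPGroup_closure_rootHom v hsq' hsq ?_)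
    rw [hE', vecMulVec_mul_vecMulVec, single_dotProduct, h0, mul_zero, zero_smul, vecMulVec_zero]
  obtain ⟨s, hs1, hs2⟩ := exists_conj_rootHom_eq_stdRoot hol hbf hb0 hf0
  refine ⟨s * s₀, ?_, ?_⟩
  · rw [map_mul, mul_assoc, ← ha₀]
    refine mul_mem (Subgroup.mem_normalizer_fintype fun n hn => ?_) hs₀
    obtain ⟨t, rfl⟩ := mem_rootSubgroup.1 hn
    rw [← map_mul, hs1, map_mul, mul_inv_cancel_right]
    exact hn
  · refine Subgroup.mem_normalizer_fintype fun n hn => ?_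
    obtain ⟨t, rfl⟩ := mem_rootSubgroup.1 hn
    obtain ⟨t', ht'⟩ := hY t
    obtain ⟨t'', ht''⟩ := hs2 t'
    refine mem_rootSubgroup.2 ⟨t'', ?_⟩
    rw [← ht'', map_mul, map_mul, ← ht', map_mul, map_inv, ha₀]
    group

end normalizer

/-- If `c` normalizes `Q` and no nontrivial power of `c` fixes a nontrivial element of `Q`, then the
order of `c` divides `|Q| - 1`. -/
theorem orderOf_dvd_card_sub_one {A : Type*} [Group A] [Finite A] (Q : Subgroup A) (c : A)
    (hc : c ∈ Subgroup.normalizer (Q : Set A))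
    (h : ∀ x ∈ Q, x ≠ 1 → ∀ i : ℤ, c ^ i * x = x * c ^ i → c ^ i = 1) :
    orderOf c ∣ Nat.card Q - 1 := by
  let act : MulAction (Subgroup.zpowers c) {x : A // x ∈ Q ∧ x ≠ 1} :=
    { smul := fun b x => ⟨b.1 * x.1 * b.1⁻¹,
        (Subgroup.mem_normalizer_iff.1 ((Subgroup.zpowers_le.2 hc) b.2) _).1 x.2.1, by
          rw [ne_eq, conj_eq_one_iff]; exact x.2.2⟩
      one_smul := fun x => Subtype.ext (by
        change (1 : A) * x.1 * (1 : A)⁻¹ = x.1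
        group)
      mul_smul := fun a b x => Subtype.ext (by
        change a.1 * b.1 * x.1 * (a.1 * b.1)⁻¹ = a.1 * (b.1 * x.1 * b.1⁻¹) * a.1⁻¹
        group) }
  have hst : ∀ x : {x : A // x ∈ Q ∧ x ≠ 1},
      MulAction.stabilizer (Subgroup.zpowers c) x = ⊥ := by
    intro x
    rw [eq_bot_iff]
    rintro ⟨b, i, rfl⟩ hb
    have h1 : c ^ i * x.1 * (c ^ i)⁻¹ = x.1 := congrArg Subtype.val hb
    exact Subtype.ext (h x.1 x.2.1 x.2.2 i (mul_inv_eq_iff_eq_mul.1 h1))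
  have h1 := Nat.card_congr (MulAction.selfEquivOrbitsQuotientProd hst)
  rw [Nat.card_prod, Nat.card_zpowers] at h1
  have h2 : Nat.card {x : A // x ∈ Q ∧ x ≠ 1} = Nat.card Q - 1 := by
    have h3 : {x : A | x ∈ Q ∧ x ≠ 1} = (Q : Set A) \ {1} := by ext; simp
    have h4 : Nat.card {x : A // x ∈ Q ∧ x ≠ 1} = ({x : A | x ∈ Q ∧ x ≠ 1}).ncard := rfl
    rw [h4, h3, Set.ncard_sdiff_singleton_of_mem Q.one_mem]
    rfl
  rw [← h2, h1]
  exact Dvd.intro_left _ rfl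

theorem orderOf_dvd_card_sub_one_of_nonadjacent {A : Type*} [Group A] [Finite A] {s : ℕ}
    (hs : s.Prime) {Q : Subgroup A} (hQ : IsPGroup s Q) {c : A}
    (hc : c ∈ Subgroup.normalizer (Q : Set A))
    (h : ∀ t, t.Prime → t ∣ orderOf c → t ≠ s ∧ Nonadjacent A t s) :
    orderOf c ∣ Nat.card Q - 1 := by
  refine orderOf_dvd_card_sub_one Q c hc fun x hx hx1 i hi => ?_
  by_contra hne
  obtain ⟨t, ht, hto⟩ := Nat.exists_prime_and_dvd (n := orderOf (c ^ i))
    (by rwa [ne_eq, orderOf_eq_one_iff])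
  obtain ⟨h1, h2⟩ := h t ht (hto.trans (orderOf_dvd_of_mem_zpowers ⟨i, rfl⟩))
  exact h2.not_commute ((Nat.coprime_primes ht hs).2 h1) hto
    (dvd_orderOf_of_isPGroup hs hQ hx hx1) hi

open Matrix in
theorem IsSLCover.exists_scalar_of_map_slBlock {I J E A : Type*} [Fintype I] [DecidableEq I]
    [Fintype J] [DecidableEq J] [Field E] [Group A] {φ : SpecialLinearGroup (I ⊕ J) E →* A}
    (h : IsSLCover φ) {x : SpecialLinearGroup I E} {y : SpecialLinearGroup J E}
    (hxy : φ (slBlock I J E (x, y)) = 1) : ∃ c : E, x.1 = scalar I c ∧ y.1 = scalar J c := by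
  rw [h.map_eq_one_iff, Matrix.SpecialLinearGroup.mem_center_iff] at hxy
  obtain ⟨c, -, hc⟩ := hxy
  refine ⟨c, ?_, ?_⟩
  · ext a b
    have := congrFun (congrFun hc (Sum.inl a)) (Sum.inl b)
    rw [coe_slBlock, fromBlocks_apply₁₁] at this
    rw [← this]
    simp [diagonal_apply]
  · ext a b
    have := congrFun (congrFun hc (Sum.inr a)) (Sum.inr b)
    rw [coe_slBlock, fromBlocks_apply₂₂] at this
    rw [← this]
    simp [diagonal_apply]

open Matrix in
theorem IsSLCover.eq_one_of_map_slBlock {I J E A : Type*} [Fintype I] [DecidableEq I] [Nonempty I]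
    [Fintype J] [DecidableEq J] [Nonempty J] [Field E] [Group A]
    {φ : SpecialLinearGroup (I ⊕ J) E →* A} (h : IsSLCover φ) {x : SpecialLinearGroup I E}
    {y : SpecialLinearGroup J E} (hxy : φ (slBlock I J E (x, y)) = 1) : x = 1 ↔ y = 1 := by
  obtain ⟨c, hx, hy⟩ := h.exists_scalar_of_map_slBlock hxy
  have hx1 : x = 1 ↔ c = 1 := by
    refine (Subtype.ext_iff (a1 := x)).trans ?_
    rw [hx]
    change scalar I c = 1 ↔ c = 1
    rw [← map_one (scalar I), scalar_inj]
  have hy1 : y = 1 ↔ c = 1 := by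
    refine (Subtype.ext_iff (a1 := y)).trans ?_
    rw [hy]
    change scalar J c = 1 ↔ c = 1
    rw [← map_one (scalar J), scalar_inj]
  rw [hx1, hy1]

section oppositeNormalizer

open Matrix

variable {J E A : Type*} [Fintype J] [DecidableEq J] [Field E] [Group A]

/-- The common normalizer of two opposite root subgroups. -/
noncomputable def oppositeNormalizer (φ : SpecialLinearGroup (Fin 2 ⊕ J) E →* A) : Subgroup A :=
  Subgroup.normalizer
    (rootSubgroup φ (Sum.inl_injective.ne (zero_ne_one (α := Fin 2))) : Set A) ⊓
  Subgroup.normalizer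
    (rootSubgroup φ (Sum.inl_injective.ne (zero_ne_one (α := Fin 2))).symm : Set A)

variable {φ : SpecialLinearGroup (Fin 2 ⊕ J) E →* A}

theorem IsSLCover.exists_orderOf_eq_of_dvd_index [Finite E] [Finite A] (h : IsSLCover φ) (v : ℕ)
    [Fact v.Prime] [CharP E v] (hE : ∃ c : E, c ≠ 0 ∧ c ^ 2 ≠ 1) {r : ℕ} (hr : r.Prime)
    (hri : r ∣ φ.range.index) : ∃ b ∈ oppositeNormalizer φ, orderOf b = r := by
  have hN := h.normal
  have htop : oppositeNormalizer φ ⊔ φ.range = ⊤ := by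
    rw [eq_top_iff]
    intro a _
    obtain ⟨s, hs⟩ := h.exists_mul_mem_normalizer_opposite v hE a
    rw [sup_comm, Subgroup.mem_sup_of_normal_left]
    exact ⟨(φ s)⁻¹, inv_mem ⟨s, rfl⟩, φ s * a, hs, inv_mul_cancel_left _ _⟩
  have := Fact.mk hr
  have h1 : r ∣ Nat.card (oppositeNormalizer φ) := by
    have h2 := Subgroup.relIndex_sup_right (H := oppositeNormalizer φ) (K := φ.range)
    rw [htop, Subgroup.relIndex_top_right] at h2
    exact (h2 ▸ hri).trans (Subgroup.relIndex_dvd_card _ _)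
  obtain ⟨b, hb⟩ := exists_prime_orderOf_dvd_card' r h1
  exact ⟨b.1, b.2, by rwa [Subgroup.orderOf_coe]⟩

/-- In odd characteristic, the involution of the block `SL₂` is central in the common normalizer of
the opposite root subgroups. -/
theorem IsSLCover.exists_involution_commute [Finite E] [Finite A] [Nonempty J] (h : IsSLCover φ)
    (h2 : (2 : E) ≠ 0) :
    ∃ z : A, orderOf z = 2 ∧ ∀ b ∈ oppositeNormalizer φ, b * z = z * b := by
  set ψ := (φ.comp (slBlock (Fin 2) J E)).comp (MonoidHom.inl _ _) with hψ
  have hψinj : Function.Injective ψ := (injective_iff_map_eq_one _).2 fun g hg =>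
      (h.eq_one_of_map_slBlock hg).2 rfl
  have hneg : (-1 : SpecialLinearGroup (Fin 2) E) ≠ 1 := by
    intro h3
    have h4 : (-1 : Matrix (Fin 2) (Fin 2) E) 0 0 = (1 : Matrix (Fin 2) (Fin 2) E) 0 0 :=
      congrFun (congrFun (congrArg Subtype.val h3) 0) 0
    simp at h4
    exact h2 (by linear_combination -h4)
  have huniq : ∀ g : SpecialLinearGroup (Fin 2) E, g ^ 2 = 1 → g ≠ 1 → g = -1 := by
    intro g hg hg1
    have hM : g.1 * g.1 = 1 := by
      rw [pow_two] at hg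
      exact congrArg Subtype.val hg
    have hd := g.2
    rw [det_fin_two] at hd
    have e : ∀ i j, g.1 i 0 * g.1 0 j + g.1 i 1 * g.1 1 j = (1 : Matrix (Fin 2) (Fin 2) E) i j := by
      intro i j
      rw [← hM, mul_apply, Fin.sum_univ_two]
    have e00 := e 0 0
    have e01 := e 0 1
    have e10 := e 1 0
    simp only [one_apply_eq, ne_eq, zero_ne_one, one_ne_zero, not_false_eq_true, one_apply_ne]
      at e00 e01 e10
    have ht : g.1 0 0 + g.1 1 1 ≠ 0 := by
      intro h0
      exact h2 (by linear_combination g.1 0 0 * h0 - e00 - hd)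
    have hb : g.1 0 1 = 0 := (mul_eq_zero.1 (show g.1 0 1 * (g.1 0 0 + g.1 1 1) = 0 by
      linear_combination e01)).resolve_right ht
    have hc : g.1 1 0 = 0 := (mul_eq_zero.1 (show g.1 1 0 * (g.1 0 0 + g.1 1 1) = 0 by
      linear_combination e10)).resolve_right ht
    rw [hb] at hd e00
    have had : g.1 1 1 = g.1 0 0 := by
      linear_combination -(g.1 1 1) * e00 + g.1 0 0 * hd
    rcases mul_self_eq_one_iff.1 (show g.1 0 0 * g.1 0 0 = 1 by linear_combination e00)
      with h1 | h1
    · refine absurd (Subtype.ext ?_) hg1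
      change g.1 = 1
      ext i j
      fin_cases i <;> fin_cases j <;> simp [hb, hc, had, h1]
    · apply Subtype.ext
      change g.1 = -1
      ext i j
      fin_cases i <;> fin_cases j <;> simp [hb, hc, had, h1]
  have hz2 : orderOf (-1 : SpecialLinearGroup (Fin 2) E) = 2 :=
    orderOf_eq_prime (by simp) hneg
  refine ⟨ψ (-1), by rw [orderOf_injective ψ hψinj, hz2], fun b hb => ?_⟩
  have hbn : b * ψ (-1) * b⁻¹ ∈ ψ.range := by
    rw [hψ, ← sup_rootSubgroup_eq_range]
    refine (Subgroup.mem_normalizer_iff.1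
      (Subgroup.normalizer_inf_normalizer_le_normalizer_sup _ _ hb) _).1 ?_
    rw [sup_rootSubgroup_eq_range]
    exact ⟨-1, rfl⟩
  obtain ⟨g, hg⟩ := hbn
  have hg1 : g = -1 := by
    apply huniq
    · apply hψinj
      rw [map_pow, hg, conj_pow, ← map_pow]
      simp
    · rintro rfl
      rw [map_one, eq_comm, conj_eq_one_iff] at hg
      exact hneg (hψinj (hg.trans (map_one ψ).symm))
  rw [hg1, eq_mul_inv_iff_mul_eq] at hg
  exact hg.symm

end oppositeNormalizer

section element_orders

open Matrix

variable {I J E A : Type*} [Fintype I] [DecidableEq I] [Fintype J] [DecidableEq J]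
  [Field E] [Finite E] [Group A] [Finite A]

/-- Commuting blocks produce elements whose order is divisible by two primes. -/
theorem IsSLCover.not_nonadjacent_of_dvd_card [Nonempty I] [Nonempty J]
    {φ : SpecialLinearGroup (I ⊕ J) E →* A} (h : IsSLCover φ) {s t : ℕ} (hs : s.Prime)
    (ht : t.Prime) (hst : t ≠ s) (hsc : s ∣ Nat.card (SpecialLinearGroup I E))
    (htc : t ∣ Nat.card (SpecialLinearGroup J E)) : ¬ Nonadjacent A t s := by
  intro hna
  have := Fact.mk hs
  have := Fact.mk ht
  obtain ⟨x, hx⟩ := exists_prime_orderOf_dvd_card' s hsc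
  obtain ⟨y, hy⟩ := exists_prime_orderOf_dvd_card' t htc
  have h1 : orderOf (φ (slBlock I J E (x, 1))) = s := by
    refine orderOf_eq_prime ?_ fun h0 => ?_
    · rw [← map_pow, ← map_pow, Prod.pow_mk, ← hx, pow_orderOf_eq_one, one_pow]
      exact (congrArg φ (map_one _)).trans (map_one φ)
    · rw [(h.eq_one_of_map_slBlock h0).2 rfl, orderOf_one] at hx
      exact hs.one_lt.ne hx
  have h2 : orderOf (φ (slBlock I J E (1, y))) = t := by
    refine orderOf_eq_prime ?_ fun h0 => ?_
    · rw [← map_pow, ← map_pow, Prod.pow_mk, ← hy, pow_orderOf_eq_one, one_pow]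
      exact (congrArg φ (map_one _)).trans (map_one φ)
    · rw [(h.eq_one_of_map_slBlock h0).1 rfl, orderOf_one] at hy
      exact ht.one_lt.ne hy
  refine hna.not_commute ((Nat.coprime_primes ht hs).2 hst) h2.symm.dvd h1.symm.dvd ?_
  rw [← map_mul, ← map_mul, ← map_mul, ← map_mul]
  simp

omit [Finite A] in
theorem IsSLCover.exists_noncyclic_isPGroup [Nonempty J]
    {φ : SpecialLinearGroup (Fin 2 ⊕ J) E →* A} (h : IsSLCover φ) {s : ℕ} (hs : s.Prime)
    (hodd : Odd s) (hsc : s ∣ Nat.card (SpecialLinearGroup (Fin 2) E))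
    (htc : s ∣ Nat.card (SpecialLinearGroup J E)) :
    ∃ Q : Subgroup A, IsPGroup s Q ∧ ¬ IsCyclic Q := by
  have := Fact.mk hs
  obtain ⟨x, hx⟩ := exists_prime_orderOf_dvd_card' s hsc
  obtain ⟨y, hy⟩ := exists_prime_orderOf_dvd_card' s htc
  let ψ : Subgroup.zpowers x × Subgroup.zpowers y →* A :=
    (φ.comp (slBlock (Fin 2) J E)).comp
      (MonoidHom.prodMap (Subgroup.zpowers x).subtype (Subgroup.zpowers y).subtype)
  have hpow : ∀ g : Subgroup.zpowers x × Subgroup.zpowers y, g ^ s = 1 := by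
    rintro ⟨a, b⟩
    rw [Prod.pow_mk]
    have ha : a ^ s = 1 := by
      rw [← hx, ← Nat.card_zpowers]
      exact pow_card_eq_one'
    have hb : b ^ s = 1 := by
      rw [← hy, ← Nat.card_zpowers]
      exact pow_card_eq_one'
    rw [ha, hb]
    rfl
  have hψ : Function.Injective ψ := by
    rw [injective_iff_map_eq_one]
    rintro ⟨a, b⟩ hab
    have hab' : φ (slBlock (Fin 2) J E (a.1, b.1)) = 1 := hab
    obtain ⟨c, hc, -⟩ := h.exists_scalar_of_map_slBlock hab'
    have hc2 : c ^ 2 = 1 := by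
      have := a.1.2
      rw [hc] at this
      simpa using this
    have hcs : c ^ s = 1 := by
      have h1 : a.1 ^ s = 1 := congrArg (fun z => (z.1 : SpecialLinearGroup (Fin 2) E)) (hpow (a,
          b))
      have h2 : a.1.1 ^ s = 1 := congrArg Subtype.val h1
      rw [hc, ← map_pow] at h2
      have := congrFun (congrFun h2 0) 0
      simpa using this
    have hc1 : c = 1 := by
      obtain ⟨k, rfl⟩ := hodd
      rwa [pow_succ, pow_mul, hc2, one_pow, one_mul] at hcs
    have ha1 : a.1 = 1 := by
      apply Subtype.ext
      rw [hc, hc1, map_one]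
      rfl
    have hb1 := (h.eq_one_of_map_slBlock hab').1 ha1
    exact Prod.ext (Subtype.ext ha1) (Subtype.ext hb1)
  refine ⟨ψ.range, ?_, ?_⟩
  · rintro ⟨_, g, rfl⟩
    refine ⟨1, Subtype.ext ?_⟩
    change ψ g ^ s ^ 1 = 1
    rw [pow_one, ← map_pow, hpow, map_one]
  · intro hcyc
    have h1 := IsCyclic.exponent_eq_card (α := ψ.range)
    have h2 : Monoid.exponent ψ.range ∣ s := by
      refine Monoid.exponent_dvd_of_forall_pow_eq_one ?_
      rintro ⟨_, g, rfl⟩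
      apply Subtype.ext
      change ψ g ^ s = 1
      rw [← map_pow, hpow, map_one]
    rw [h1, ← Nat.card_congr (MonoidHom.ofInjective hψ).toEquiv, Nat.card_prod, Nat.card_zpowers,
      Nat.card_zpowers, hx, hy] at h2
    have h3 := Nat.le_of_dvd hs.pos h2
    have := hs.two_le
    nlinarith

omit [Finite A] in
theorem IsSLCover.orderOf_dvd [Nonempty I] {φ : SpecialLinearGroup I E →* A} (h : IsSLCover φ)
    (y : SpecialLinearGroup I E) :
    orderOf y ∣ orderOf (φ y) * (Fintype.card I).gcd (Nat.card E - 1) := by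
  apply orderOf_dvd_of_pow_eq_one
  have h1 : φ (y ^ orderOf (φ y)) = 1 := by rw [map_pow, pow_orderOf_eq_one]
  rw [h.map_eq_one_iff, Matrix.SpecialLinearGroup.mem_center_iff] at h1
  obtain ⟨c, hc1, hc⟩ := h1
  have hc0 : c ≠ 0 := by
    rintro rfl
    rw [zero_pow Fintype.card_ne_zero] at hc1
    exact zero_ne_one hc1
  have hc2 : c ^ (Nat.card E - 1) = 1 := by
    have := Fintype.ofFinite E
    rw [Nat.card_eq_fintype_card]
    exact FiniteField.pow_card_sub_one_eq_one c hc0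
  have hc3 : c ^ (Fintype.card I).gcd (Nat.card E - 1) = 1 := pow_gcd_eq_one.2 ⟨hc1, hc2⟩
  rw [pow_mul]
  apply Subtype.ext
  change (y ^ orderOf (φ y)).1 ^ _ = 1
  rw [← hc, ← map_pow, hc3, map_one]

theorem exists_sl_orderOf_eq_pow_sub_one (I E : Type*) [Fintype I] [DecidableEq I] [Field E]
    [Finite E] (hI : 2 ≤ Fintype.card I) :
    ∃ y : SpecialLinearGroup I E, orderOf y = Nat.card E ^ (Fintype.card I - 1) - 1 := by
  obtain ⟨g, hg⟩ := exists_gl_orderOf_eq E (j := Fintype.card I - 1) (by omega)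
  have hm : ∀ g : GL (Fin (Fintype.card I - 1)) E,
      (fromBlocks g.1 0 0 ((GeneralLinearGroup.det g)⁻¹.1 • (1 : Matrix (Fin 1) (Fin 1) E))).det =
        1 := by
    intro g
    rw [det_fromBlocks_zero₂₁, det_smul, det_one, mul_one, Fintype.card_fin, pow_one]
    exact (GeneralLinearGroup.det g).mul_inv
  let θ : GL (Fin (Fintype.card I - 1)) E →*
      SpecialLinearGroup (Fin (Fintype.card I - 1) ⊕ Fin 1) E :=
    { toFun := fun g => ⟨_, hm g⟩
      map_one' := Subtype.ext (by simp [fromBlocks_one])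
      map_mul' := fun g g' => Subtype.ext (by
        change fromBlocks _ _ _ _ = fromBlocks _ _ _ _ * fromBlocks _ _ _ _
        rw [fromBlocks_multiply]
        simp [smul_smul, mul_comm]) }
  have hθ : Function.Injective θ := by
    intro g g' hgg
    have h1 : fromBlocks g.1 0 0 _ = fromBlocks g'.1 0 0 _ := congrArg Subtype.val hgg
    exact Units.ext (fromBlocks_inj.1 h1).1
  have e : Fin (Fintype.card I - 1) ⊕ Fin 1 ≃ I := Fintype.equivOfCardEq (by
    rw [Fintype.card_sum, Fintype.card_fin, Fintype.card_fin]
    omega)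
  refine ⟨slReindex E e (θ g), ?_⟩
  rw [MulEquiv.orderOf_eq, orderOf_injective θ hθ, hg]

theorem exists_sl_orderOf_eq_div (I E : Type*) [Fintype I] [DecidableEq I] [Nonempty I] [Field E]
    [Finite E] : ∃ y : SpecialLinearGroup I E,
      orderOf y = (Nat.card E ^ Fintype.card I - 1) / (Nat.card E - 1) := by
  obtain ⟨g, hg⟩ := exists_sl_orderOf_eq E (j := Fintype.card I) Fintype.card_ne_zero
  refine ⟨slReindex E (Fintype.equivFin I).symm g, ?_⟩
  rw [MulEquiv.orderOf_eq, hg]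

end element_orders

section card_sl

open Matrix

theorem card_specialLinearGroup (J E : Type*) [Fintype J] [DecidableEq J] [Field E] [Finite E]
    {k : ℕ} (hJ : Fintype.card J = k + 1) :
    Nat.card (SpecialLinearGroup J E) =
      (∏ i ∈ Finset.range k, (Nat.card E ^ (k + 1) - Nat.card E ^ i)) * Nat.card E ^ k := by
  have := Fintype.ofFinite E
  have e := Fintype.equivFinOfCardEq hJ
  rw [Nat.card_congr (slReindex E e).toEquiv]
  have hrange : (Matrix.SpecialLinearGroup.toGL : SpecialLinearGroup (Fin (k + 1)) E →*
      GL (Fin (k + 1)) E).range = (GeneralLinearGroup.det (n := Fin (k + 1)) (R := E)).ker := by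
    apply SetLike.coe_injective
    rw [MonoidHom.coe_range, Matrix.SpecialLinearGroup.range_toGL]
    rfl
  have h1 := (GeneralLinearGroup.det (n := Fin (k + 1)) (R := E)).ker.card_mul_index
  rw [← hrange, ← Nat.card_congr (MonoidHom.ofInjective
    Matrix.SpecialLinearGroup.toGL_injective).toEquiv, hrange, Subgroup.index_ker,
    MonoidHom.range_eq_top.2 GeneralLinearGroup.det_surjective, Subgroup.card_top,
    Nat.card_units, card_GL_field, Nat.card_eq_fintype_card (α := E)] at h1
  rw [Nat.card_eq_fintype_card (α := E)]
  have hE : 1 < Fintype.card E := Fintype.one_lt_card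
  have h2 := Finset.prod_range (fun i => Fintype.card E ^ (k + 1) - Fintype.card E ^ i) (n := k + 1)
  rw [← h2, Finset.prod_range_succ, pow_succ, show ∀ a b : ℕ, a * b - a = a * (b - 1) from
    fun a b => by rw [Nat.mul_sub, mul_one], ← mul_assoc, ← pow_succ] at h1
  exact Nat.eq_of_mul_eq_mul_right (by omega) h1

variable {J E : Type*} [Fintype J] [DecidableEq J] [Field E] [Finite E]

theorem dvd_card_specialLinearGroup_of_dvd_pow_sub_one {i d : ℕ} (hi : 2 ≤ i)
    (hiJ : i ≤ Fintype.card J) (hd : d ∣ Nat.card E ^ i - 1) :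
    d ∣ Nat.card (SpecialLinearGroup J E) := by
  obtain ⟨k, hk⟩ : ∃ k, Fintype.card J = k + 1 := ⟨Fintype.card J - 1, by omega⟩
  rw [card_specialLinearGroup J E hk]
  refine Dvd.dvd.mul_right ?_ _
  refine Dvd.dvd.trans ?_ (Finset.dvd_prod_of_mem _ (a := k + 1 - i) (by
    rw [Finset.mem_range]
    omega))
  have h1 : Nat.card E ^ (k + 1) = Nat.card E ^ (k + 1 - i) * Nat.card E ^ i := by
    rw [← pow_add]
    congr 1
    omega
  rw [h1, ← Nat.mul_sub_one]
  exact hd.mul_left _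

theorem dvd_card_specialLinearGroup_of_dvd_card {d : ℕ} (hJ : 2 ≤ Fintype.card J)
    (hd : d ∣ Nat.card E) : d ∣ Nat.card (SpecialLinearGroup J E) := by
  obtain ⟨k, hk⟩ : ∃ k, Fintype.card J = k + 1 := ⟨Fintype.card J - 1, by omega⟩
  rw [card_specialLinearGroup J E hk]
  exact (dvd_pow hd (by omega)).mul_left _

theorem exists_of_prime_dvd_card_specialLinearGroup {t : ℕ} (ht : t.Prime)
    (h : t ∣ Nat.card (SpecialLinearGroup J E)) :
    t ∣ Nat.card E ∨ ∃ i, 2 ≤ i ∧ i ≤ Fintype.card J ∧ t ∣ Nat.card E ^ i - 1 := by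
  rcases Nat.eq_zero_or_pos (Fintype.card J) with h0 | h0
  · have := Fintype.card_eq_zero_iff.1 h0
    rw [Nat.card_of_subsingleton (1 : SpecialLinearGroup J E), Nat.dvd_one] at h
    exact absurd h ht.ne_one
  obtain ⟨k, hk⟩ : ∃ k, Fintype.card J = k + 1 := ⟨Fintype.card J - 1, by omega⟩
  rw [card_specialLinearGroup J E hk, ht.dvd_mul, ht.prime.dvd_finsetProd_iff] at h
  rcases h with ⟨i, hi, h⟩ | h
  · rw [Finset.mem_range] at hi
    have h1 : Nat.card E ^ (k + 1) = Nat.card E ^ i * Nat.card E ^ (k + 1 - i) := by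
      rw [← pow_add]
      congr 1
      omega
    rw [h1, ← Nat.mul_sub_one, ht.dvd_mul] at h
    rcases h with h | h
    · exact Or.inl (ht.dvd_of_dvd_pow h)
    · exact Or.inr ⟨k + 1 - i, by omega, by omega, h⟩
  · exact Or.inl (ht.dvd_of_dvd_pow h)

end card_sl

/-- The features of the spectrum of `PSp_{2n}(q)` used to restrict the structure of a group with
the same spectrum. -/
structure HasPSpSpectrum (G : Type*) [Group G] (n q : ℕ) : Prop where
  nonadjacent : ∀ a b : ℕ, a.Prime → b.Prime → a ≠ 2 → b ≠ 2 →
    orderOf (q : ZMod a) ≠ 0 → orderOf (q : ZMod b) ≠ 0 →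
    2 * n < orbitBound (orderOf (q : ZMod a)) (orderOf (q : ZMod a)) +
      orbitBound (orderOf (q : ZMod b)) (orderOf (q : ZMod b)) →
    2 * n < orbitBound (orderOf (q : ZMod a)) (orderOf (q : ZMod b)) → Nonadjacent G a b
  dvd_half : ∀ (r : ℕ) (x : G), r.Prime → orderOf (q : ZMod r) = 2 * n → r ∣ orderOf x →
    orderOf x ∣ (q ^ n + 1) / 2
  exists_orderOf_eq : ∀ j d : ℕ, j ≠ 0 → j ≤ n → Odd d → (d ∣ q ^ j - 1 ∨ d ∣ q ^ j + 1) →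
    ∃ g : G, orderOf g = d

theorem hasPSpSpectrum_of_elementOrders_eq {G F : Type*} [Group G] [Field F] [Fintype F] {n : ℕ}
    (hn : n ≠ 0) (hodd : Odd (Fintype.card F)) (h : elementOrders G = elementOrders (PSp n F)) :
    HasPSpSpectrum G n (Fintype.card F) where
  nonadjacent a b ha hb ha2 hb2 hqa hqb h1 h2 g hg := by
    have hm : orderOf g ∈ elementOrders G := ⟨g, rfl⟩
    rw [h] at hm
    obtain ⟨x, hx⟩ := hm
    exact nonadjacent_psp ha hb ha2 hb2 hqa hqb h1 h2 x (hx ▸ hg)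
  dvd_half r g hr hqr hg := by
    have hm : orderOf g ∈ elementOrders G := ⟨g, rfl⟩
    rw [h] at hm
    obtain ⟨x, hx⟩ := hm
    rw [← hx]
    exact dvd_half_of_dvd_orderOf_psp hodd hn hr hqr x (hx ▸ hg)
  exists_orderOf_eq j d hj hjn hd hdq := by
    have hm := odd_dvd_mem_elementOrders_psp hj hjn hd hdq
    rwa [← h] at hm

section arithmetic

variable {q n : ℕ}

theorem two_mul_half (hodd : Odd q) : 2 * ((q ^ n + 1) / 2) = q ^ n + 1 :=
  Nat.mul_div_cancel' ((hodd.pow.add_one).two_dvd)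

theorem odd_half (hodd : Odd q) (hn : Even n) : Odd ((q ^ n + 1) / 2) := by
  have h1 := two_mul_half (n := n) hodd
  obtain ⟨k, rfl⟩ := hn
  have h2 : q ^ (k + k) % 4 = 1 := by
    rw [pow_add, ← mul_pow, Nat.pow_mod, Nat.mul_mod]
    have : q % 4 = 1 ∨ q % 4 = 3 := by
      obtain ⟨l, rfl⟩ := hodd
      omega
    rcases this with h | h <;> rw [h] <;> norm_num
  rw [Nat.odd_iff]
  omega

theorem not_three_dvd_half (hodd : Odd q) (hn : Even n) (hn0 : n ≠ 0) :
    ¬ 3 ∣ (q ^ n + 1) / 2 := by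
  have h1 := two_mul_half (n := n) hodd
  obtain ⟨k, rfl⟩ := hn
  have h2 : q ^ (k + k) % 3 = 1 ∨ q ^ (k + k) % 3 = 0 := by
    rw [pow_add, ← mul_pow, Nat.pow_mod, Nat.mul_mod]
    have : q % 3 = 0 ∨ q % 3 = 1 ∨ q % 3 = 2 := by omega
    rcases this with h | h | h <;> rw [h]
    · right
      rw [Nat.zero_mod, zero_pow (by omega)]
      rfl
    · left; norm_num
    · left; norm_num
  omega

theorem orderOf_of_prime_dvd_half (hodd : Odd q) (hn : Even n) (hn0 : n ≠ 0) {s : ℕ}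
    (hs : s.Prime) (h : s ∣ (q ^ n + 1) / 2) :
    s ≠ 2 ∧ orderOf (q : ZMod s) ∣ 2 * n ∧ 4 ∣ orderOf (q : ZMod s) ∧
      ¬ orderOf (q : ZMod s) ∣ n := by
  have hq1 : 1 ≤ q := hodd.pos
  have hs2 : s ≠ 2 := by
    rintro rfl
    exact Nat.not_even_iff_odd.2 (odd_half hodd hn) (even_iff_two_dvd.2 h)
  have h1 : s ∣ q ^ n + 1 := h.trans (Dvd.intro_left 2 (two_mul_half hodd))
  have h2 : ¬ orderOf (q : ZMod s) ∣ n := by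
    rw [← dvd_pow_sub_one_iff hq1]
    intro h3
    have h4 := Nat.dvd_sub h1 h3
    have h5 : q ^ n + 1 - (q ^ n - 1) = 2 := by
      have := Nat.one_le_pow n q hq1
      omega
    rw [h5, Nat.prime_dvd_prime_iff_eq hs Nat.prime_two] at h4
    exact hs2 h4
  have h3 : orderOf (q : ZMod s) ∣ 2 * n := by
    rw [← dvd_pow_sub_one_iff hq1, mul_comm, pow_mul]
    have h4 : (q ^ n) ^ 2 - 1 = (q ^ n + 1) * (q ^ n - 1) := by
      rw [← Nat.sq_sub_sq, one_pow]
    rw [h4]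
    exact h1.mul_right _
  refine ⟨hs2, h3, ?_, h2⟩
  obtain ⟨f, hf⟩ := h3
  have hfo : Odd f := by
    rw [← Nat.not_even_iff_odd]
    rintro ⟨f', rfl⟩
    exact h2 ⟨f', by linarith⟩
  have h4 : 4 ∣ orderOf (q : ZMod s) * f := by
    rw [← hf]
    obtain ⟨k, rfl⟩ := hn
    exact ⟨k, by ring⟩
  exact ((Nat.coprime_two_left.2 hfo).pow_left 2).dvd_of_dvd_mul_right h4

variable {G : Type*} [Group G]

namespace HasPSpSpectrum

variable (hG : HasPSpSpectrum G n q)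

include hG

theorem nonadjacent_of_dvd_half (hodd : Odd q) (hn : Even n) (hn1 : 6 ≤ n) (hn2 : n ≤ 16)
    {s t : ℕ} (hs : s.Prime) (ht : t.Prime) (hsd : s ∣ (q ^ n + 1) / 2)
    (hti : orderOf (q : ZMod t) = (if n = 16 then 13 else n - 1) ∨
      orderOf (q : ZMod t) = 2 * (if n = 16 then 13 else n - 1)) : Nonadjacent G t s := by
  obtain ⟨h1, h2, h3, h4⟩ := orderOf_of_prime_dvd_half hodd hn (by omega) hs hsd
  have ht2 : t ≠ 2 := by
    rintro rfl
    rw [orderOf_natCast_zmod_two hodd] at hti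
    split_ifs at hti <;> omega
  have hm : orderOf (q : ZMod s) ∈ (2 * n).divisors.filter (fun i => 4 ∣ i ∧ ¬ i ∣ n) := by
    rw [Finset.mem_filter, Nat.mem_divisors]
    exact ⟨⟨h2, by omega⟩, h3, h4⟩
  have key : ∀ n ∈ Finset.Icc 6 16, Even n →
      ∀ i ∈ (2 * n).divisors.filter (fun i => 4 ∣ i ∧ ¬ i ∣ n),
      ∀ j ∈ ({(if n = 16 then 13 else n - 1), 2 * (if n = 16 then 13 else n - 1)} : Finset ℕ),
      j ≠ 0 ∧ i ≠ 0 ∧ 2 * n < orbitBound j j + orbitBound i i ∧ 2 * n < orbitBound j i := by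
    unfold orbitBound
    decide +kernel
  obtain ⟨k1, k2, k3, k4⟩ := key n (Finset.mem_Icc.2 ⟨hn1, hn2⟩) hn _ hm
    (orderOf (q : ZMod t)) (by simpa using hti)
  exact hG.nonadjacent t s ht hs ht2 h1 k1 k2 k3 k4

theorem nonadjacent_of_orderOf (hodd : Odd q) (hn : Even n) (hn1 : 6 ≤ n) (hn2 : n ≤ 16)
    {t t' : ℕ} (ht : t.Prime) (ht' : t'.Prime)
    (hti : orderOf (q : ZMod t) = (if n = 16 then 13 else n - 1))
    (hti' : orderOf (q : ZMod t') = 2 * (if n = 16 then 13 else n - 1)) :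
    Nonadjacent G t t' := by
  have h2 : ∀ t : ℕ, (orderOf (q : ZMod t) = (if n = 16 then 13 else n - 1) ∨
      orderOf (q : ZMod t) = 2 * (if n = 16 then 13 else n - 1)) → t ≠ 2 := by
    rintro _ hti rfl
    rw [orderOf_natCast_zmod_two hodd] at hti
    split_ifs at hti <;> omega
  have key : ∀ n ∈ Finset.Icc 6 16, Even n →
      ∀ a ∈ ({if n = 16 then 13 else n - 1} : Finset ℕ),
      a ≠ 0 ∧ 2 * a ≠ 0 ∧ 2 * n < orbitBound a a + orbitBound (2 * a) (2 * a) ∧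
        2 * n < orbitBound a (2 * a) := by
    unfold orbitBound
    decide +kernel
  have k := key n (Finset.mem_Icc.2 ⟨hn1, hn2⟩) hn _ (Finset.mem_singleton.2 rfl)
  rw [← hti', ← hti] at k
  exact hG.nonadjacent t t' ht ht' (h2 _ (Or.inl hti)) (h2 _ (Or.inr hti')) k.1 k.2.1 k.2.2.1
    k.2.2.2

theorem exists_orderOf_eq_pow (hodd : Odd q) (hn0 : n ≠ 0) {r k : ℕ} (hr : r.Prime)
    (h : orderOf (q : ZMod r) = 2 * n) (hk : r ^ k ∣ q ^ (2 * n) - 1) :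
    ∃ g : G, orderOf g = r ^ k := by
  have hr2 : r ≠ 2 := by
    rintro rfl
    rw [orderOf_natCast_zmod_two hodd] at h
    omega
  exact hG.exists_orderOf_eq n _ hn0 le_rfl (hr.odd_of_ne_two hr2).pow
    (Or.inr (prime_pow_dvd_pow_add_one hr hn0 hodd.pos h hk))

theorem exists_orderOf_eq_kpart (hq : 3 ≤ q) (hodd : Odd q) (hn1 : 6 ≤ n)
    {i : ℕ} (hi : i = (if n = 16 then 13 else n - 1) ∨ i = 2 * (if n = 16 then 13 else n - 1)) :
    ∃ g : G, orderOf g = kpart i q := by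
  have h1 : (if n = 16 then 13 else n - 1) ≤ n := by split_ifs <;> omega
  have h2 : 5 ≤ (if n = 16 then 13 else n - 1) := by split_ifs <;> omega
  refine hG.exists_orderOf_eq (if n = 16 then 13 else n - 1) _ (by omega) h1
    (odd_kpart (by omega) (by omega) hodd) ?_
  rcases hi with rfl | rfl
  · exact Or.inl (kpart_dvd_pow_sub_one (by omega) (by omega))
  · exact Or.inr (kpart_two_mul_dvd (by omega) (by omega))

/-- There are five odd primes that are pairwise nonadjacent in the prime graph. -/
theorem exists_five_nonadjacent (hq : 3 ≤ q) (hodd : Odd q) (hn : Even n) (hn1 : 6 ≤ n)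
    (hn2 : n ≤ 16) : ∃ t : Fin 5 → ℕ, (∀ i, (t i).Prime) ∧ (∀ i, t i ≠ 2) ∧
      (∀ i j, i ≠ j → t i ≠ t j) ∧ (∀ i j, i ≠ j → Nonadjacent G (t i) (t j)) ∧
      ∀ i, ∃ g : G, orderOf g = t i := by
  let e : ℕ → Fin 5 → ℕ := fun n => ![2 * n, n - 1, 2 * n - 2, 2 * n - 4, n - 3]
  have he1 : ∀ n ∈ Finset.Icc 6 16, Even n → ∀ i : Fin 5, 3 ≤ e n i ∧
      e n i ≤ 2 ^ (e n i).totient ∧ (e n i ≤ n ∨ (Even (e n i) ∧ e n i / 2 ≤ n)) := by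
    decide +kernel
  have he2 : ∀ n ∈ Finset.Icc 6 16, Even n → ∀ i j : Fin 5, i ≠ j → e n i ≠ e n j ∧
      2 * n < orbitBound (e n i) (e n i) + orbitBound (e n j) (e n j) ∧
      2 * n < orbitBound (e n i) (e n j) := by
    unfold orbitBound
    decide +kernel
  replace he1 := he1 n (Finset.mem_Icc.2 ⟨hn1, hn2⟩) hn
  replace he2 := he2 n (Finset.mem_Icc.2 ⟨hn1, hn2⟩) hn
  choose t ht hti using fun i => exists_primitive_prime (he1 i).1 (he1 i).2.1 hq hodd
  have ht2 : ∀ i, t i ≠ 2 := by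
    intro i h2
    have h1 := hti i
    rw [h2, orderOf_natCast_zmod_two hodd] at h1
    have := (he1 i).1
    omega
  have h0 : ∀ i, orderOf (q : ZMod (t i)) ≠ 0 := by
    intro i h
    have := (he1 i).1
    rw [← hti i] at this
    omega
  refine ⟨t, ht, ht2, fun i j hij h => ?_, fun i j hij => ?_, fun i => ?_⟩
  · exact (he2 i j hij).1 (by rw [← hti i, ← hti j, h])
  · refine hG.nonadjacent _ _ (ht i) (ht j) (ht2 i) (ht2 j) (h0 i) (h0 j) ?_ ?_
    · rw [hti, hti]
      exact (he2 i j hij).2.1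
    · rw [hti, hti]
      exact (he2 i j hij).2.2
  · have h3 := (he1 i).1
    rcases (he1 i).2.2 with h | ⟨⟨k, hk⟩, h⟩
    · refine hG.exists_orderOf_eq _ _ (by omega) h ((ht i).odd_of_ne_two (ht2 i)) (Or.inl ?_)
      rw [dvd_pow_sub_one_iff hodd.pos, hti]
    · refine hG.exists_orderOf_eq k _ (by omega) (by omega) ((ht i).odd_of_ne_two (ht2 i))
        (Or.inr ?_)
      have h4 := prime_pow_dvd_pow_add_one (k := 1) (j := k) (q := q) (ht i) (by omega) hodd.pos
        (by rw [hti, hk, two_mul])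
        (by rw [pow_one, dvd_pow_sub_one_iff hodd.pos, hti, hk, two_mul])
      rwa [pow_one] at h4

end HasPSpSpectrum

end arithmetic

section sl_orders

open Matrix

variable {J E : Type*} [Fintype J] [DecidableEq J] [Field E] [Finite E]

theorem exists_pow_dvd_of_pow_dvd_orderOf (y : SpecialLinearGroup J E) {r k : ℕ} (hr : r.Prime)
    (hru : r.Coprime (Nat.card E)) (hk : k ≠ 0) (h : r ^ k ∣ orderOf y) :
    ∃ d, d ≠ 0 ∧ d ≤ Fintype.card J ∧ r ^ k ∣ Nat.card E ^ d - 1 := by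
  classical
  have := Fintype.ofFinite E
  rw [Nat.card_eq_fintype_card] at hru ⊢
  have hrE : (r : E) ≠ 0 := by
    intro h0
    obtain ⟨p, hp⟩ := CharP.exists E
    have hpr := (CharP.cast_eq_zero_iff E p r).1 h0
    obtain ⟨l, hpp, hcard⟩ := FiniteField.card E p
    rw [hcard] at hru
    have h1 : p ∣ r.gcd (p ^ (l : ℕ)) := Nat.dvd_gcd hpr (dvd_pow_self p l.ne_zero)
    rw [hru.gcd_eq_one, Nat.dvd_one] at h1
    exact hpp.ne_one h1
  have hord : orderOf y.1 = orderOf y :=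
    orderOf_injective ({ toFun := fun g => g.1, map_one' := rfl, map_mul' := fun _ _ => rfl } :
      SpecialLinearGroup J E →* Matrix J J E) Subtype.val_injective y
  obtain ⟨c, hc, hc0, hco, hrc⟩ := exists_root_charpoly_pow_dvd_orderOf y.1
    (by rw [hord]; exact (orderOf_pos y).ne') hr hrE hk (by rwa [hord])
  have hmaps : ∀ j ∈ Finset.range (Fintype.card J + 1),
      c ^ Fintype.card E ^ j ∈ (y.1.charpoly.aroots (AlgebraicClosure E)).toFinset := by
    intro j _
    rw [Multiset.mem_toFinset, Polynomial.mem_aroots]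
    exact ⟨(charpoly_monic _).ne_zero, aeval_pow_card_eq_zero _ hc j⟩
  have hcard : (y.1.charpoly.aroots (AlgebraicClosure E)).toFinset.card <
      (Finset.range (Fintype.card J + 1)).card := by
    rw [Finset.card_range, Nat.lt_succ_iff]
    refine (Multiset.toFinset_card_le _).trans ((Polynomial.card_roots' _).trans ?_)
    rw [Polynomial.natDegree_map, charpoly_natDegree_eq_dim]
  obtain ⟨a, ha, b, hb, hab, heq⟩ := Finset.exists_ne_map_eq_of_card_lt_of_maps_to hcard hmaps
  wlog hlt : a < b generalizing a b
  · exact this b hb a ha hab.symm heq.symm (by omega)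
  rw [Finset.mem_range] at ha hb
  refine ⟨b - a, by omega, by omega, ?_⟩
  have h1 : r ^ k ∣ Fintype.card E ^ a * (Fintype.card E ^ (b - a) - 1) := by
    refine hrc.trans (orderOf_dvd_of_pow_eq_one ?_)
    have h2 : c ^ (Fintype.card E ^ a * (Fintype.card E ^ (b - a) - 1)) * c ^ Fintype.card E ^ a =
        c ^ Fintype.card E ^ a := by
      rw [← pow_add, Nat.mul_sub_one, ← pow_add, Nat.add_sub_cancel' hlt.le,
        Nat.sub_add_cancel (Nat.pow_le_pow_right Fintype.card_pos hlt.le), heq]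
    exact mul_eq_right₀ (pow_ne_zero _ hc0) |>.1 h2
  exact (Nat.Coprime.pow k a hru).dvd_of_dvd_mul_left h1

theorem two_dvd_card_specialLinearGroup (hJ : 2 ≤ Fintype.card J) :
    2 ∣ Nat.card (SpecialLinearGroup J E) := by
  rcases Nat.even_or_odd (Nat.card E) with h | h
  · exact dvd_card_specialLinearGroup_of_dvd_card hJ h.two_dvd
  · refine dvd_card_specialLinearGroup_of_dvd_pow_sub_one le_rfl hJ ?_
    exact (Nat.Odd.sub_odd h.pow odd_one).two_dvd

theorem three_dvd_card_specialLinearGroup (hJ : 2 ≤ Fintype.card J) :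
    3 ∣ Nat.card (SpecialLinearGroup J E) := by
  by_cases h : 3 ∣ Nat.card E
  · exact dvd_card_specialLinearGroup_of_dvd_card hJ h
  · refine dvd_card_specialLinearGroup_of_dvd_pow_sub_one le_rfl hJ ?_
    have h1 : Nat.card E ^ 2 % 3 = 1 := by
      rw [Nat.pow_mod]
      have : Nat.card E % 3 = 1 ∨ Nat.card E % 3 = 2 := by omega
      rcases this with h | h <;> rw [h]
    omega

end sl_orders

namespace HasPSpSpectrum

variable {G : Type*} [Group G] {n q : ℕ} (hG : HasPSpSpectrum G n q) (hodd : Odd q) (hn : Even n)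
  (hn0 : n ≠ 0) {r : ℕ} (hr : r.Prime) (hrq : orderOf (q : ZMod r) = 2 * n)

include hG hodd hn hn0 hr hrq

omit hn0 in
theorem nonadjacent_two : Nonadjacent G r 2 := by
  intro g hg
  have h1 := hG.dvd_half r g hr hrq ((Dvd.intro _ rfl).trans hg)
  have h2 : 2 ∣ (q ^ n + 1) / 2 := (Dvd.intro_left _ rfl).trans (hg.trans h1)
  exact Nat.not_even_iff_odd.2 (odd_half hodd hn) (even_iff_two_dvd.2 h2)

theorem nonadjacent_three : Nonadjacent G r 3 := by
  intro g hg
  have h1 := hG.dvd_half r g hr hrq ((Dvd.intro _ rfl).trans hg)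
  exact not_three_dvd_half hodd hn hn0 ((Dvd.intro_left _ rfl).trans (hg.trans h1))

end HasPSpSpectrum

section primitive_prime

open Matrix

variable {G : Type*} [Group G] [Finite G] {K : Subgroup G} [K.Normal] {n q : ℕ}
  {J E : Type*} [Fintype J] [DecidableEq J] [Field E] [Finite E]
  {φ : SpecialLinearGroup (Fin 2 ⊕ J) E →* G ⧸ K}

theorem IsSLCover.not_dvd_card_of_orderOf_eq (h : IsSLCover φ) (hJ : 2 ≤ Fintype.card J)
    (hG : HasPSpSpectrum G n q) (hodd : Odd q) (hn : Even n) (hn2 : 2 ≤ n) {r : ℕ} (hr : r.Prime)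
    (hrq : orderOf (q : ZMod r) = 2 * n) : ¬ r ∣ Nat.card K := by
  have : Nonempty J := Fintype.card_pos_iff.1 (by omega)
  obtain ⟨Q, hQ, hQc⟩ := h.exists_noncyclic_isPGroup Nat.prime_three (by decide)
    (three_dvd_card_specialLinearGroup (by simp)) (three_dvd_card_specialLinearGroup hJ)
  refine not_dvd_card_of_noncyclic_quotient K hr Nat.prime_three ?_ (by decide)
    (hG.nonadjacent_three hodd hn (by omega) hr hrq) Q hQ hQc
  rintro rfl
  have h1 : orderOf (q : ZMod 3) ≤ 3 := by
    have := orderOf_le_card (x := (q : ZMod 3))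
    simpa using this
  omega

theorem IsSLCover.not_dvd_index_of_orderOf_eq (h : IsSLCover φ) (v : ℕ) [Fact v.Prime] [CharP E v]
    (hE : ∃ c : E, c ≠ 0 ∧ c ^ 2 ≠ 1) (hJ : 2 ≤ Fintype.card J)
    (hG : HasPSpSpectrum G n q) (hodd : Odd q) (hn : Even n) {r : ℕ} (hr : r.Prime)
    (hrq : orderOf (q : ZMod r) = 2 * n) : ¬ r ∣ φ.range.index := by
  intro hri
  have : Nonempty J := Fintype.card_pos_iff.1 (by omega)
  have hr2 : r ≠ 2 := by
    rintro rfl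
    rw [orderOf_natCast_zmod_two hodd] at hrq
    omega
  have hna : Nonadjacent (G ⧸ K) r 2 := (hG.nonadjacent_two hodd hn hr hrq).of_surjective
    (QuotientGroup.mk' K) (QuotientGroup.mk'_surjective K)
  obtain ⟨b, hb, hbr⟩ := h.exists_orderOf_eq_of_dvd_index v hE hr hri
  by_cases h2 : (2 : E) = 0
  · have hv : v = 2 := by
      have h3 : ((2 : ℕ) : E) = 0 := by exact_mod_cast h2
      exact (Nat.prime_dvd_prime_iff_eq (Fact.out (p := v.Prime)) Nat.prime_two).1
        ((CharP.cast_eq_zero_iff E v 2).1 h3)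
    subst hv
    have hcard := h.card_rootSubgroup 2 (Sum.inl_injective.ne (zero_ne_one (α := Fin 2)) :
      (Sum.inl 0 : Fin 2 ⊕ J) ≠ Sum.inl 1)
    have hX : IsPGroup 2 (rootSubgroup φ (Sum.inl_injective.ne (zero_ne_one (α := Fin 2)))) := by
      have := Fintype.ofFinite E
      obtain ⟨l, -, hl⟩ := FiniteField.card E 2
      exact IsPGroup.of_card (n := l) (by rw [hcard, Nat.card_eq_fintype_card, hl])
    have h1 := orderOf_dvd_card_sub_one_of_nonadjacent Nat.prime_two hX hb.1 (by
      intro t ht hto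
      rw [hbr, Nat.prime_dvd_prime_iff_eq ht hr] at hto
      subst hto
      exact ⟨hr2, hna⟩)
    rw [hbr, hcard] at h1
    refine h.not_nonadjacent_of_dvd_card Nat.prime_two hr hr2
      (two_dvd_card_specialLinearGroup (by simp)) ?_ hna
    exact dvd_card_specialLinearGroup_of_dvd_pow_sub_one le_rfl hJ
      (h1.trans (by simpa using Nat.sub_dvd_pow_sub_pow (Nat.card E) 1 2))
  · obtain ⟨z, hz, hzc⟩ := h.exists_involution_commute h2
    exact hna.not_commute ((Nat.coprime_primes hr Nat.prime_two).2 hr2) hbr.symm.dvd hz.symm.dvd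
      (hzc b hb)

theorem mem_range_of_coprime_index {A S : Type*} [Group A] [Finite A] [Group S] (φ : S →* A)
    [φ.range.Normal] {a : A} (h : (orderOf a).Coprime φ.range.index) : a ∈ φ.range := by
  rw [← QuotientGroup.eq_one_iff, ← orderOf_eq_one_iff]
  refine Nat.dvd_one.1 (h ▸ Nat.dvd_gcd ?_ ?_)
  · exact orderOf_map_dvd (QuotientGroup.mk' φ.range) a
  · exact orderOf_dvd_natCard _

omit [Finite G] in
theorem orderOf_mk_eq_of_coprime_card {g : G} (h : (orderOf g).Coprime (Nat.card K)) :
    orderOf (g : G ⧸ K) = orderOf g := by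
  refine Nat.dvd_antisymm (orderOf_map_dvd (QuotientGroup.mk' K) g) ?_
  refine orderOf_dvd_of_pow_eq_one ?_
  rw [← orderOf_eq_one_iff]
  refine Nat.dvd_one.1 (h ▸ Nat.dvd_gcd (orderOf_pow_dvd _) ?_)
  have h1 : g ^ orderOf (g : G ⧸ K) ∈ K := by
    rw [← QuotientGroup.eq_one_iff, QuotientGroup.mk_pow, pow_orderOf_eq_one]
  rw [← Subgroup.orderOf_mk _ h1]
  exact orderOf_dvd_natCard _

end primitive_prime

section primitive_prime

open Matrix

/-- A prime dividing `|SL_m(u)|` but not `|SL_{m-2}(u)|` is a primitive divisor of `u ^ (m-1) - 1`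
or of `u ^ m - 1`. -/
theorem orderOf_eq_of_dvd_card_of_not_dvd_card {J E : Type*} [Fintype J] [DecidableEq J] [Field E]
    [Finite E] (hJ : 2 ≤ Fintype.card J) {t : ℕ} (ht : t.Prime)
    (h1 : t ∣ Nat.card (SpecialLinearGroup (Fin 2 ⊕ J) E))
    (h2 : ¬ t ∣ Nat.card (SpecialLinearGroup J E)) :
    orderOf (Nat.card E : ZMod t) = Fintype.card J + 1 ∨
      orderOf (Nat.card E : ZMod t) = Fintype.card J + 2 := by
  have hu1 : 1 ≤ Nat.card E := Nat.card_pos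
  rcases exists_of_prime_dvd_card_specialLinearGroup ht h1 with h | ⟨i, hi2, him, h⟩
  · exact absurd (dvd_card_specialLinearGroup_of_dvd_card hJ h) h2
  rw [Fintype.card_sum, Fintype.card_fin] at him
  rw [dvd_pow_sub_one_iff hu1] at h
  have hle := Nat.le_of_dvd (by omega) h
  have hpos := Nat.pos_of_dvd_of_pos h (by omega)
  by_contra hne
  refine h2 (dvd_card_specialLinearGroup_of_dvd_pow_sub_one
    (i := if orderOf (Nat.card E : ZMod t) = 1 then 2 else orderOf (Nat.card E : ZMod t)) ?_ ?_ ?_)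
  · split_ifs <;> omega
  · split_ifs <;> omega
  · rw [dvd_pow_sub_one_iff hu1]
    split_ifs with h
    · rw [h]
      exact one_dvd _
    · exact dvd_rfl

variable {G : Type*} [Group G] [Finite G] {K : Subgroup G} [K.Normal] {n q : ℕ}
  {J E : Type*} [Fintype J] [DecidableEq J] [Field E] [Finite E]
  {φ : SpecialLinearGroup (Fin 2 ⊕ J) E →* G ⧸ K}

theorem IsSLCover.orderOf_eq_and_pow_dvd (h : IsSLCover φ) (v : ℕ) [Fact v.Prime] [CharP E v]
    (hE : ∃ c : E, c ≠ 0 ∧ c ^ 2 ≠ 1) (hJ : 2 ≤ Fintype.card J)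
    (hG : HasPSpSpectrum G n q) (hodd : Odd q) (hn : Even n) (hn2 : 2 ≤ n) {r : ℕ} (hr : r.Prime)
    (hrq : orderOf (q : ZMod r) = 2 * n) :
    (orderOf (Nat.card E : ZMod r) = Fintype.card J + 1 ∨
      orderOf (Nat.card E : ZMod r) = Fintype.card J + 2) ∧
    ∀ k, k ≠ 0 → r ^ k ∣ q ^ (2 * n) - 1 →
      r ^ k ∣ Nat.card E ^ orderOf (Nat.card E : ZMod r) - 1 := by
  have hu1 : 1 ≤ Nat.card E := Nat.card_pos
  have hN := h.normal
  have : Nonempty J := Fintype.card_pos_iff.1 (by omega)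
  have hrK := h.not_dvd_card_of_orderOf_eq hJ hG hodd hn hn2 hr hrq
  have hri := h.not_dvd_index_of_orderOf_eq v hE hJ hG hodd hn hr hrq
  have hr2 : r ≠ 2 := by
    rintro rfl
    rw [orderOf_natCast_zmod_two hodd] at hrq
    omega
  have hna : Nonadjacent (G ⧸ K) r 2 := (hG.nonadjacent_two hodd hn hr hrq).of_surjective
    (QuotientGroup.mk' K) (QuotientGroup.mk'_surjective K)
  have hlift : ∀ k, r ^ k ∣ q ^ (2 * n) - 1 →
      ∃ y : SpecialLinearGroup (Fin 2 ⊕ J) E, r ^ k ∣ orderOf y := by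
    intro k hk
    obtain ⟨g, hg⟩ := hG.exists_orderOf_eq_pow hodd (by omega) hr hrq hk
    have h1 : orderOf (g : G ⧸ K) = r ^ k := by
      rw [orderOf_mk_eq_of_coprime_card, hg]
      rw [hg]
      exact Nat.Coprime.pow_left k (hr.coprime_iff_not_dvd.2 hrK)
    obtain ⟨y, hy⟩ := mem_range_of_coprime_index φ (a := (g : G ⧸ K)) (by
      rw [h1]
      exact Nat.Coprime.pow_left k (hr.coprime_iff_not_dvd.2 hri))
    refine ⟨y, ?_⟩
    rw [← h1, ← hy]
    exact orderOf_map_dvd φ y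
  have hSL : ¬ r ∣ Nat.card (SpecialLinearGroup J E) := fun hd =>
    h.not_nonadjacent_of_dvd_card Nat.prime_two hr hr2 (two_dvd_card_specialLinearGroup (by simp))
      hd hna
  have hru : r.Coprime (Nat.card E) := hr.coprime_iff_not_dvd.2 fun hd =>
    hSL (dvd_card_specialLinearGroup_of_dvd_card hJ hd)
  have he : orderOf (Nat.card E : ZMod r) = Fintype.card J + 1 ∨
      orderOf (Nat.card E : ZMod r) = Fintype.card J + 2 := by
    obtain ⟨y, hy⟩ := hlift 1 (by rw [pow_one, dvd_pow_sub_one_iff hodd.pos, hrq])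
    rw [pow_one] at hy
    exact orderOf_eq_of_dvd_card_of_not_dvd_card hJ hr (hy.trans (orderOf_dvd_natCard _)) hSL
  refine ⟨he, fun k hk0 hk => ?_⟩
  obtain ⟨y, hy⟩ := hlift k hk
  obtain ⟨d, hd0, hd, hkd⟩ := exists_pow_dvd_of_pow_dvd_orderOf y hr hru hk0 hy
  rw [Fintype.card_sum, Fintype.card_fin] at hd
  have h3 : orderOf (Nat.card E : ZMod r) ∣ d := by
    rw [← dvd_pow_sub_one_iff hu1]
    exact (dvd_pow_self r hk0).trans hkd
  have h4 : d = orderOf (Nat.card E : ZMod r) := by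
    obtain ⟨f, rfl⟩ := h3
    have h5 : f ≠ 0 := by
      rintro rfl
      exact hd0 (mul_zero _)
    have h6 : f < 2 := by
      by_contra! h7
      have := Nat.mul_le_mul_left (orderOf (Nat.card E : ZMod r)) h7
      omega
    obtain rfl : f = 1 := by omega
    rw [mul_one]
  rw [← h4]
  exact hkd

end primitive_prime

section maximal_tori

open Matrix

theorem HasPSpSpectrum.dvd_half_quotient {G : Type*} [Group G] {K : Subgroup G} [K.Normal]
    {n q : ℕ} (hG : HasPSpSpectrum G n q) {r : ℕ} (x : G ⧸ K) (hr : r.Prime)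
    (hrq : orderOf (q : ZMod r) = 2 * n) (h : r ∣ orderOf x) : orderOf x ∣ (q ^ n + 1) / 2 := by
  obtain ⟨g, rfl⟩ := QuotientGroup.mk_surjective x
  have h1 : orderOf (g : G ⧸ K) ∣ orderOf g := orderOf_map_dvd (QuotientGroup.mk' K) g
  exact h1.trans (hG.dvd_half r g hr hrq (h.trans h1))

variable {A J E : Type*} [Fintype J] [DecidableEq J] [Field E] [Finite E] [Group A]

/-- Generators of the two large cyclic tori. -/
theorem IsSLCover.exists_torus {φ : SpecialLinearGroup (Fin 2 ⊕ J) E →* A} (h : IsSLCover φ)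
    (hJ : 2 ≤ Fintype.card J) {e : ℕ} (he : e = Fintype.card J + 1 ∨ e = Fintype.card J + 2) :
    ∃ y : SpecialLinearGroup (Fin 2 ⊕ J) E,
      (∀ t, t.Prime → orderOf (Nat.card E : ZMod t) = e → t ∣ orderOf (φ y)) ∧
      Nat.card E ^ (Fintype.card J + 1) - 1 ≤ orderOf y ∧
      (e = Fintype.card J + 1 → orderOf y = Nat.card E ^ (Fintype.card J + 1) - 1) ∧
      (e = Fintype.card J + 2 →
        orderOf y * (Nat.card E - 1) = Nat.card E ^ (Fintype.card J + 2) - 1) := by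
  have hcard : Fintype.card (Fin 2 ⊕ J) = Fintype.card J + 2 := by
    rw [Fintype.card_sum, Fintype.card_fin, add_comm]
  have hu1 : 1 < Nat.card E := Finite.one_lt_card
  have hndvd : ∀ t, t.Prime → orderOf (Nat.card E : ZMod t) = e → ¬ t ∣ Nat.card E - 1 := by
    intro t ht hte hd
    rw [← pow_one (Nat.card E), dvd_pow_sub_one_iff hu1.le, hte] at hd
    have := Nat.le_of_dvd one_pos hd
    omega
  have hcop : ∀ t, t.Prime → orderOf (Nat.card E : ZMod t) = e → ∀ y, t ∣ orderOf y →
      t ∣ orderOf (φ y) := by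
    intro t ht hte y hy
    refine (ht.dvd_mul.1 (hy.trans (h.orderOf_dvd y))).resolve_right fun h1 => ?_
    exact hndvd t ht hte (h1.trans (Nat.gcd_dvd_right _ _))
  rcases he with rfl | rfl
  · obtain ⟨y, hy⟩ := exists_sl_orderOf_eq_pow_sub_one (Fin 2 ⊕ J) E (by omega)
    rw [hcard] at hy
    refine ⟨y, fun t ht hte => hcop t ht hte y ?_, hy.ge, fun _ => hy, fun h0 => by omega⟩
    rw [hy, dvd_pow_sub_one_iff hu1.le, hte]
    exact dvd_rfl
  · obtain ⟨y, hy⟩ := exists_sl_orderOf_eq_div (Fin 2 ⊕ J) E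
    rw [hcard] at hy
    have hy' : orderOf y * (Nat.card E - 1) = Nat.card E ^ (Fintype.card J + 2) - 1 := by
      rw [hy]
      exact Nat.div_mul_cancel (by simpa using Nat.sub_dvd_pow_sub_pow (Nat.card E) 1 _)
    refine ⟨y, fun t ht hte => hcop t ht hte y ?_, ?_, fun h0 => by omega, fun _ => hy'⟩
    · have h1 : t ∣ orderOf y * (Nat.card E - 1) := by
        rw [hy', dvd_pow_sub_one_iff hu1.le, hte]
      exact (ht.dvd_mul.1 h1).resolve_right (hndvd t ht hte)
    · refine Nat.le_of_mul_le_mul_right (c := Nat.card E - 1) ?_ (by omega)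
      rw [hy', Nat.mul_sub_one, Nat.sub_mul, one_mul, ← pow_succ,
        show Fintype.card J + 1 + 1 = Fintype.card J + 2 from rfl]
      have : 1 ≤ Nat.card E ^ (Fintype.card J + 1) := Nat.one_le_pow _ _ hu1.le
      omega

/-- Unless `(u - 1) ∣ m` and `e = m - 1`, some prime divisor of `u ^ 2 - 1` divides the order of the
torus generator. -/
theorem exists_prime_dvd_of_torus {u m w o : ℕ} (hu : 3 < u) (hm : Even m) (hw : Odd w)
    (ho : o ∣ w * m.gcd (u - 1))
    (h : (o = u ^ (m - 1) - 1 ∧ ¬ (u - 1) ∣ m) ∨ o * (u - 1) = u ^ m - 1) :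
    ∃ s, s.Prime ∧ s ∣ u ^ 2 - 1 ∧ s ∣ w := by
  have hgpos : 0 < m.gcd (u - 1) := Nat.gcd_pos_of_pos_right _ (by omega)
  have hsq : u ^ 2 - 1 = (u + 1) * (u - 1) := by rw [← Nat.sq_sub_sq, one_pow]
  rcases h with ⟨ho', hdvd⟩ | ho'
  · obtain ⟨f, hf⟩ := Nat.gcd_dvd_right m (u - 1)
    have hf1 : f ≠ 1 := by
      rintro rfl
      rw [mul_one] at hf
      exact hdvd (hf ▸ Nat.gcd_dvd_left _ _)
    obtain ⟨s, hs, hsf⟩ := Nat.exists_prime_and_dvd hf1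
    have h1 : m.gcd (u - 1) * s ∣ u - 1 := by
      conv_rhs => rw [hf]
      exact Nat.mul_dvd_mul_left _ hsf
    refine ⟨s, hs, ?_, ?_⟩
    · rw [hsq]
      exact ((Dvd.intro_left _ rfl).trans h1).mul_left _
    · have h2 : u - 1 ∣ o := by
        rw [ho']
        simpa using Nat.sub_dvd_pow_sub_pow u 1 (m - 1)
      have h3 := (h1.trans h2).trans ho
      rw [mul_comm w] at h3
      exact Nat.dvd_of_mul_dvd_mul_left hgpos h3
  · have h1 : u + 1 ∣ o := by
      refine Nat.dvd_of_mul_dvd_mul_right (k := u - 1) (by omega) ?_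
      rw [ho', ← hsq]
      obtain ⟨k, rfl⟩ := hm
      rw [← two_mul, pow_mul]
      simpa using Nat.sub_dvd_pow_sub_pow (u ^ 2) 1 k
    have hg2 : ∀ d, d ∣ u + 1 → d ∣ m.gcd (u - 1) → d ∣ 2 := by
      intro d hd1 hd2
      have h2 := Nat.dvd_sub hd1 (hd2.trans (Nat.gcd_dvd_right _ _))
      rwa [show u + 1 - (u - 1) = 2 by omega] at h2
    by_cases hodd : ∃ s, s.Prime ∧ s ∣ u + 1 ∧ s ≠ 2
    · obtain ⟨s, hs, hsu, hs2⟩ := hodd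
      refine ⟨s, hs, ?_, ?_⟩
      · rw [hsq]
        exact hsu.mul_right _
      · refine (hs.dvd_mul.1 ((hsu.trans h1).trans ho)).resolve_right fun h2 => hs2 ?_
        exact (Nat.prime_dvd_prime_iff_eq hs Nat.prime_two).1 (hg2 s hsu h2)
    · push Not at hodd
      have h2 := Nat.eq_prime_pow_of_unique_prime_dvd (n := u + 1) (p := 2) (by omega)
        (fun {d} hd hdu => hodd d hd hdu)
      have h3 : 2 < (u + 1).primeFactorsList.length := by
        by_contra! h3
        have := Nat.pow_le_pow_right (n := 2) two_pos h3
        omega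
      have h4 : 2 ^ 2 ∣ u + 1 := by
        rw [h2]
        exact pow_dvd_pow 2 h3.le
      have h5 : 2 ^ 2 ∣ m.gcd (u - 1) :=
        ((Nat.coprime_two_left.2 hw).pow_left 2).dvd_of_dvd_mul_left ((h4.trans h1).trans ho)
      have := Nat.le_of_dvd two_pos (hg2 _ h4 h5)
      omega

theorem cube_le_of_torus {u m w o N : ℕ} (hu : 3 < u) (hm : 4 ≤ m) (hw : 2 * w ≤ N)
    (ho : u ^ (m - 1) - 1 ≤ o) (how : o ≤ w * m) : u ^ 3 ≤ 2 * N + 1 := by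
  obtain ⟨k, rfl⟩ := Nat.exists_eq_add_of_le hm
  have h1 : 4 + k ≤ 4 * u ^ k := by
    have h2 : 1 + k ≤ 4 ^ k := by
      have := Nat.lt_pow_self (n := k) (a := 4) (by norm_num)
      omega
    have h3 : 4 ^ k ≤ u ^ k := Nat.pow_le_pow_left hu k
    omega
  have h2 : u ^ (4 + k - 1) = u ^ 3 * u ^ k := by
    rw [← pow_add]
    congr 1
    omega
  rw [h2] at ho
  have h3 : u ^ 3 * u ^ k ≤ w * (4 + k) + 1 := by omega
  have h4 : u ^ 3 * (4 + k) ≤ u ^ 3 * (4 * u ^ k) := Nat.mul_le_mul_left _ h1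
  have h5 : 2 * w * (4 + k) ≤ N * (4 + k) := Nat.mul_le_mul_right _ hw
  by_contra! h6
  have h7 : (2 * N + 2) * (4 + k) ≤ u ^ 3 * (4 + k) := Nat.mul_le_mul_right _ h6
  nlinarith

end maximal_tori

section large_rank

open Matrix

theorem IsSLCover.block_injective {A I J E : Type*} [Fintype I] [DecidableEq I] [Nonempty I]
    [Fintype J] [DecidableEq J] [Nonempty J] [Field E] [Group A]
    {φ : SpecialLinearGroup (I ⊕ J) E →* A} (h : IsSLCover φ) :
    Function.Injective ((φ.comp (slBlock I J E)).comp (MonoidHom.inl _ _)) :=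
  (injective_iff_map_eq_one _).2 fun _ hg => (h.eq_one_of_map_slBlock hg).2 rfl

/-- Modulo inner factors, an element of order coprime to the socle normalizes a Sylow `s`-subgroup
of the block `SL₂`; fixed point freeness bounds its order. -/
theorem IsSLCover.le_card_of_nonadjacent {A J E : Type*} [Fintype J] [DecidableEq J] [Nonempty J]
    [Field E] [Finite E] [Group A] [Finite A] {φ : SpecialLinearGroup (Fin 2 ⊕ J) E →* A}
    (h : IsSLCover φ) (v : ℕ) [Fact v.Prime] [CharP E v] (hE : ∃ c : E, c ≠ 0 ∧ c ^ 2 ≠ 1)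
    {s : ℕ} (hs : s.Prime) (hs2 : s ≠ 2) (hsu : s ∣ Nat.card E ^ 2 - 1) (x : A)
    (hx : ∀ t, t.Prime → t ∣ orderOf x → t ≠ s ∧ Nonadjacent A t s)
    (hco : (orderOf x).Coprime (Nat.card φ.range)) : orderOf x ≤ Nat.card E := by
  have hN := h.normal
  have := Fact.mk hs
  have hu1 : 1 < Nat.card E := Finite.one_lt_card
  obtain ⟨P, hPD, hP, hPne, -, hfr⟩ := exists_sylow_frattini
    (rootSubgroup φ (Sum.inl_injective.ne (zero_ne_one (α := Fin 2))) ⊔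
      rootSubgroup φ (Sum.inl_injective.ne (zero_ne_one (α := Fin 2))).symm) s
  obtain ⟨s₀, hs₀⟩ := h.exists_mul_mem_normalizer_opposite v hE x
  obtain ⟨w, hw, hwN⟩ := hfr _ (Subgroup.normalizer_inf_normalizer_le_normalizer_sup _ _ hs₀)
  rw [sup_rootSubgroup_eq_range] at hPD hPne hw
  have hwr : w ∈ φ.range := by
    obtain ⟨g, rfl⟩ := hw
    exact ⟨_, rfl⟩
  have hsr : φ s₀ ∈ φ.range := ⟨s₀, rfl⟩
  have hmk : ((w * (φ s₀ * x) : A) : A ⧸ φ.range) = x := by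
    rw [QuotientGroup.mk_mul, QuotientGroup.mk_mul, (QuotientGroup.eq_one_iff w).2 hwr,
      (QuotientGroup.eq_one_iff (φ s₀)).2 hsr, one_mul, one_mul]
  have hdvd : orderOf x ∣ orderOf (w * (φ s₀ * x)) := by
    rw [← orderOf_mk_eq_of_coprime_card hco, ← hmk]
    exact orderOf_map_dvd (QuotientGroup.mk' φ.range) _
  obtain ⟨c, hcN, hc⟩ := exists_orderOf_of_dvd _ _ hwN hdvd
  have h1 := orderOf_dvd_card_sub_one_of_nonadjacent hs hP hcN (by rwa [hc])
  rw [hc] at h1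
  have hcardD := Nat.card_congr (MonoidHom.ofInjective h.block_injective).toEquiv
  have hSL := card_specialLinearGroup (Fin 2) E (k := 1) (by simp)
  rw [Finset.prod_range_one, pow_zero, pow_one] at hSL
  have hsq : Nat.card E ^ 2 - 1 = (Nat.card E + 1) * (Nat.card E - 1) := by
    rw [← Nat.sq_sub_sq, one_pow]
  obtain ⟨j, hj⟩ := IsPGroup.iff_card.1 hP
  have hj0 : j ≠ 0 := by
    rintro rfl
    rw [pow_zero] at hj
    refine hPne ?_ (Subgroup.card_eq_one.1 hj)
    rw [← hcardD, hSL]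
    exact hsu.mul_right _
  have h2 : s ^ j ∣ (Nat.card E + 1) * (Nat.card E - 1) * Nat.card E := by
    rw [← hsq, ← hj, ← hSL, hcardD]
    exact Subgroup.card_dvd_of_le hPD
  have hsE : ¬ s ∣ Nat.card E := by
    intro h3
    have h4 := Nat.dvd_sub (h3.pow (n := 2) two_ne_zero) hsu
    rw [Nat.sub_sub_self (Nat.one_le_pow _ _ hu1.le), Nat.dvd_one] at h4
    exact hs.ne_one h4
  have h3 := Nat.Coprime.dvd_of_dvd_mul_right
    (Nat.Coprime.pow_left j (hs.coprime_iff_not_dvd.2 hsE)) h2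
  have h4 : s ^ j ≤ Nat.card E + 1 := by
    by_cases h5 : s ∣ Nat.card E + 1
    · have h6 : ¬ s ∣ Nat.card E - 1 := by
        intro h6
        have h7 := Nat.dvd_sub h5 h6
        rw [show Nat.card E + 1 - (Nat.card E - 1) = 2 by omega,
          Nat.prime_dvd_prime_iff_eq hs Nat.prime_two] at h7
        exact hs2 h7
      exact Nat.le_of_dvd (by omega) (Nat.Coprime.dvd_of_dvd_mul_right
        (Nat.Coprime.pow_left j (hs.coprime_iff_not_dvd.2 h6)) h3)
    · have h6 := Nat.le_of_dvd (by omega) (Nat.Coprime.dvd_of_dvd_mul_left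
        (Nat.Coprime.pow_left j (hs.coprime_iff_not_dvd.2 h5)) h3)
      omega
  have h5 : 1 < s ^ j := Nat.one_lt_pow hj0 hs.one_lt
  rw [hj] at h1
  have h6 := Nat.le_of_dvd (by omega) h1
  omega

variable {G : Type*} [Group G] [Finite G] {K : Subgroup G} [K.Normal] {n q : ℕ}
  {J E : Type*} [Fintype J] [DecidableEq J] [Field E] [Finite E]
  {φ : SpecialLinearGroup (Fin 2 ⊕ J) E →* G ⧸ K}

theorem IsSLCover.false_of_torus (h : IsSLCover φ) (v : ℕ) [Fact v.Prime] [CharP E v]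
    (hE : ∃ c : E, c ≠ 0 ∧ c ^ 2 ≠ 1) (hu : 3 < Nat.card E) (hJ : 2 ≤ Fintype.card J)
    (hG : HasPSpSpectrum G n q) (hq : 3 ≤ q) (hodd : Odd q) (hn : Even n) (hn1 : 6 ≤ n)
    (hn2 : n ≤ 16) {e s : ℕ} (he : e = Fintype.card J + 1 ∨ e = Fintype.card J + 2)
    (hs : s.Prime) (hsu : s ∣ Nat.card E ^ 2 - 1) (y : SpecialLinearGroup (Fin 2 ⊕ J) E)
    (hsy : s ∣ orderOf (φ y)) (hyh : orderOf (φ y) ∣ (q ^ n + 1) / 2)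
    (hye : ∀ t, t.Prime → orderOf (Nat.card E : ZMod t) = e → t ∣ orderOf (φ y))
    (hyo : Nat.card E ^ (Fintype.card J + 1) - 1 ≤ orderOf y) : False := by
  have : Nonempty J := Fintype.card_pos_iff.1 (by omega)
  have hsh := hsy.trans hyh
  obtain ⟨hs2, -, hs4, -⟩ := orderOf_of_prime_dvd_half hodd hn (by omega) hs hsh
  obtain ⟨a, ha⟩ : ∃ a, a = if n = 16 then 13 else n - 1 := ⟨_, rfl⟩
  have hA : ∀ t r, Nonadjacent G t r → Nonadjacent (G ⧸ K) t r := fun t r hna =>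
    hna.of_surjective (QuotientGroup.mk' K) (QuotientGroup.mk'_surjective K)
  have hts : ∀ t, t.Prime → (orderOf (q : ZMod t) = a ∨ orderOf (q : ZMod t) = 2 * a) →
      t ≠ s ∧ Nonadjacent G t s := by
    intro t ht hti
    refine ⟨?_, hG.nonadjacent_of_dvd_half hodd hn hn1 hn2 hs ht hsh (ha ▸ hti)⟩
    rintro rfl
    obtain ⟨c, hc⟩ := hs4
    obtain ⟨b, rfl⟩ := hn
    rw [hc] at hti
    split_ifs at ha <;> omega
  have hsJ : s ∣ Nat.card (SpecialLinearGroup J E) :=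
    dvd_card_specialLinearGroup_of_dvd_pow_sub_one le_rfl hJ hsu
  have hs22 : s ∣ Nat.card (SpecialLinearGroup (Fin 2) E) :=
    dvd_card_specialLinearGroup_of_dvd_pow_sub_one le_rfl (by simp) hsu
  obtain ⟨Q, hQ, hQc⟩ := h.exists_noncyclic_isPGroup hs (hs.odd_of_ne_two hs2) hs22 hsJ
  have hK : ∀ t, t.Prime → (orderOf (q : ZMod t) = a ∨ orderOf (q : ZMod t) = 2 * a) →
      ¬ t ∣ Nat.card K := fun t ht hti =>
    not_dvd_card_of_noncyclic_quotient K ht hs (hts t ht hti).1 (hs.odd_of_ne_two hs2)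
      (hts t ht hti).2 Q hQ hQc
  have hS : ∀ t, t.Prime → (orderOf (q : ZMod t) = a ∨ orderOf (q : ZMod t) = 2 * a) →
      t ∣ Nat.card φ.range →
      orderOf (Nat.card E : ZMod t) = 2 * Fintype.card J + 3 - e := by
    intro t ht hti htS
    obtain ⟨hne, hna⟩ := hts t ht hti
    have h1 : ¬ t ∣ Nat.card (SpecialLinearGroup J E) := fun h1 =>
      h.not_nonadjacent_of_dvd_card hs ht hne hs22 h1 (hA _ _ hna)
    have h2 := orderOf_eq_of_dvd_card_of_not_dvd_card hJ ht
      (htS.trans (Subgroup.card_range_dvd φ)) h1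
    have h3 : orderOf (Nat.card E : ZMod t) ≠ e := fun h3 => hA _ _ hna (φ y)
      (((Nat.coprime_primes ht hs).2 hne).mul_dvd_of_dvd_of_dvd (hye t ht h3) hsy)
    omega
  have hex : ∃ i, (i = a ∨ i = 2 * a) ∧
      ∀ t, t.Prime → orderOf (q : ZMod t) = i → ¬ t ∣ Nat.card φ.range := by
    by_contra! hcon
    obtain ⟨t, ht, hti, htS⟩ := hcon a (Or.inl rfl)
    obtain ⟨t', ht', hti', htS'⟩ := hcon (2 * a) (Or.inr rfl)
    obtain ⟨z, hz, -⟩ := h.exists_torus hJ (e := 2 * Fintype.card J + 3 - e) (by omega)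
    have hne : t ≠ t' := by
      rintro rfl
      split_ifs at ha <;> omega
    refine hA _ _ (hG.nonadjacent_of_orderOf hodd hn hn1 hn2 ht ht' (ha ▸ hti) (ha ▸ hti')) (φ z) ?_
    exact ((Nat.coprime_primes ht ht').2 hne).mul_dvd_of_dvd_of_dvd
      (hz t ht (hS t ht (Or.inl hti) htS)) (hz t' ht' (hS t' ht' (Or.inr hti') htS'))
  obtain ⟨i, hi, hiS⟩ := hex
  have ha0 : a ≠ 0 := by split_ifs at ha <;> omega
  have hprime : ∀ t, t.Prime → t ∣ kpart i q → orderOf (q : ZMod t) = i := fun t ht htk =>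
    (prime_dvd_kpart_iff ht (by omega) (by omega)).1 htk
  have hprime' : ∀ t, t.Prime → t ∣ kpart i q →
      (orderOf (q : ZMod t) = a ∨ orderOf (q : ZMod t) = 2 * a) := fun t ht htk => by
    rw [hprime t ht htk]
    exact hi
  obtain ⟨g, hg⟩ := hG.exists_orderOf_eq_kpart hq hodd hn1 (ha ▸ hi)
  have hg' : orderOf (g : G ⧸ K) = kpart i q := by
    rw [orderOf_mk_eq_of_coprime_card, hg]
    rw [hg]
    exact Nat.coprime_of_dvd fun t ht htk htK => hK t ht (hprime' t ht htk) htK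
  have hle := h.le_card_of_nonadjacent v hE hs hs2 hsu (g : G ⧸ K)
    (fun t ht htk => by
      rw [hg'] at htk
      obtain ⟨h1, h2⟩ := hts t ht (hprime' t ht htk)
      exact ⟨h1, hA _ _ h2⟩)
    (by
      rw [hg']
      exact Nat.coprime_of_dvd fun t ht htk htS => hiS t ht (hprime t ht htk) htS)
  rw [hg'] at hle
  have h1 := cube_bound hq hodd hn1 hn2 hn a ha i hi
  have h2 : orderOf (φ y) ≤ (q ^ n + 1) / 2 :=
    Nat.le_of_dvd (odd_half hodd hn).pos hyh
  have h3 := cube_le_of_torus (m := Fintype.card J + 2) (N := q ^ n + 1) hu (by omega)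
    (w := orderOf (φ y)) (by omega) hyo (by
      refine (Nat.le_of_dvd ?_ (h.orderOf_dvd y)).trans (Nat.mul_le_mul_left _ ?_)
      · exact Nat.mul_pos (orderOf_pos _) (Nat.gcd_pos_of_pos_right _ (by omega))
      · refine (Nat.gcd_le_left _ (Fintype.card_pos)).trans ?_
        rw [Fintype.card_sum, Fintype.card_fin, add_comm])
  have h4 := Nat.pow_le_pow_left hle 3
  omega

theorem IsSLCover.sub_one_dvd_and_orderOf_eq (h : IsSLCover φ) (v : ℕ) [Fact v.Prime] [CharP E v]
    (hE : ∃ c : E, c ≠ 0 ∧ c ^ 2 ≠ 1) (hu : 3 < Nat.card E) (hJ : 2 ≤ Fintype.card J)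
    (hJe : Even (Fintype.card J)) (hG : HasPSpSpectrum G n q) (hq : 3 ≤ q) (hodd : Odd q)
    (hn : Even n) (hn1 : 6 ≤ n) (hn2 : n ≤ 16) {r : ℕ} (hr : r.Prime)
    (hrq : orderOf (q : ZMod r) = 2 * n) :
    (Nat.card E - 1) ∣ Fintype.card J + 2 ∧
      orderOf (Nat.card E : ZMod r) = Fintype.card J + 1 := by
  by_contra hcon
  have he := (h.orderOf_eq_and_pow_dvd v hE hJ hG hodd hn (by omega) hr hrq).1
  obtain ⟨y, hye, hyo, hy1, hy2⟩ := h.exists_torus hJ he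
  have hyh := hG.dvd_half_quotient (φ y) hr hrq (hye r hr rfl)
  have hcard : Fintype.card (Fin 2 ⊕ J) = Fintype.card J + 2 := by
    rw [Fintype.card_sum, Fintype.card_fin, add_comm]
  have hgo := h.orderOf_dvd y
  rw [hcard] at hgo
  obtain ⟨s, hs, hsu, hsy⟩ := exists_prime_dvd_of_torus (m := Fintype.card J + 2) hu
    (hJe.add even_two) ((odd_half hodd hn).of_dvd_nat hyh) hgo (by
      rcases he with he | he
      · exact Or.inl ⟨hy1 he, fun hd => hcon ⟨hd, he⟩⟩
      · exact Or.inr (hy2 he))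
  exact h.false_of_torus v hE hu hJ hG hq hodd hn hn1 hn2 he hs hsu y hsy hyh hye hyo

theorem IsSLCover.kpart_dvd (h : IsSLCover φ) (v : ℕ) [Fact v.Prime] [CharP E v]
    (hE : ∃ c : E, c ≠ 0 ∧ c ^ 2 ≠ 1) (hu : 3 < Nat.card E) (hJ : 2 ≤ Fintype.card J)
    (hJe : Even (Fintype.card J)) (hG : HasPSpSpectrum G n q) (hq : 3 ≤ q) (hodd : Odd q)
    (hn : Even n) (hn1 : 6 ≤ n) (hn2 : n ≤ 16) :
    (Nat.card E - 1) ∣ Fintype.card J + 2 ∧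
      kpart (2 * n) q ∣ kpart (Fintype.card J + 1) (Nat.card E) := by
  constructor
  · have key : ∀ n ∈ Finset.Icc 6 16, Even n → 2 * n ≤ 2 ^ (2 * n).totient := by decide +kernel
    obtain ⟨r, hr, hrq⟩ := exists_primitive_prime (i := 2 * n) (by omega)
      (key n (Finset.mem_Icc.2 ⟨hn1, hn2⟩) hn) hq hodd
    exact (h.sub_one_dvd_and_orderOf_eq v hE hu hJ hJe hG hq hodd hn hn1 hn2 hr hrq).1
  · refine kpart_dvd_of_forall (by omega) (by omega) fun r k hr hk0 hrq hk => ?_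
    have he := (h.sub_one_dvd_and_orderOf_eq v hE hu hJ hJe hG hq hodd hn hn1 hn2 hr hrq).2
    have h1 := (h.orderOf_eq_and_pow_dvd v hE hJ hG hodd hn (by omega) hr hrq).2 k hk0 hk
    rw [he] at h1
    exact (prime_pow_dvd_kpart_iff hr hk0 (by omega) (by omega)).2 ⟨he, h1⟩

end large_rank

section rank_one

open Matrix

/-- The diagonal torus of `SL₂`. -/
def slTorus (E : Type*) [Field E] : Eˣ →* SpecialLinearGroup (Fin 2) E where
  toFun c := ⟨diagonal ![(c : E), ((c⁻¹ : Eˣ) : E)], by simp [det_diagonal, Fin.prod_univ_two]⟩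
  map_one' := Subtype.ext (by
    change diagonal _ = 1
    rw [← diagonal_one]
    congr 1
    ext i
    fin_cases i <;> simp)
  map_mul' c d := Subtype.ext (by
    change diagonal _ = diagonal _ * diagonal _
    rw [diagonal_mul_diagonal]
    congr 1
    ext i
    fin_cases i <;> simp [mul_comm])

variable {E : Type*} [Field E]

theorem exists_slTorus_conj_stdRoot {i j : Fin 2} (hij : i ≠ j) :
    ∃ ε : Eˣ ≃ Eˣ, ∀ (c : Eˣ) (s : E),
      slTorus E c * stdRoot E hij (Multiplicative.ofAdd s) * (slTorus E c)⁻¹ =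
        stdRoot E hij (Multiplicative.ofAdd ((ε c : E) ^ 2 * s)) := by
  have key : ∀ ε : Eˣ ≃ Eˣ,
      (∀ (c : Eˣ) (s : E), (diagonal ![(c : E), ((c⁻¹ : Eˣ) : E)] : Matrix _ _ E) * single i j s =
        single i j ((ε c : E) ^ 2 * s) * (diagonal ![(c : E), ((c⁻¹ : Eˣ) : E)] : Matrix _ _ E)) →
      ∃ ε : Eˣ ≃ Eˣ, ∀ (c : Eˣ) (s : E),
        slTorus E c * stdRoot E hij (Multiplicative.ofAdd s) * (slTorus E c)⁻¹ =
          stdRoot E hij (Multiplicative.ofAdd ((ε c : E) ^ 2 * s)) := by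
    intro ε hε
    refine ⟨ε, fun c s => ?_⟩
    rw [mul_inv_eq_iff_eq_mul]
    apply Subtype.ext
    change (diagonal _ : Matrix _ _ E) * (stdRoot E hij _).1 = (stdRoot E hij _).1 * diagonal _
    rw [coe_stdRoot, coe_stdRoot, mul_add, add_mul, mul_one, one_mul, toAdd_ofAdd, toAdd_ofAdd, hε]
  fin_cases i <;> fin_cases j
  · exact absurd rfl hij
  · refine key (Equiv.refl _) fun c s => ?_
    ext a b
    fin_cases a <;> fin_cases b <;> simp [mul_diagonal]
    field_simp
  · refine key (Equiv.inv _) fun c s => ?_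
    ext a b
    fin_cases a <;> fin_cases b <;> simp [mul_diagonal]
    field_simp
  · exact absurd rfl hij

theorem exists_sq_sub_sq_of_finite [Finite E] (a : E) : ∃ x y : E, a = x ^ 2 - y ^ 2 := by
  by_cases h2 : (2 : E) = 0
  · have : CharP E 2 := CharTwo.of_one_ne_zero_of_two_eq_zero one_ne_zero h2
    obtain ⟨x, hx⟩ := FiniteField.isSquare_of_char_two (ringChar.eq_iff.2 this) a
    exact ⟨x, 0, by rw [hx]; ring⟩
  · exact ⟨(a + 1) / 2, (a - 1) / 2, by field_simp; ring⟩

variable {A J : Type*} [Fintype J] [DecidableEq J] [Group A]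
  {φ : SpecialLinearGroup (Fin 2 ⊕ J) E →* A}

/-- The image of the torus of the block `SL₂`. -/
def blockTorus (φ : SpecialLinearGroup (Fin 2 ⊕ J) E →* A) : Eˣ →* A :=
  ((φ.comp (slBlock (Fin 2) J E)).comp (MonoidHom.inl _ _)).comp (slTorus E)

theorem exists_blockTorus_conj_stdRoot (φ : SpecialLinearGroup (Fin 2 ⊕ J) E →* A) {i j : Fin 2}
    (hij : i ≠ j) : ∃ ε : Eˣ ≃ Eˣ, ∀ (c : Eˣ) (s : E),
      blockTorus φ c * φ (stdRoot E (Sum.inl_injective.ne hij) (Multiplicative.ofAdd s)) *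
        (blockTorus φ c)⁻¹ =
      φ (stdRoot E (Sum.inl_injective.ne hij) (Multiplicative.ofAdd ((ε c : E) ^ 2 * s))) := by
  obtain ⟨ε, h⟩ := exists_slTorus_conj_stdRoot (E := E) hij
  refine ⟨ε, fun c s => ?_⟩
  have := congrArg ((φ.comp (slBlock (Fin 2) J E)).comp (MonoidHom.inl _ _)) (h c s)
  rw [map_mul, map_mul, map_inv] at this
  rw [← slBlock_stdRoot hij, ← slBlock_stdRoot hij]
  exact this

theorem blockTorus_mem_oppositeNormalizer [Finite A] (c : Eˣ) :
    blockTorus φ c ∈ oppositeNormalizer φ := by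
  have key : ∀ {i j : Fin 2} (hij : i ≠ j), blockTorus φ c ∈
      Subgroup.normalizer (rootSubgroup φ (Sum.inl_injective.ne hij) : Set A) := by
    intro i j hij
    obtain ⟨ε, h⟩ := exists_blockTorus_conj_stdRoot φ hij
    refine Subgroup.mem_normalizer_fintype fun n hn => ?_
    obtain ⟨t, rfl⟩ := mem_rootSubgroup.1 hn
    exact mem_rootSubgroup.2 ⟨_, (h c t.toAdd).symm⟩
  exact ⟨key zero_ne_one, key one_ne_zero⟩

/-- An element centralizing the torus and a nontrivial root element centralizes the root
subgroup. -/
theorem commute_of_mem_rootSubgroup_of_commute_blockTorus [Finite E] {a : A}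
    (ha : ∀ c, Commute a (blockTorus φ c)) {i j : Fin 2} (hij : i ≠ j)
    (h : ∃ x ∈ rootSubgroup φ (Sum.inl_injective.ne hij), x ≠ 1 ∧ Commute a x) :
    ∀ x ∈ rootSubgroup φ (Sum.inl_injective.ne hij), Commute a x := by
  obtain ⟨x, hx, hx1, hax⟩ := h
  obtain ⟨s, rfl⟩ := mem_rootSubgroup.1 hx
  have hs : s.toAdd ≠ 0 := by
    intro hs
    have : s = 1 := hs
    rw [this, map_one, map_one] at hx1
    exact hx1 rfl
  set f : E → A := fun t => φ (stdRoot E (Sum.inl_injective.ne hij) (Multiplicative.ofAdd t))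
    with hf
  have hfs : ∀ x y, f (x - y) = f x * (f y)⁻¹ := fun x y => by
    simp only [hf, ofAdd_sub, div_eq_mul_inv, map_mul, map_inv]
  have hsq : ∀ c : E, Commute a (f (c ^ 2 * s.toAdd)) := by
    intro c
    by_cases hc : c = 0
    · simp [hf, hc]
    · obtain ⟨ε, hε⟩ := exists_blockTorus_conj_stdRoot φ hij
      obtain ⟨d, hd⟩ := ε.surjective (Units.mk0 c hc)
      have h1 := hε d s.toAdd
      rw [hd, Units.val_mk0] at h1
      simp only [hf]
      rw [← h1]
      exact ((ha d).mul_right hax).mul_right (ha d).inv_right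
  rintro _ hy
  obtain ⟨t, rfl⟩ := mem_rootSubgroup.1 hy
  obtain ⟨x, y, hxy⟩ := exists_sq_sub_sq_of_finite (t.toAdd / s.toAdd)
  have ht : t.toAdd = x ^ 2 * s.toAdd - y ^ 2 * s.toAdd := by
    rw [← sub_mul, ← hxy, div_mul_cancel₀ _ hs]
  have h1 : f t.toAdd = f (x ^ 2 * s.toAdd) * (f (y ^ 2 * s.toAdd))⁻¹ := by rw [ht, hfs]
  have h2 : φ (stdRoot E (Sum.inl_injective.ne hij) t) = f t.toAdd := rfl
  rw [h2, h1]
  exact (hsq x).mul_right (hsq y).inv_right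

theorem IsSLCover.apply_eq_zero_of_mem_normalizer {I : Type*} [Fintype I] [DecidableEq I]
    {φ : SpecialLinearGroup I E →* A} (h : IsSLCover φ) {o l : I} (hol : o ≠ l)
    {g : SpecialLinearGroup I E}
    (hg : φ g ∈ Subgroup.normalizer (rootSubgroup φ hol : Set A)) : g.1 l o = 0 := by
  obtain ⟨t, ht⟩ := mem_rootSubgroup.1 ((Subgroup.mem_normalizer_iff.1 hg _).1
    (mem_rootSubgroup.2 ⟨Multiplicative.ofAdd 1, rfl⟩))
  rw [eq_mul_inv_iff_mul_eq, ← map_mul, ← map_mul, eq_comm, ← mul_inv_eq_one, ← map_inv, ← map_mul,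
    h.map_eq_one_iff, Matrix.SpecialLinearGroup.mem_center_iff] at ht
  obtain ⟨c, -, hc⟩ := ht
  have h1 : g.1 * (stdRoot E hol (Multiplicative.ofAdd 1)).1 =
      scalar I c * ((stdRoot E hol t).1 * g.1) := by
    rw [hc]
    exact congrArg Subtype.val (inv_mul_cancel_right (g * stdRoot E hol (Multiplicative.ofAdd 1))
      (stdRoot E hol t * g)).symm
  rw [coe_stdRoot, coe_stdRoot, mul_add, add_mul, mul_one, one_mul] at h1
  have e1 := congrFun (congrFun h1 l) o
  have e2 := congrFun (congrFun h1 l) l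
  simp [hol, hol.symm] at e1 e2
  by_contra h0
  have hc1 : c = 1 := mul_right_cancel₀ h0 (by rw [← e1, one_mul])
  rw [hc1] at e2
  exact h0 (by linear_combination e2)

/-- If the complement of the block is empty, the inner part of the common normalizer of two opposite
root subgroups is the torus. -/
theorem IsSLCover.exists_eq_blockTorus [IsEmpty J] (h : IsSLCover φ) {a : A} (ha : a ∈ φ.range)
    (ha' : a ∈ oppositeNormalizer φ) : ∃ c, blockTorus φ c = a := by
  obtain ⟨g, rfl⟩ := ha
  have h1 := h.apply_eq_zero_of_mem_normalizer _ ha'.1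
  have h2 := h.apply_eq_zero_of_mem_normalizer _ ha'.2
  have hd : g.1 = diagonal fun i => g.1 i i := by
    ext i j
    rcases i with i | i
    · rcases j with j | j
      · fin_cases i <;> fin_cases j <;> simp [h1, h2]
      · exact isEmptyElim j
    · exact isEmptyElim i
  have hdet := g.2
  rw [hd, det_diagonal, Fintype.prod_sum_type, Fin.prod_univ_two, Fintype.prod_empty, mul_one]
    at hdet
  refine ⟨⟨g.1 (Sum.inl 0) (Sum.inl 0), g.1 (Sum.inl 1) (Sum.inl 1), hdet, by rwa [mul_comm]⟩,
    congrArg φ ?_⟩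
  apply Subtype.ext
  change fromBlocks (diagonal ![g.1 (Sum.inl 0) (Sum.inl 0), g.1 (Sum.inl 1) (Sum.inl 1)]) 0 0 1 =
    g.1
  ext i j
  rcases i with i | i
  · rcases j with j | j
    · fin_cases i <;> fin_cases j <;> simp [h1, h2]
    · exact isEmptyElim j
  · exact isEmptyElim i

/-- If the complement of the block is empty, a nontrivial outer element of prime order not dividing
`u - 1` does not centralize the torus. -/
theorem IsSLCover.eq_one_of_commute_blockTorus [Finite E] [Finite A] [IsEmpty J] (h : IsSLCover φ)
    (v : ℕ) [Fact v.Prime] [CharP E v] {a : A} (ha : a ∈ oppositeNormalizer φ)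
    (hp : (orderOf a).Prime) (hau : ¬ orderOf a ∣ Nat.card E - 1)
    (hc : ∀ c, Commute a (blockTorus φ c)) : False := by
  have key : ∀ {i j : Fin 2} (hij : i ≠ j),
      a ∈ Subgroup.normalizer (rootSubgroup φ (Sum.inl_injective.ne hij) : Set A) →
      ∀ x ∈ rootSubgroup φ (Sum.inl_injective.ne hij), Commute a x := by
    intro i j hij haN
    refine commute_of_mem_rootSubgroup_of_commute_blockTorus hc hij ?_
    by_contra! hcon
    refine hau ?_
    rw [← h.card_rootSubgroup v (Sum.inl_injective.ne hij)]
    refine orderOf_dvd_card_sub_one _ a haN fun x hx hx1 k hk => ?_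
    by_contra hk1
    have hmem : a ∈ Subgroup.zpowers (a ^ k) := by
      have h1 : orderOf (a ^ k) = orderOf a :=
        (hp.eq_one_or_self_of_dvd _ (orderOf_dvd_of_mem_zpowers ⟨k, rfl⟩)).resolve_left
          (by rwa [orderOf_eq_one_iff])
      have h2 : Subgroup.zpowers (a ^ k) = Subgroup.zpowers a :=
        Subgroup.eq_of_le_of_card_ge (Subgroup.zpowers_le.2 ⟨k, rfl⟩)
          (by rw [Nat.card_zpowers, Nat.card_zpowers, h1])
      rw [h2]
      exact Subgroup.mem_zpowers a
    obtain ⟨i, hi⟩ := hmem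
    refine hcon x hx hx1 ?_
    have h1 : Commute ((a ^ k) ^ i) x := Commute.zpow_left hk i
    rwa [show (a ^ k) ^ i = a from hi] at h1
  have hle : ((φ.comp (slBlock (Fin 2) J E)).comp (MonoidHom.inl _ _)).range ≤
      Subgroup.centralizer {a} := by
    rw [← sup_rootSubgroup_eq_range, sup_le_iff]
    exact ⟨fun x hx => Subgroup.mem_centralizer_singleton_iff.2 (key zero_ne_one ha.1 x hx).eq.symm,
      fun x hx => Subgroup.mem_centralizer_singleton_iff.2 (key one_ne_zero ha.2 x hx).eq.symm⟩
  have ha1 : a = 1 := by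
    refine h.eq_one_of_centralizes a fun g => ?_
    have hg : slBlock (Fin 2) J E (slReindex E (Equiv.sumEmpty (Fin 2) J) g, 1) = g := by
      apply Subtype.ext
      rw [coe_slBlock]
      ext i j
      rcases i with i | i
      · rcases j with j | j
        · rfl
        · exact isEmptyElim j
      · exact isEmptyElim i
    exact (Subgroup.mem_centralizer_singleton_iff.1 (hle ⟨_, congrArg φ hg⟩)).symm
  rw [ha1, orderOf_one] at hp
  exact Nat.not_prime_one hp

/-- If the complement of the block is empty, the outer automorphisms act on the torus through an
abelian group. -/
theorem IsSLCover.not_nonadjacent_of_dvd_index [Finite E] [Finite A] [IsEmpty J] (h : IsSLCover φ)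
    (v : ℕ) [Fact v.Prime] [CharP E v] (hE : ∃ c : E, c ≠ 0 ∧ c ^ 2 ≠ 1) {s t : ℕ} (hs : s.Prime)
    (ht : t.Prime) (hst : s ≠ t) (hsi : s ∣ φ.range.index) (hti : t ∣ φ.range.index)
    (hsu : ¬ s ∣ Nat.card E - 1) (htu : ¬ t ∣ Nat.card E - 1) : ¬ Nonadjacent A s t := by
  intro hna
  have hN := h.normal
  have hcyc : IsCyclic (φ.range.subgroupOf (oppositeNormalizer φ)) := by
    have h1 : IsCyclic (blockTorus φ).range :=
      isCyclic_of_surjective (blockTorus φ).rangeRestrict (blockTorus φ).rangeRestrict_surjective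
    let f : φ.range.subgroupOf (oppositeNormalizer φ) →* (blockTorus φ).range :=
      ((oppositeNormalizer φ).subtype.comp
        (φ.range.subgroupOf (oppositeNormalizer φ)).subtype).codRestrict _
        fun x => h.exists_eq_blockTorus x.2 x.1.2
    refine isCyclic_of_injective f fun x y hxy => ?_
    exact Subtype.ext (Subtype.ext (congrArg (fun z : (blockTorus φ).range => z.1) hxy))
  let ρ : oppositeNormalizer φ →* MulAut (φ.range.subgroupOf (oppositeNormalizer φ)) :=
    MulAut.conjNormal
  have hρ : ∀ {t : ℕ}, t.Prime → t ∣ φ.range.index → ¬ t ∣ Nat.card E - 1 →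
      ∃ a, orderOf (ρ a) = t := by
    intro t ht hti htu
    obtain ⟨b, hb, hbo⟩ := h.exists_orderOf_eq_of_dvd_index v hE ht hti
    refine ⟨⟨b, hb⟩, ?_⟩
    have h1 : orderOf (ρ ⟨b, hb⟩) ∣ t := by
      rw [← hbo, ← Subgroup.orderOf_mk b hb]
      exact orderOf_map_dvd ρ _
    refine (ht.eq_one_or_self_of_dvd _ h1).resolve_left fun h2 => ?_
    rw [orderOf_eq_one_iff] at h2
    refine h.eq_one_of_commute_blockTorus v hb (hbo ▸ ht) (hbo ▸ htu) fun c => ?_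
    have h3 := congrArg (fun x => ((x.1 : oppositeNormalizer φ) : A))
      (DFunLike.congr_fun h2 ⟨⟨_, blockTorus_mem_oppositeNormalizer c⟩, ⟨_, rfl⟩⟩)
    exact mul_inv_eq_iff_eq_mul.1 h3
  obtain ⟨a, ha⟩ := hρ hs hsi hsu
  obtain ⟨b, hb⟩ := hρ ht hti htu
  have hab : Commute (ρ a) (ρ b) := by
    let e := IsCyclic.mulAutMulEquiv (φ.range.subgroupOf (oppositeNormalizer φ))
    apply e.injective
    rw [map_mul, map_mul, mul_comm]
  have h1 := hab.orderOf_mul_eq_mul_orderOf_of_coprime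
    (by rw [ha, hb]; exact (Nat.coprime_primes hs ht).2 hst)
  rw [← map_mul, ha, hb] at h1
  refine hna ((a * b : oppositeNormalizer φ) : A) ?_
  rw [Subgroup.orderOf_coe, ← h1]
  exact orderOf_map_dvd ρ _

end rank_one

section conclusion

open Matrix

variable {G : Type*} [Group G] [Finite G] {K : Subgroup G} [K.Normal] [Group.IsSolvable K]
  {J E : Type*} [Fintype J] [DecidableEq J] [Field E] [Finite E]
  {φ : SpecialLinearGroup (Fin 2 ⊕ J) E →* G ⧸ K}

/-- A group with socle `PSL₂(u)` modulo its solvable radical does not have five pairwise nonadjacent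
odd primes. -/
theorem IsSLCover.false_of_five_nonadjacent [IsEmpty J] (h : IsSLCover φ) (v : ℕ) [Fact v.Prime]
    [CharP E v] (hE : ∃ c : E, c ≠ 0 ∧ c ^ 2 ≠ 1) {t : Fin 5 → ℕ} (ht : ∀ i, (t i).Prime)
    (ht2 : ∀ i, t i ≠ 2) (hne : ∀ i j, i ≠ j → t i ≠ t j)
    (hna : ∀ i j, i ≠ j → Nonadjacent G (t i) (t j)) (hex : ∀ i, ∃ g : G, orderOf g = t i) :
    False := by
  have hN := h.normal
  have hu1 : 1 < Nat.card E := Finite.one_lt_card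
  have hA : ∀ i j, i ≠ j → Nonadjacent (G ⧸ K) (t i) (t j) := fun i j hij =>
    (hna i j hij).of_surjective (QuotientGroup.mk' K) (QuotientGroup.mk'_surjective K)
  have hG : ∀ i, t i ∣ Nat.card G := fun i => by
    obtain ⟨g, hg⟩ := hex i
    exact hg ▸ orderOf_dvd_natCard g
  have hcard : Fintype.card (Fin 2 ⊕ J) = 2 := by simp
  have htorus : ∀ {N : ℕ} (y : SpecialLinearGroup (Fin 2 ⊕ J) E), orderOf y = N →
      ∀ i j, t i ∣ N → t j ∣ N → i = j := by
    intro N y hy i j hi hj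
    have key : ∀ i, t i ∣ N → t i ∣ orderOf (φ y) := by
      intro i hi
      have h1 := h.orderOf_dvd y
      rw [hy, hcard] at h1
      refine Nat.Coprime.dvd_of_dvd_mul_right ?_ (hi.trans h1)
      exact Nat.Coprime.coprime_dvd_right (Nat.gcd_dvd_left _ _)
        ((Nat.coprime_primes (ht i) Nat.prime_two).2 (ht2 i))
    by_contra hij
    exact hA i j hij (φ y) (((Nat.coprime_primes (ht i) (ht j)).2
      (hne i j hij)).mul_dvd_of_dvd_of_dvd (key i hi) (key j hj))
  obtain ⟨y₁, hy₁⟩ := exists_sl_orderOf_eq_pow_sub_one (Fin 2 ⊕ J) E (by omega)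
  obtain ⟨y₂, hy₂⟩ := exists_sl_orderOf_eq_div (Fin 2 ⊕ J) E
  have hsq : Nat.card E ^ 2 - 1 = (Nat.card E + 1) * (Nat.card E - 1) := by
    rw [← Nat.sq_sub_sq, one_pow]
  rw [hcard, pow_one] at hy₁
  rw [hcard, hsq, Nat.mul_div_cancel _ (by omega)] at hy₂
  let P : Fin 5 → Fin 5 → Prop := ![fun i => t i ∣ Nat.card K,
    fun i => t i ∣ φ.range.index ∧ ¬ t i ∣ Nat.card E - 1, fun i => t i ∣ Nat.card E,
    fun i => t i ∣ Nat.card E - 1, fun i => t i ∣ Nat.card E + 1]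
  have hP : ∀ i, ∃ c, P c i := by
    intro i
    by_cases h3 : t i ∣ Nat.card E - 1
    · exact ⟨3, h3⟩
    have h1 := hG i
    rw [← K.index_mul_card, Subgroup.index_eq_card, (ht i).dvd_mul, ← φ.range.index_mul_card,
      (ht i).dvd_mul] at h1
    rcases h1 with (h1 | h1) | h1
    · exact ⟨1, h1, h3⟩
    · rcases exists_of_prime_dvd_card_specialLinearGroup (ht i)
        (h1.trans (Subgroup.card_range_dvd φ)) with h2 | ⟨j, hj1, hj2, hj⟩
      · exact ⟨2, h2⟩
      · obtain rfl : j = 2 := by omega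
        rw [hsq, (ht i).dvd_mul] at hj
        exact ⟨4, hj.resolve_right h3⟩
    · exact ⟨0, h1⟩
  have huniq : ∀ c i j, P c i → P c j → i = j := by
    intro c i j hi hj
    by_contra hij
    fin_cases c
    · obtain ⟨k, hki, hkj⟩ : ∃ k, i ≠ k ∧ j ≠ k :=
        (by decide : ∀ i j : Fin 5, ∃ k, i ≠ k ∧ j ≠ k) i j
      exact false_of_two_in_solvable K (ht i) (ht j) (ht k) (hne i j hij) (hne i k hki)
          (hne j k hkj)
        (hna i j hij) (hna i k hki) (hna j k hkj) hi hj (hG k)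
    · exact h.not_nonadjacent_of_dvd_index v hE (ht i) (ht j) (hne i j hij) hi.1 hj.1 hi.2 hj.2
        (hA i j hij)
    · have := Fintype.ofFinite E
      obtain ⟨n, -, hn⟩ := FiniteField.card E v
      have key : ∀ i, P 2 i → t i = v := by
        intro i hi
        have h1 : t i ∣ Nat.card E := hi
        rw [Nat.card_eq_fintype_card, hn] at h1
        exact (Nat.prime_dvd_prime_iff_eq (ht i) Fact.out).1 ((ht i).dvd_of_dvd_pow h1)
      exact hne i j hij ((key i hi).trans (key j hj).symm)
    · exact hij (htorus y₁ hy₁ i j hi hj)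
    · exact hij (htorus y₂ hy₂ i j hi hj)
  choose f hf using hP
  have hfinj : Function.Injective f := fun i j hij => huniq (f i) i j (hf i) (hij ▸ hf j)
  have hfsurj := Finite.surjective_of_injective hfinj
  have hsurj : ∀ c, ∃ i, f i = c ∧ P c i := fun c => by
    obtain ⟨i, rfl⟩ := hfsurj c
    exact ⟨i, rfl, hf i⟩
  obtain ⟨i, hi, hiK⟩ := hsurj 0
  obtain ⟨j, hj, hji⟩ := hsurj 1
  obtain ⟨k, hk, hkE⟩ := hsurj 2
  have hik : i ≠ k := by rintro rfl; exact absurd (hi.symm.trans hk) (by decide)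
  have hij : i ≠ j := by rintro rfl; exact absurd (hi.symm.trans hj) (by decide)
  have hkj : k ≠ j := by rintro rfl; exact absurd (hk.symm.trans hj) (by decide)
  refine false_of_three_step K (φ.range.comap (QuotientGroup.mk' K)) ?_ (ht i) (ht k) (ht j)
    (hne i k hik) (hne i j hij) (hne k j hkj) (hna i k hik) (hna i j hij) (hna k j hkj) hiK ?_ ?_
  · intro x hx
    rw [Subgroup.mem_comap, QuotientGroup.mk'_apply, (QuotientGroup.eq_one_iff x).2 hx]
    exact one_mem _
  · have := Fact.mk (ht k)
    have h1 : t k ∣ Nat.card (rootSubgroup φ (Sum.inl_injective.ne (zero_ne_one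
        (α := Fin 2)))) := by
      rw [h.card_rootSubgroup v]
      exact hkE
    obtain ⟨⟨x, hx⟩, hxo⟩ := exists_prime_orderOf_dvd_card' (t k) h1
    obtain ⟨w, rfl⟩ := QuotientGroup.mk_surjective x
    obtain ⟨s, hs⟩ := mem_rootSubgroup.1 hx
    rw [Subgroup.orderOf_mk] at hxo
    exact ⟨w, ⟨_, hs⟩, dvd_of_eq hxo.symm⟩
  · have := Fact.mk (ht j)
    have h1 : t j ∣ Nat.card (G ⧸ φ.range.comap (QuotientGroup.mk' K)) := by
      rw [← Subgroup.index_eq_card, Subgroup.index_comap_of_surjective _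
        (QuotientGroup.mk'_surjective K)]
      exact hji.1
    obtain ⟨x, hx⟩ := exists_prime_orderOf_dvd_card' (t j) h1
    obtain ⟨w, rfl⟩ := QuotientGroup.mk_surjective x
    exact ⟨w, dvd_of_eq hx.symm⟩

end conclusion

/-- Let `L = PSp_{2n}(q)`, `q` a power of an odd prime `p`, `n` even with
`6 ≤ n ≤ 16`. If a finite group `G` with `ω(G) = ω(L)` is not almost simple
with socle `L`, `K` is its solvable radical, and `G/K` embeds into `Aut S`
above `Inn S` for `S = PSL_m(u)` with `m` even and `u > 3` a power of a prime
`v ≠ p`, then `u - 1` divides `m` and `k_{2n}(q)` divides `k_{m-1}(u)`. -/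
theorem kpart_dvd_of_psl_even_quotient
    (p k q : ℕ) (hp : p.Prime) (hpodd : Odd p) (hk : 0 < k) (hq : q = p ^ k)
    (n : ℕ) (hn1 : 6 ≤ n) (hn2 : n ≤ 16) (hneven : Even n)
    (F : Type) [Field F] [Fintype F] (hF : Fintype.card F = q)
    (G : Type) [Group G] [Finite G]
    (hspec : elementOrders G = elementOrders (PSp n F))
    (hnas : ¬ IsAlmostSimpleWithSocle G (PSp n F))
    (K : Subgroup G) (hKnorm : K.Normal) (hKsolv : IsSolvable K)
    (hKrad : ∀ K' : Subgroup G, K'.Normal → IsSolvable K' → K' ≤ K)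
    (m : ℕ) (hmeven : Even m)
    (u v l : ℕ) (hv : v.Prime) (hl : 0 < l) (hu : u = v ^ l)
    (hu3 : 3 < u) (hvp : v ≠ p)
    (F' : Type) [Field F'] [Fintype F'] (hF' : Fintype.card F' = u)
    (ι : G ⧸ K →* MulAut (PSL m F')) (hι : Function.Injective ι)
    (hInn : (MulAut.conj (G := PSL m F')).range ≤ ι.range) :
    (u - 1) ∣ m ∧ kpart (2 * n) q ∣ kpart (m - 1) u := by
  have := Fact.mk hv
  have hq3 : 3 ≤ q := by
    have h1 : p ≠ 1 := hp.ne_one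
    have h2 := Nat.le_self_pow hk.ne' p
    have h3 := hp.pos
    obtain ⟨c, rfl⟩ := hpodd
    omega
  have hqodd : Odd q := hq ▸ hpodd.pow
  have hG : HasPSpSpectrum G n q := by
    rw [← hF]
    exact hasPSpSpectrum_of_elementOrders_eq (by omega) (hF.symm ▸ hqodd) hspec
  have hchar : CharP F' v := by
    obtain ⟨w, hw⟩ := CharP.exists F'
    obtain ⟨j, hwp, hj⟩ := FiniteField.card F' w
    rw [hF', hu] at hj
    have h1 : v ∣ w ^ (j : ℕ) := hj ▸ dvd_pow_self v hl.ne'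
    rwa [(Nat.prime_dvd_prime_iff_eq hv hwp).1 (hv.dvd_of_dvd_pow h1)]
  have hcard : Nat.card F' = u := by rw [Nat.card_eq_fintype_card, hF']
  have hE : ∃ c : F', c ≠ 0 ∧ c ^ 2 ≠ 1 := by
    classical
    by_contra! hcon
    have h1 : (Finset.univ : Finset F') ⊆ {0, 1, -1} := by
      intro c _
      by_cases hc : c = 0
      · simp [hc]
      · rcases mul_self_eq_one_iff.1 ((pow_two c).symm.trans (hcon c hc)) with h | h <;> simp [h]
    have h2 := (Finset.card_le_card h1).trans Finset.card_le_three
    rw [Finset.card_univ] at h2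
    omega
  have hsolv : Group.IsSolvable K := hKsolv
  obtain ⟨t, ht, ht2, hne, hna, hex⟩ := hG.exists_five_nonadjacent hq3 hqodd hneven hn1 hn2
  obtain ⟨φ, hφ, -⟩ := exists_isSLCover v ι hι hInn
  rcases Nat.eq_zero_or_pos m with rfl | hm
  · have h0 : Subsingleton (PSL 0 F') :=
      (QuotientGroup.mk_surjective (s := Subgroup.center _)).subsingleton
    have h0' : Subsingleton (MulAut (PSL 0 F')) := ⟨fun f g => MulEquiv.ext fun _ => Subsingleton.elim _ _⟩
    have h1 : Subsingleton (G ⧸ K) := hι.subsingleton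
    have h2 : ∀ i, t i ∣ Nat.card G := fun i => by
      obtain ⟨g, hg⟩ := hex i
      exact hg ▸ orderOf_dvd_natCard g
    have h3 : Nat.card K = Nat.card G := by
      rw [← K.index_mul_card, Subgroup.index_eq_card, Nat.card_of_subsingleton (1 : G ⧸ K), one_mul]
    exact (false_of_two_in_solvable K (ht 0) (ht 1) (ht 2) (hne 0 1 (by decide))
      (hne 0 2 (by decide)) (hne 1 2 (by decide)) (hna 0 1 (by decide)) (hna 0 2 (by decide))
      (hna 1 2 (by decide)) (h3 ▸ h2 0) (h3 ▸ h2 1) (h2 2)).elim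
  · obtain ⟨j, rfl⟩ : ∃ j, m = 2 + j := by
      obtain ⟨c, rfl⟩ := hmeven
      exact ⟨2 * c - 2, by omega⟩
    have hψ := hφ.comp_equiv finSumFinEquiv
    rcases Nat.eq_zero_or_pos j with rfl | hj
    · exact (hψ.false_of_five_nonadjacent v hE ht ht2 hne hna hex).elim
    · have hje : Even j := by
        rwa [Nat.even_add, iff_true_left even_two] at hmeven
      have hj2 : 2 ≤ j := by
        obtain ⟨c, rfl⟩ := hje
        omega
      have := hψ.kpart_dvd v hE (by omega) (by simpa using hj2) (by simpa using hje) hG hq3 hqodd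
        hneven hn1 hn2
      rwa [Fintype.card_fin, hcard, show j + 1 = 2 + j - 1 by omega, add_comm j 2] at this
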